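/- arXiv:0808.2910 — 2 statements merged into one kernel-verified Lean document; each statement's English description precedes it below -/
import Mathlib

section
/- Let F ∈ Z[x_1,…,x_n] be a homogeneous polynomial of degree d ≥ 3 (n ≥ 3) defining a non-singular hypersurface in P^{n-1}_Q. Then the set P(F) of primes p for which F fails at least one of the conditions (R_0(p)), (R_1(p)), (R_2(p)) is finite, and there are constants C, κ depending only on n and d such that ∏_{p ∈ P(F)} p ≤ C ‖F‖^κ, where ‖F‖ is the maximum absolute value of the coefficients of F. -/
open MvPolynomial

noncomputable section

/-- The zero locus in `K^n` of a set of polynomials. -/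
def zeroLocusSet {K : Type*} [Field K] {n : ℕ} (S : Set (MvPolynomial (Fin n) K)) :
    Set (Fin n → K) := {x | ∀ f ∈ S, eval x f = 0}

/-- The vanishing ideal of a set of points of `K^n`. -/
def vIdeal {K : Type*} [Field K] {n : ℕ} (S : Set (Fin n → K)) :
    Ideal (MvPolynomial (Fin n) K) where
  carrier := {f | ∀ x ∈ S, eval x f = 0}
  add_mem' := by intro a b ha hb x hx; simp [ha x hx, hb x hx]
  zero_mem' := by intro x hx; simp
  smul_mem' := by intro c f hf x hx; simp [smul_eq_mul, hf x hx]

/-- Dimension of (the Zariski closure of) a subset of `K^n`, as the Krull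
dimension of its affine coordinate ring. -/
def coneDim {K : Type*} [Field K] {n : ℕ} (S : Set (Fin n → K)) : WithBot ℕ∞ :=
  ringKrullDim (MvPolynomial (Fin n) K ⧸ vIdeal S)

/-- An `r×r` minor of the Jacobian matrix of a system of `r` polynomials,
given by a choice `c` of `r` columns. -/
def jacMinor {K : Type*} [Field K] {n r : ℕ} (f : Fin r → MvPolynomial (Fin n) K)
    (c : Fin r → Fin n) : MvPolynomial (Fin n) K :=
  (Matrix.of fun i j => pderiv (c j) (f i)).det

/-- The ideal of the singular locus (Jacobian criterion) of the system `f`. -/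
def singIdeal {K : Type*} [Field K] {n r : ℕ} (f : Fin r → MvPolynomial (Fin n) K) :
    Ideal (MvPolynomial (Fin n) K) :=
  Ideal.span (Set.range f ∪ Set.range (jacMinor f))

/-- The projective scheme cut out by the system `f` is non-singular: any prime
containing the singular ideal contains the irrelevant ideal. -/
def ProjNonsingular {K : Type*} [Field K] {n r : ℕ} (f : Fin r → MvPolynomial (Fin n) K) :
    Prop :=
  ∀ P : Ideal (MvPolynomial (Fin n) K), P.IsPrime → singIdeal f ≤ P →
    ∀ i, MvPolynomial.X i ∈ P

/-- The directional derivative polynomial `G^y = y · ∇G`. -/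
def polY {K : Type*} [Field K] {n : ℕ} (y : Fin n → K) (G : MvPolynomial (Fin n) K) :
    MvPolynomial (Fin n) K :=
  ∑ i, C (y i) * pderiv i G

end

noncomputable section

/-- Property (R₀): the hypersurface `V(G) ⊂ P^{n-1}` is non-singular. -/
def R0prop {k : Type*} [Field k] {n : ℕ} (G : MvPolynomial (Fin n) k) : Prop :=
  ProjNonsingular ![G]

/-- Property (R₁): for every `σ` (written `σ = u - 1`), the locus
`T_σ = {y : σ_y ≥ σ}`, where `σ_y = max {dim Sing V(G,G^y), dim Sing V(G^y)}`
(cone dimensions `≥ u`), has `dim T_σ ≤ n - 2 - σ` (cone dimension `≤ n - u`). -/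
def R1prop {k : Type*} [Field k] {n : ℕ} (G : MvPolynomial (Fin n) k) : Prop :=
  ∀ u : ℕ, u ≤ n →
    coneDim {y : Fin n → k |
        (u : WithBot ℕ∞) ≤
            ringKrullDim (MvPolynomial (Fin n) k ⧸ singIdeal ![G, polY y G]) ∨
          (u : WithBot ℕ∞) ≤
            ringKrullDim (MvPolynomial (Fin n) k ⧸ singIdeal ![polY y G])}
      ≤ ((n - u : ℕ) : WithBot ℕ∞)

/-- Property (R₂): for every `y` and every `s` (written `s = t - 1`), the locus
`T_{σ_y+s+1, y} = {z : dim Sing V(G, G^y, G^{y,z}) ≥ σ_y + s + 1}` (cone dimension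
`≥ u + t` where `u = σ_y + 1` bounds the cone dimensions of `Sing V(G,G^y)` and
`Sing V(G^y)`) has dimension `≤ n - 2 - s` (cone dimension `≤ n - t`). -/
def R2prop {k : Type*} [Field k] {n : ℕ} (G : MvPolynomial (Fin n) k) : Prop :=
  ∀ y : Fin n → k, ∀ u t : ℕ, t ≤ n →
    ringKrullDim (MvPolynomial (Fin n) k ⧸ singIdeal ![G, polY y G])
        ≤ (u : WithBot ℕ∞) →
    ringKrullDim (MvPolynomial (Fin n) k ⧸ singIdeal ![polY y G])
        ≤ (u : WithBot ℕ∞) →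
    coneDim {z : Fin n → k |
        ((u + t : ℕ) : WithBot ℕ∞) ≤
          ringKrullDim (MvPolynomial (Fin n) k ⧸
            singIdeal ![G, polY y G, polY z (polY y G)])}
      ≤ ((n - t : ℕ) : WithBot ℕ∞)

end

/-- The maximum absolute value of the coefficients of an integer polynomial. -/
def polyHeight {n : ℕ} (F : MvPolynomial (Fin n) ℤ) : ℕ :=
  F.support.sup fun m => (F.coeff m).natAbs

/-- `F` satisfies all of (R₀(p)), (R₁(p)), (R₂(p)): the reduction of `F` to any
algebraically closed field of characteristic `p` satisfies R₀, R₁ and R₂. -/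
def GoodPrime {n : ℕ} (F : MvPolynomial (Fin n) ℤ) (p : ℕ) : Prop :=
  ∀ (k : Type) (_ : Field k) (_ : IsAlgClosed k), ringChar k = p →
    R0prop (F.map (Int.castRingHom k)) ∧ R1prop (F.map (Int.castRingHom k)) ∧
      R2prop (F.map (Int.castRingHom k))

section Ultraproduct

/-- The ideal of families vanishing along an ultrafilter. -/
def ultraIdeal {ι : Type} (U : Ultrafilter ι) (K : ι → Type) [∀ i, Field (K i)] :
    Ideal (∀ i, K i) where
  carrier := {a | ∀ᶠ i in (U : Filter ι), a i = 0}
  add_mem' ha hb := by filter_upwards [ha, hb] with i h₁ h₂; simp [h₁, h₂]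
  zero_mem' := by simp
  smul_mem' c a ha := by
    filter_upwards [show ∀ᶠ i in (U : Filter ι), a i = 0 from ha] with i h; simp [h]

lemma mem_ultraIdeal {ι : Type} {U : Ultrafilter ι} {K : ι → Type} [∀ i, Field (K i)]
    {a : ∀ i, K i} : a ∈ ultraIdeal U K ↔ ∀ᶠ i in (U : Filter ι), a i = 0 := Iff.rfl

instance ultraIdeal_isMaximal {ι : Type} (U : Ultrafilter ι) (K : ι → Type) [∀ i, Field (K i)] :
    (ultraIdeal U K).IsMaximal := by
  classical
  rw [Ideal.isMaximal_iff]
  refine ⟨by simp [mem_ultraIdeal, U.neBot.ne], fun J a _ ha haJ => ?_⟩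
  rw [mem_ultraIdeal, ← Ultrafilter.eventually_not] at ha
  have h1 : (fun i => 1 - a i * (a i)⁻¹ : ∀ i, K i) ∈ J := by
    apply ‹ultraIdeal U K ≤ J›
    rw [mem_ultraIdeal]
    filter_upwards [ha] with i hi
    simp [hi]
  have h2 : a * (fun i => (a i)⁻¹) ∈ J := J.mul_mem_right _ haJ
  convert J.add_mem h1 h2 using 1
  funext i
  simp

/-- The ultraproduct of a family of fields. -/
def UProd {ι : Type} (U : Ultrafilter ι) (K : ι → Type) [∀ i, Field (K i)] : Type :=
  (∀ i, K i) ⧸ ultraIdeal U K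

namespace UProd

variable {ι : Type} {U : Ultrafilter ι} {K L : ι → Type} [∀ i, Field (K i)] [∀ i, Field (L i)]
  [∀ i, Algebra (K i) (L i)]

noncomputable instance : Field (UProd U K) := Ideal.Quotient.field (ultraIdeal U K)

/-- The quotient map onto the ultraproduct. -/
noncomputable def mk (U : Ultrafilter ι) (K : ι → Type) [∀ i, Field (K i)] :
    (∀ i, K i) →+* UProd U K := Ideal.Quotient.mk (ultraIdeal U K)

lemma mk_surjective : Function.Surjective (mk U K) := Ideal.Quotient.mk_surjective

lemma mk_eq_zero {a : ∀ i, K i} : mk U K a = 0 ↔ ∀ᶠ i in (U : Filter ι), a i = 0 :=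
  Ideal.Quotient.eq_zero_iff_mem

lemma mk_eq_mk {a b : ∀ i, K i} :
    mk U K a = mk U K b ↔ ∀ᶠ i in (U : Filter ι), a i = b i := by
  rw [← sub_eq_zero, ← map_sub, mk_eq_zero]
  simp [sub_eq_zero]

/-- The componentwise algebra structure between ultraproducts. -/
noncomputable instance : Algebra (UProd U K) (UProd U L) :=
  (Ideal.Quotient.lift (ultraIdeal U K)
    ((mk U L).comp (RingHom.pi fun i => (algebraMap (K i) (L i)).comp (Pi.evalRingHom K i)))
    (fun a ha => by
      rw [RingHom.comp_apply, mk_eq_zero]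
      filter_upwards [mem_ultraIdeal.1 ha] with i hi
      exact (congrArg _ hi).trans (map_zero (algebraMap (K i) (L i))))).toAlgebra

lemma algebraMap_mk (a : ∀ i, K i) :
    algebraMap (UProd U K) (UProd U L) (mk U K a) = mk U L fun i => algebraMap (K i) (L i) (a i) :=
  rfl

/-- The diagonal algebra structure on an ultraproduct. -/
noncomputable instance {k : Type} [Field k] [∀ i, Algebra k (L i)] : Algebra k (UProd U L) :=
  ((mk U L).comp (algebraMap k (∀ i, L i))).toAlgebra

lemma algebraMap_diag {k : Type} [Field k] [∀ i, Algebra k (L i)] (c : k) :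
    algebraMap k (UProd U L) c = mk U L fun i => algebraMap k (L i) c := rfl

lemma aeval_mk_diag {k : Type} [Field k] [∀ i, Algebra k (L i)] {σ : Type}
    (x : σ → ∀ i, L i) (P : MvPolynomial σ k) :
    aeval (fun j => mk U L (x j)) P = mk U L fun i => aeval (fun j => x j i) P := by
  induction P using MvPolynomial.induction_on with
  | C c => simp [algebraMap_diag]
  | add p q hp hq =>
    simp only [map_add, hp, hq]
    rfl
  | mul_X p j hp =>
    simp only [map_mul, hp, aeval_X]
    rfl

lemma aeval_mk {σ : Type} (x : σ → ∀ i, L i) (P : MvPolynomial σ (∀ i, K i)) :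
    aeval (fun j => mk U L (x j)) (map (mk U K) P) =
      mk U L fun i => aeval (fun j => x j i) (map (Pi.evalRingHom K i) P) := by
  induction P using MvPolynomial.induction_on with
  | C c => simp [algebraMap_mk]
  | add p q hp hq =>
    simp only [map_add, hp, hq]
    rfl
  | mul_X p j hp =>
    simp only [map_mul, hp, aeval_X, map_X]
    rfl

lemma map_mk_eq_zero {σ : Type} {P : MvPolynomial σ (∀ i, K i)} :
    map (mk U K) P = 0 ↔ ∀ᶠ i in (U : Filter ι), map (Pi.evalRingHom K i) P = 0 := by
  constructor
  · intro h
    have h1 : ∀ m ∈ P.support, ∀ᶠ i in (U : Filter ι), coeff m P i = 0 := by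
      intro m _
      rw [← mk_eq_zero, ← coeff_map, h, coeff_zero]
    filter_upwards [(Filter.eventually_all_finset P.support).2 h1] with i hi
    ext m
    rw [coeff_map, coeff_zero]
    by_cases hm : m ∈ P.support
    · exact hi m hm
    · simp [notMem_support_iff.1 hm]
  · intro h
    ext m
    rw [coeff_map, coeff_zero, mk_eq_zero]
    filter_upwards [h] with i hi
    have := congrArg (coeff m) hi
    simpa [coeff_map] using this

lemma algebraicIndependent_mk {σ : Type} (x : σ → ∀ i, L i)
    (hx : ∀ i, AlgebraicIndependent (K i) fun j => x j i) :
    AlgebraicIndependent (UProd U K) fun j => mk U L (x j) := by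
  rw [algebraicIndependent_iff]
  intro P hP
  obtain ⟨P, rfl⟩ := map_surjective (mk U K) mk_surjective P
  rw [aeval_mk, mk_eq_zero] at hP
  rw [map_mk_eq_zero]
  filter_upwards [hP] with i hi
  exact (algebraicIndependent_iff.1 (hx i)) _ hi

lemma charZero (h : ∀ m : ℕ, m ≠ 0 → ∀ᶠ i in (U : Filter ι), (m : K i) ≠ 0) :
    CharZero (UProd U K) := by
  refine charZero_of_inj_zero fun m hm => ?_
  by_contra hm0
  have : mk U K (fun i => (m : K i)) = 0 := by
    rw [← hm, ← map_natCast (mk U K)]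
    rfl
  rw [mk_eq_zero] at this
  obtain ⟨i, hi⟩ := (this.and (h m hm0)).exists
  exact hi.2 hi.1

instance isAlgClosed [∀ i, IsAlgClosed (K i)] : IsAlgClosed (UProd U K) := by
  refine IsAlgClosed.of_exists_root _ fun p hp hirr => ?_
  have hl : p ∈ Polynomial.lifts (mk U K) := by
    rw [Polynomial.lifts_iff_coeff_lifts]
    exact fun m => mk_surjective _
  obtain ⟨q, hq, hdeg, hmon⟩ := Polynomial.lifts_and_natDegree_eq_and_monic hl hp
  have hpos : 0 < q.natDegree := hdeg ▸ hirr.natDegree_pos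
  have hroot : ∀ i, ∃ r : K i, (q.map (Pi.evalRingHom K i)).eval r = 0 := fun i => by
    refine IsAlgClosed.exists_root _ ?_
    refine (Polynomial.natDegree_pos_iff_degree_pos.1 ?_).ne'
    rwa [hmon.natDegree_map (Pi.evalRingHom K i)]
  choose r hr using hroot
  refine ⟨mk U K r, ?_⟩
  rw [← hq, Polynomial.eval_map, Polynomial.eval₂_hom, mk_eq_zero]
  refine Filter.Eventually.of_forall fun i => ?_
  have := hr i
  rw [Polynomial.eval_map] at this
  rw [← this]
  exact (Polynomial.hom_eval₂ q (RingHom.id _) (Pi.evalRingHom K i) r)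

end UProd

end Ultraproduct

open KaehlerDifferential in
/-- In characteristic zero the differentials of a transcendence basis form a basis. -/
lemma exists_basis_kaehler {k L ι : Type} [Field k] [Field L] [Algebra k L] [CharZero k]
    {s : ι → L} (hs : IsTranscendenceBasis k s) :
    ∃ b : Module.Basis ι L Ω[L⁄k], ∀ i, b i = D k L (s i) := by
  let : Algebra (MvPolynomial ι k) L := (aeval s).toAlgebra
  have : IsScalarTower k (MvPolynomial ι k) L := IsScalarTower.of_algHom (aeval s)
  have : FaithfulSMul (MvPolynomial ι k) L := by
    rw [faithfulSMul_iff_algebraMap_injective]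
    exact hs.1
  let : Algebra (FractionRing (MvPolynomial ι k)) L := FractionRing.liftAlgebra _ _
  have : IsScalarTower (MvPolynomial ι k) (FractionRing (MvPolynomial ι k)) L :=
    FractionRing.isScalarTower_liftAlgebra _ _
  have : CharZero (FractionRing (MvPolynomial ι k)) :=
    charZero_of_injective_algebraMap (R := MvPolynomial ι k) (IsFractionRing.injective _ _)
  have : Algebra.IsAlgebraic (MvPolynomial ι k) L := by
    have := hs.isAlgebraic
    refine Algebra.IsAlgebraic.of_ringHom_of_comp_eq hs.1.aevalEquiv (RingHom.id L)
      hs.1.aevalEquiv.surjective Function.injective_id ?_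
    ext <;> simp [RingHom.algebraMap_toAlgebra]
  have : Algebra.IsAlgebraic (FractionRing (MvPolynomial ι k)) L :=
    Algebra.IsAlgebraic.extendScalars
      (IsFractionRing.injective (MvPolynomial ι k) (FractionRing (MvPolynomial ι k)))
  have : Algebra.FormallyEtale (FractionRing (MvPolynomial ι k)) L :=
    Algebra.FormallyEtale.of_isSeparable _ _
  have : Algebra.FormallyEtale (MvPolynomial ι k) (FractionRing (MvPolynomial ι k)) :=
    Algebra.FormallyEtale.of_isLocalization (nonZeroDivisors _)
  have : Algebra.FormallyEtale (MvPolynomial ι k) L :=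
    Algebra.FormallyEtale.comp _ (FractionRing (MvPolynomial ι k)) _
  refine ⟨((mvPolynomialBasis k ι).baseChange L).map
    (tensorKaehlerEquivOfFormallyEtale k (MvPolynomial ι k) L), fun i => ?_⟩
  simp [RingHom.algebraMap_toAlgebra]

lemma aeval_mul_of_isHomogeneous {σ k L : Type} [Field k] [Field L] [Algebra k L]
    {f : MvPolynomial σ k} {e : ℕ} (hf : f.IsHomogeneous e) (c : L) (y : σ → L) :
    aeval (fun i => c * y i) f = c ^ e * aeval y f := by
  rw [aeval_def, aeval_def, eval₂_eq, eval₂_eq, Finset.mul_sum]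
  refine Finset.sum_congr rfl fun m hm => ?_
  have hdeg : ∑ i ∈ m.support, m i = e := by
    have := hf (mem_support_iff.1 hm)
    simpa [Finsupp.weight_apply, Finsupp.sum] using this
  simp_rw [mul_pow]
  rw [Finset.prod_mul_distrib, Finset.prod_pow_eq_pow_sum, hdeg]
  ring

lemma aeval_mem_valuationSubring {σ k L : Type} [Field k] [Field L] [Algebra k L]
    (V : ValuationSubring L) (hk : ∀ c : k, algebraMap k L c ∈ V) {y : σ → L}
    (hy : ∀ i, y i ∈ V) (f : MvPolynomial σ k) : aeval y f ∈ V := by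
  induction f using MvPolynomial.induction_on with
  | C c => simpa using hk c
  | add p q hp hq => simpa using V.add_mem _ _ hp hq
  | mul_X p j hp => simpa using V.mul_mem _ _ hp (hy j)

/-- A point is integral over the values of homogeneous forms having only the trivial
common zero. -/
lemma isAlgebraic_of_X_pow_mem_span {n : ℕ} {τ k L : Type} [Field k] [Field L] [Algebra k L]
    {g : τ → MvPolynomial (Fin n) k} {e : τ → ℕ} (hg : ∀ t, (g t).IsHomogeneous (e t))
    (he : ∀ t, 0 < e t) (hX : ∀ i, ∃ N : ℕ, X i ^ N ∈ Ideal.span (Set.range g))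
    (x : Fin n → L) (C : IntermediateField k L) (hC : ∀ t, aeval x (g t) ∈ C) (i : Fin n) :
    IsAlgebraic C (x i) := by
  set s : Set L := Set.range (algebraMap k L) ∪ Set.range fun t => aeval x (g t)
  have hmem : x i ∈ (integralClosure (Subring.closure s) L).toSubring := by
    rw [← iInf_valuationSubring_superset, Subring.mem_iInf]
    rintro ⟨V, hV⟩
    change x i ∈ V
    have hk : ∀ c : k, algebraMap k L c ∈ V := fun c => hV (Or.inl ⟨c, rfl⟩)
    have hgV : ∀ t, aeval x (g t) ∈ V := fun t => hV (Or.inr ⟨t, rfl⟩)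
    by_contra hi
    obtain ⟨j, -, hj⟩ := Finset.exists_max_image Finset.univ (fun j => V.valuation (x j))
      ⟨i, Finset.mem_univ i⟩
    rw [← V.valuation_le_one_iff, not_le] at hi
    have hj1 : 1 < V.valuation (x j) := hi.trans_le (hj i (Finset.mem_univ i))
    have hx0 : x j ≠ 0 := by
      rintro h
      simp [h] at hj1
    set y : Fin n → L := fun l => x l / x j
    have hy : ∀ l, y l ∈ V := fun l => by
      rw [← V.valuation_le_one_iff, map_div₀]
      exact div_le_one_of_le₀ (hj l (Finset.mem_univ l)) zero_le
    have hxy : x = fun l => x j * y l := by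
      funext l
      simp only [y]
      field_simp
    have hgy : ∀ t, V.valuation (aeval y (g t)) < 1 := fun t => by
      have h1 := hgV t
      rw [hxy, aeval_mul_of_isHomogeneous (hg t), ← V.valuation_le_one_iff, map_mul, map_pow] at h1
      by_contra h2
      rw [not_lt] at h2
      exact absurd h1 (not_le.2 ((one_lt_pow₀ hj1 (he t).ne').trans_le (le_mul_of_one_le_right' h2)))
    obtain ⟨N, hN⟩ := hX j
    have hspan : ∀ f ∈ Ideal.span (Set.range g), V.valuation (aeval y f) < 1 := by
      intro f hf
      induction hf using Submodule.span_induction with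
      | mem f hf => obtain ⟨t, rfl⟩ := hf; exact hgy t
      | zero => simp
      | add a b _ _ ha hb =>
        rw [map_add]
        exact (V.valuation.map_add _ _).trans_lt (max_lt ha hb)
      | smul a b _ hb =>
        rw [smul_eq_mul, map_mul, map_mul]
        exact (mul_le_of_le_one_left' ((V.valuation_le_one_iff _).2
          (aeval_mem_valuationSubring V hk hy a))).trans_lt hb
    have := hspan _ hN
    simp [y, hx0] at this
  have hle : Subring.closure s ≤ C.toSubfield.toSubring := by
    rw [Subring.closure_le]
    rintro _ (⟨c, rfl⟩ | ⟨t, rfl⟩)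
    · exact C.algebraMap_mem c
    · exact hC t
  obtain ⟨p, hp, hpx⟩ := hmem
  refine IsIntegral.isAlgebraic ⟨p.map (Subring.inclusion hle), hp.map _, ?_⟩
  rw [Polynomial.eval₂_map]
  exact hpx

section Dimension

/-- A chain of primes of length `u` yields `u` algebraically independent elements modulo its
smallest member. -/
lemma exists_algebraicIndependent_of_ltSeries {k A : Type} [Field k] [CommRing A] [Algebra k A]
    (u : ℕ) (l : LTSeries (PrimeSpectrum A)) (hl : l.length = u) :
    ∃ f : Fin u → A,
      AlgebraicIndependent k fun i => Ideal.Quotient.mk l.head.asIdeal (f i) := by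
  induction u generalizing l with
  | zero =>
    refine ⟨Fin.elim0, ?_⟩
    rw [algebraicIndependent_empty_type_iff]
    exact (algebraMap k (A ⧸ l.head.asIdeal)).injective
  | succ u ih =>
    have h0 : l.length ≠ 0 := by omega
    obtain ⟨f, hf⟩ := ih (l.tail h0) (by simp [hl])
    set p := l.head.asIdeal
    set q := (l.tail h0).head.asIdeal
    have hlt : p < q := by
      have h := l.step ⟨0, by omega⟩
      have h2 : (l.tail h0).head = l (Fin.succ ⟨0, by omega⟩) := by
        simp only [RelSeries.head_tail]
        congr 1
        ext
        simp
        omega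
      simp only [p, q, h2]
      exact h
    obtain ⟨a, haq, hap⟩ := SetLike.exists_of_lt hlt
    let φ : (A ⧸ p) →ₐ[k] (A ⧸ q) := Ideal.Quotient.factorₐ k hlt.le
    have hf' : AlgebraicIndependent k fun i => Ideal.Quotient.mk p (f i) :=
      AlgebraicIndependent.of_comp φ (by simpa [Function.comp_def, φ] using hf)
    have htr : Transcendental (Algebra.adjoin k (Set.range fun i => Ideal.Quotient.mk p (f i)))
        (Ideal.Quotient.mk p a) := by
      intro halg
      have ha0 : Ideal.Quotient.mk p a ≠ 0 := by rwa [Ne, Ideal.Quotient.eq_zero_iff_mem]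
      obtain ⟨⟨r, hr⟩, hr0, c, hc⟩ := halg.exists_nonzero_dvd (mem_nonZeroDivisors_of_ne_zero ha0)
      rw [Algebra.adjoin_range_eq_range_aeval] at hr
      obtain ⟨P, rfl⟩ := hr
      have hP : P = 0 := by
        refine (algebraicIndependent_iff.1 hf) P ?_
        have h1 : φ (Ideal.Quotient.mk p a) = 0 := by
          simpa [φ, Ideal.Quotient.eq_zero_iff_mem] using haq
        have h2 := congrArg φ hc
        rw [map_mul, h1, zero_mul] at h2
        rw [← h2]
        change _ = φ (aeval _ P)
        rw [← AlgHom.comp_apply, comp_aeval]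
        simp [φ]
      subst hP
      exact hr0 (Subtype.ext (map_zero _))
    have := (hf'.option_iff_transcendental (Ideal.Quotient.mk p a)).2 htr
    refine ⟨fun i => (finSuccEquiv u i).elim a f, ?_⟩
    convert this.comp _ (finSuccEquiv u).injective using 2 with i
    cases h : finSuccEquiv u i <;> simp [h, p]

/-- Algebraically independent elements can be chosen among generators. -/
lemma exists_algebraicIndependent_generators {k B : Type} [Field k] [CommRing B] [IsDomain B]
    [Algebra k B] {n u : ℕ} {φ : MvPolynomial (Fin n) k →ₐ[k] B} (hφ : Function.Surjective φ)
    {f : Fin u → B} (hf : AlgebraicIndependent k f) :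
    ∃ s : Fin u → Fin n, AlgebraicIndependent k fun i => φ (X (s i)) := by
  have hφ' : φ = aeval fun i => φ (X i) := by ext; simp
  have htop : Algebra.adjoin k (Set.range fun i => φ (X i)) = ⊤ := by
    rw [Algebra.adjoin_range_eq_range_aeval, ← hφ', AlgHom.range_eq_top]
    exact hφ
  have halg : Algebra.IsAlgebraic (Algebra.adjoin k (Set.range fun i => φ (X i))) B := by
    refine ⟨fun b => ?_⟩
    have hb : b ∈ Algebra.adjoin k (Set.range fun i => φ (X i)) := htop ▸ Algebra.mem_top
    exact isAlgebraic_algebraMap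
      (⟨b, hb⟩ : Algebra.adjoin k (Set.range fun i => φ (X i)))
  obtain ⟨t, hts, ht⟩ := exists_isTranscendenceBasis_subset (R := k) (Set.range fun i => φ (X i))
  have hcard : Cardinal.mk (Fin u) ≤ Cardinal.mk t := by
    rw [ht.cardinalMk_eq_trdeg]
    exact hf.cardinalMk_le_trdeg
  obtain ⟨g⟩ := Cardinal.le_def _ _ |>.1 hcard
  choose s hs using fun i => hts (g i).2
  refine ⟨s, ?_⟩
  convert ht.1.comp g g.injective using 2 with i
  exact hs i

/-- A quotient of a polynomial ring of dimension at least `u` has a point with `u` algebraically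
independent coordinates. -/
lemma exists_point_of_le_ringKrullDim {k : Type} [Field k] {n u : ℕ}
    (I : Ideal (MvPolynomial (Fin n) k))
    (h : (u : WithBot ℕ∞) ≤ ringKrullDim (MvPolynomial (Fin n) k ⧸ I)) :
    ∃ (L : Type) (_ : Field L) (_ : Algebra k L) (x : Fin n → L) (s : Fin u → Fin n),
      (∀ f ∈ I, aeval x f = 0) ∧ AlgebraicIndependent k (x ∘ s) := by
  obtain ⟨l, hl⟩ := Order.le_krullDim_iff.1 h
  obtain ⟨f, hf⟩ := exists_algebraicIndependent_of_ltSeries (k := k) u l hl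
  let φ : MvPolynomial (Fin n) k →ₐ[k] (MvPolynomial (Fin n) k ⧸ I) ⧸ l.head.asIdeal :=
    (Ideal.Quotient.mkₐ k l.head.asIdeal).comp (Ideal.Quotient.mkₐ k I)
  have hφ : Function.Surjective φ :=
    (Ideal.Quotient.mkₐ_surjective k l.head.asIdeal).comp (Ideal.Quotient.mkₐ_surjective k I)
  obtain ⟨s, hs⟩ := exists_algebraicIndependent_generators hφ hf
  let ψ := IsScalarTower.toAlgHom k ((MvPolynomial (Fin n) k ⧸ I) ⧸ l.head.asIdeal)
    (FractionRing ((MvPolynomial (Fin n) k ⧸ I) ⧸ l.head.asIdeal))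
  refine ⟨FractionRing ((MvPolynomial (Fin n) k ⧸ I) ⧸ l.head.asIdeal), inferInstance,
    inferInstance, fun i => ψ (φ (X i)), s, fun a ha => ?_,
    hs.map' (f := ψ) (IsFractionRing.injective _ _)⟩
  have h1 : (aeval fun i => ψ (φ (X i))) = ψ.comp φ := by ext; simp
  have h0 : φ a = 0 := by
    simp [φ, Ideal.Quotient.eq_zero_iff_mem.2 ha]
  rw [h1, AlgHom.comp_apply, h0, map_zero]

/-- A point with `m` algebraically independent coordinates bounds the dimension from below. -/
lemma le_ringKrullDim_of_point {k L : Type} [Field k] [Field L] [Algebra k L] {n m : ℕ}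
    (I : Ideal (MvPolynomial (Fin n) k)) (x : Fin n → L) (hx : ∀ f ∈ I, aeval x f = 0)
    (s : Fin m → Fin n) (hs : AlgebraicIndependent k (x ∘ s)) :
    (m : WithBot ℕ∞) ≤ ringKrullDim (MvPolynomial (Fin n) k ⧸ I) := by
  set P := RingHom.ker (aeval x : MvPolynomial (Fin n) k →ₐ[k] L)
  have hIP : I ≤ P := fun f hf => hx f hf
  have hP : P.IsPrime := RingHom.ker_isPrime _
  refine le_trans ?_ (ringKrullDim_le_of_surjective (Ideal.Quotient.factor hIP)
    (Ideal.Quotient.factor_surjective hIP))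
  obtain ⟨r, -, g, hg, hgint⟩ := exists_integral_inj_algHom_of_quotient P hP.ne_top
  set A := MvPolynomial (Fin n) k ⧸ P
  let : Algebra (MvPolynomial (Fin r) k) A := g.toAlgebra
  have : IsScalarTower k (MvPolynomial (Fin r) k) A := IsScalarTower.of_algHom g
  have : Algebra.IsIntegral (MvPolynomial (Fin r) k) A := ⟨hgint⟩
  have : FaithfulSMul (MvPolynomial (Fin r) k) A :=
    (faithfulSMul_iff_algebraMap_injective _ _).2 hg
  have hmr : m ≤ r := by
    have h1 : AlgebraicIndependent k fun i => Ideal.Quotient.mk P (X (s i)) := by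
      refine AlgebraicIndependent.of_comp (Ideal.kerLiftAlg (aeval x : _ →ₐ[k] L)) ?_
      convert hs using 1
      funext i
      exact (Ideal.kerLiftAlg_mk _ _).trans (aeval_X _ _)
    have h2 := h1.cardinalMk_le_trdeg
    have h3 : Algebra.trdeg k A = r := by
      have := (IsTranscendenceBasis.mvPolynomial (Fin r) k).algebraMap_comp (A := A)
      rw [← this.cardinalMk_eq_trdeg]
      simp
    rw [h3] at h2
    simpa using h2
  have hdim : ringKrullDim (MvPolynomial (Fin r) k) = r := by
    simp [MvPolynomial.ringKrullDim_of_isNoetherianRing]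
  obtain ⟨l, hl⟩ := Order.le_krullDim_iff.1 (show (m : WithBot ℕ∞) ≤
    Order.krullDim (PrimeSpectrum (MvPolynomial (Fin r) k)) from
    (by exact_mod_cast hmr : (m : WithBot ℕ∞) ≤ r).trans hdim.ge)
  obtain ⟨Q, -, hQ, hQl⟩ := Ideal.exists_ideal_over_prime_of_isIntegral (S := A) l.head.asIdeal ⊥
    (fun a ha => by
      have : a = 0 := hg ((by simpa using ha : algebraMap _ A a = 0).trans (map_zero g).symm)
      simp [this])
  have : Q.LiesOver l.head.asIdeal := ⟨hQl.symm⟩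
  obtain ⟨l', hl', -⟩ := Ideal.exists_ltSeries_of_hasGoingUp l Q
  exact Order.le_krullDim_iff.2 ⟨l', hl'.trans hl⟩

end Dimension

section LinearSections

/-- A nonzero point of a conical zero locus forces positive dimension. -/
lemma one_le_ringKrullDim_of_cone {k : Type} [Field k] [Infinite k] {n : ℕ}
    (I : Ideal (MvPolynomial (Fin n) k)) (a : Fin n → k) (ha : a ≠ 0)
    (hI : ∀ c : k, ∀ f ∈ I, eval (c • a) f = 0) :
    ((1 : ℕ) : WithBot ℕ∞) ≤ ringKrullDim (MvPolynomial (Fin n) k ⧸ I) := by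
  obtain ⟨j, hj⟩ := Function.ne_iff.1 ha
  let ψ := IsScalarTower.toAlgHom k (Polynomial k) (FractionRing (Polynomial k))
  have hψ : Function.Injective ψ := IsFractionRing.injective _ _
  let x : Fin n → Polynomial k := fun i => Polynomial.C (a i) * Polynomial.X
  refine le_ringKrullDim_of_point I (fun i => ψ (x i)) (fun f hf => ?_) (fun _ : Fin 1 => j) ?_
  · have h1 : (aeval fun i => ψ (x i)) f = ψ (aeval x f) := by
      rw [← AlgHom.comp_apply, comp_aeval]
    rw [h1, map_eq_zero_iff ψ hψ]
    refine Polynomial.zero_of_eval_zero _ fun c => ?_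
    have h2 : Polynomial.eval c (aeval x f) = eval (c • a) f := by
      rw [← Polynomial.coe_evalRingHom, aeval_def, Polynomial.algebraMap_eq, hom_eval₂]
      have : (Polynomial.evalRingHom c).comp Polynomial.C = RingHom.id k := by ext; simp
      rw [this, eval₂_id]
      congr 2
      funext i
      simp only [x, Polynomial.coe_evalRingHom, Polynomial.eval_mul, Polynomial.eval_C,
        Polynomial.eval_X, Pi.smul_apply, smul_eq_mul]
      exact mul_comm _ _
    rw [h2, hI c f hf]
  · rw [algebraicIndependent_unique_type_iff]
    change Transcendental k (ψ (x j))
    intro halg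
    have h1 : IsAlgebraic k (x j) := (isAlgebraic_algHom_iff ψ hψ).1 halg
    have h2 := (isAlgebraic_algebraMap (A := Polynomial k) (a j)⁻¹).mul h1
    rw [Polynomial.algebraMap_eq, ← mul_assoc, ← Polynomial.C_mul, inv_mul_cancel₀ hj, map_one,
      one_mul] at h2
    exact Polynomial.transcendental_X k h2

/-- A hyperplane avoiding the nontrivial components lowers the dimension. -/
lemma exists_linear_form_lowering {k : Type} [Field k] [Infinite k] {n u : ℕ}
    (I : Ideal (MvPolynomial (Fin n) k))
    (hI : ringKrullDim (MvPolynomial (Fin n) k ⧸ I) ≤ ((u + 1 : ℕ) : WithBot ℕ∞)) :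
    ∃ b : Fin n → k, ringKrullDim (MvPolynomial (Fin n) k ⧸
      (I ⊔ Ideal.span {∑ i, C (b i) * X i})) ≤ (u : WithBot ℕ∞) := by
  classical
  let φ : (Fin n → k) →ₗ[k] MvPolynomial (Fin n) k :=
    ∑ i, (LinearMap.proj i).smulRight (X i : MvPolynomial (Fin n) k)
  have hφ : ∀ b, φ b = ∑ i, C (b i) * X i := fun b => by
    simp [φ, LinearMap.sum_apply, smul_eq_C_mul]
  let W : Ideal (MvPolynomial (Fin n) k) → Subspace k (Fin n → k) := fun P =>
    (P.restrictScalars k).comap φ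
  have hfin := Ideal.finite_minimalPrimes_of_isNoetherianRing _ I
  let S : Finset (Subspace k (Fin n → k)) := (hfin.toFinset.image W).filter (· ≠ ⊤)
  have hS : ⊤ ∉ S := by simp [S]
  obtain ⟨b, hb⟩ := (Set.ne_univ_iff_exists_notMem _).1 (Subspace.biUnion_ne_univ_of_top_notMem hS)
  refine ⟨b, ?_⟩
  by_contra hlt
  rw [not_le] at hlt
  have hle : ((u + 1 : ℕ) : WithBot ℕ∞) ≤ ringKrullDim (MvPolynomial (Fin n) k ⧸
      (I ⊔ Ideal.span {∑ i, C (b i) * X i})) := by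
    push_cast
    exact ENat.WithBot.add_one_le_iff.2 hlt
  obtain ⟨L, _, _, x, s, hx, hs⟩ := exists_point_of_le_ringKrullDim _ hle
  set p := RingHom.ker (aeval x : MvPolynomial (Fin n) k →ₐ[k] L)
  have hp : p.IsPrime := RingHom.ker_isPrime _
  obtain ⟨P, hPmin, hPp⟩ := Ideal.exists_minimalPrimes_le (I := I) (J := p)
    (fun f hf => hx f (Ideal.mem_sup_left hf))
  have hP : P.IsPrime := hPmin.1.1
  have hWP : W P ≠ ⊤ := by
    intro h
    have h1 : (Pi.single (s 0) 1 : Fin n → k) ∈ W P := h ▸ Submodule.mem_top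
    have h2 : φ (Pi.single (s 0) 1) = X (s 0) := by
      simp [hφ, Pi.single_apply]
    have h3 : (X (s 0) : MvPolynomial (Fin n) k) ∈ p := hPp (h2 ▸ h1)
    have h4 : x (s 0) = 0 := by simpa [p] using h3
    exact hs.ne_zero 0 h4
  have hbP : (∑ i, C (b i) * X i) ∉ P := by
    intro h
    refine hb (Set.mem_biUnion (x := W P) ?_ ?_)
    · simp only [S, Finset.coe_filter, Finset.mem_image, Set.Finite.mem_toFinset, Set.mem_ofPred_eq]
      exact ⟨⟨P, hPmin, rfl⟩, hWP⟩
    · change φ b ∈ P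
      rwa [hφ]
  have hbp : (∑ i, C (b i) * X i) ∈ p :=
    hx _ (Ideal.mem_sup_right (Ideal.mem_span_singleton_self _))
  have h1 := le_ringKrullDim_of_point p x (fun f hf => hf) s hs
  have h2 := ringKrullDim_succ_le_of_surjective (Ideal.Quotient.factor hPp)
    (Ideal.Quotient.factor_surjective hPp)
    (r := Ideal.Quotient.mk P (∑ i, C (b i) * X i))
    (mem_nonZeroDivisors_of_ne_zero (by rwa [Ne, Ideal.Quotient.eq_zero_iff_mem]))
    (by rw [Ideal.Quotient.factor_mk, Ideal.Quotient.eq_zero_iff_mem]; exact hbp)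
  have h3 := ringKrullDim_le_of_surjective (Ideal.Quotient.factor hPmin.1.2)
    (Ideal.Quotient.factor_surjective hPmin.1.2)
  have h4 : ((u + 1 : ℕ) : WithBot ℕ∞) + 1 ≤ ((u + 1 : ℕ) : WithBot ℕ∞) :=
    (add_le_add_left h1 1).trans (h2.trans (h3.trans hI))
  have h5 : u + 1 + 1 ≤ u + 1 := by exact_mod_cast h4
  omega

/-- A cone of dimension at most `u` meets some linear space of codimension `u` only at the
origin. -/
lemma exists_linear_forms_of_ringKrullDim_le {k : Type} [Field k] [Infinite k] {n u : ℕ}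
    (I : Ideal (MvPolynomial (Fin n) k))
    (hI : ringKrullDim (MvPolynomial (Fin n) k ⧸ I) ≤ (u : WithBot ℕ∞))
    (hcone : ∀ a : Fin n → k, (∀ f ∈ I, eval a f = 0) → ∀ c : k, ∀ f ∈ I, eval (c • a) f = 0) :
    ∃ l : Fin u → Fin n → k, ∀ a : Fin n → k, (∀ f ∈ I, eval a f = 0) →
      (∀ i, ∑ j, l i j * a j = 0) → a = 0 := by
  induction u generalizing I with
  | zero =>
    refine ⟨Fin.elim0, fun a ha _ => ?_⟩
    by_contra h0
    have := (one_le_ringKrullDim_of_cone I a h0 (hcone a ha)).trans hI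
    have h5 : 1 ≤ 0 := by exact_mod_cast this
    omega
  | succ u ih =>
    obtain ⟨b, hb⟩ := exists_linear_form_lowering I hI
    have hsup : ∀ a : Fin n → k, (∀ f ∈ I ⊔ Ideal.span {∑ i, C (b i) * X i}, eval a f = 0) ↔
        (∀ f ∈ I, eval a f = 0) ∧ ∑ j, b j * a j = 0 := by
      intro a
      have : (∑ j, b j * a j) = eval a (∑ i, C (b i) * X i) := by simp
      rw [this]
      change (I ⊔ Ideal.span {∑ i, C (b i) * X i} ≤ RingHom.ker (eval a)) ↔
        I ≤ RingHom.ker (eval a) ∧ _ ∈ RingHom.ker (eval a)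
      rw [sup_le_iff, Ideal.span_singleton_le_iff_mem]
    obtain ⟨l, hl⟩ := ih _ hb (by
      intro a ha c
      rw [hsup] at ha ⊢
      refine ⟨hcone a ha.1 c, ?_⟩
      have := congrArg (c * ·) ha.2
      simp only [Finset.mul_sum, mul_zero] at this
      rw [← this]
      refine Finset.sum_congr rfl fun j _ => ?_
      simp
      ring)
    refine ⟨Fin.cons b l, fun a ha hla => hl a ((hsup a).2 ⟨ha, by simpa using hla 0⟩) fun i => ?_⟩
    simpa using hla i.succ

/-- A set whose Zariski closure has dimension at least `e` projects densely onto `e` of the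
coordinates. -/
lemma exists_dominant_of_le_coneDim {k : Type} [Field k] {n e : ℕ} (T : Set (Fin n → k))
    (h : (e : WithBot ℕ∞) ≤ coneDim T) :
    ∃ s : Fin e → Fin n, ∀ f : MvPolynomial (Fin e) k,
      (∀ y ∈ T, eval (y ∘ s) f = 0) → f = 0 := by
  obtain ⟨L, _, _, x, s, hx, hs⟩ := exists_point_of_le_ringKrullDim _ h
  refine ⟨s, fun f hf => algebraicIndependent_iff.1 hs f ?_⟩
  rw [← aeval_rename]
  refine hx _ fun y hy => ?_
  rw [eval_rename]
  exact hf y hy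

end LinearSections

section Core

/-- The elements of `L` algebraic over the field generated by `S`. -/
def relAlgClosure (k : Type) {L : Type} [Field k] [Field L] [Algebra k L] (S : Set L) :
    IntermediateField k L where
  toSubalgebra := (Subalgebra.algebraicClosure (Algebra.adjoin k S) L).restrictScalars k
  inv_mem' _ hx := IsAlgebraic.inv hx

lemma coe_relAlgClosure {k L : Type} [Field k] [Field L] [Algebra k L] (S : Set L) :
    (relAlgClosure k S : Set L) = (AlgebraicIndependent.matroid k L).closure S :=
  AlgebraicIndependent.matroid_closure_eq.symm

lemma subset_relAlgClosure {k L : Type} [Field k] [Field L] [Algebra k L] (S : Set L) :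
    S ⊆ relAlgClosure k S := by
  rw [coe_relAlgClosure]
  exact Matroid.subset_closure _ _ (Set.subset_univ _)

lemma relAlgClosure_mono {k L : Type} [Field k] [Field L] [Algebra k L] {S T : Set L}
    (h : S ⊆ T) : relAlgClosure k S ≤ relAlgClosure k T := by
  rw [← SetLike.coe_subset_coe, coe_relAlgClosure, coe_relAlgClosure]
  exact Matroid.closure_subset_closure _ h

lemma mem_relAlgClosure_of_isAlgebraic {k L : Type} [Field k] [Field L] [Algebra k L] {S : Set L}
    {a : L} (h : IsAlgebraic (relAlgClosure k S) a) : a ∈ relAlgClosure k S := by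
  have h1 : a ∈ relAlgClosure k (relAlgClosure k S : Set L) :=
    IsAlgebraic.tower_top_of_subalgebra_le (R := k)
      (A := (relAlgClosure k S).toSubalgebra)
      (B := Algebra.adjoin k (relAlgClosure k S : Set L)) Algebra.subset_adjoin h
  rw [← SetLike.mem_coe, coe_relAlgClosure, coe_relAlgClosure, Matroid.closure_closure] at h1
  rwa [← SetLike.mem_coe, coe_relAlgClosure]

lemma encard_le_of_subset_relAlgClosure {k L : Type} [Field k] [Field L] [Algebra k L]
    {S T : Set L} (hT : AlgebraicIndepOn k id T) (h : T ⊆ relAlgClosure k S) :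
    T.encard ≤ S.encard := by
  rw [coe_relAlgClosure] at h
  have h1 := (AlgebraicIndependent.matroid_indep_iff.2 hT).encard_le_eRk_of_subset h
  rw [Matroid.eRk_closure_eq] at h1
  exact h1.trans (Matroid.eRk_le_encard _ _)

lemma isTranscendenceBasis_relAlgClosure {k L : Type} [Field k] [Field L] [Algebra k L]
    {S : Set L} (hS : AlgebraicIndepOn k id S) :
    IsTranscendenceBasis k
      (fun a : S => (⟨a, subset_relAlgClosure S a.2⟩ : relAlgClosure k S)) := by
  refine ⟨AlgebraicIndependent.of_comp (relAlgClosure k S).val hS, fun T hT hST => ?_⟩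
  refine hST.antisymm fun a haT => ?_
  by_contra ha
  have h1 : AlgebraicIndepOn k id (Subtype.val '' T : Set L) :=
    AlgebraicIndependent.image
      (hT.map' (f := (relAlgClosure k S).val) (relAlgClosure k S).val.injective)
  have h2 := (AlgebraicIndependent.matroid_indep_iff.2 h1).notMem_closure_sdiff_of_mem
    (Set.mem_image_of_mem _ haT)
  refine h2 ?_
  have h3 : (a : L) ∈ (AlgebraicIndependent.matroid k L).closure S := by
    rw [← coe_relAlgClosure]
    exact a.2
  refine Matroid.closure_subset_closure _ ?_ h3
  intro b hb
  refine ⟨⟨⟨b, subset_relAlgClosure S hb⟩, hST ⟨⟨b, hb⟩, rfl⟩, rfl⟩, ?_⟩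
  rintro rfl
  exact ha ⟨⟨a, hb⟩, rfl⟩

open KaehlerDifferential in
lemma linearIndependent_D {k L : Type} [Field k] [Field L] [Algebra k L] [CharZero k]
    {S : Set L} (hS : AlgebraicIndepOn k id S) :
    LinearIndependent L fun a : S => D k L a := by
  obtain ⟨T, hST, hT⟩ := exists_isTranscendenceBasis_superset hS
  obtain ⟨b, hb⟩ := exists_basis_kaehler hT
  have := b.linearIndependent.comp (Set.inclusion hST) (Set.inclusion_injective hST)
  convert this using 2 with a
  simp [hb]

open KaehlerDifferential in
lemma D_aeval {k L : Type} [Field k] [Field L] [Algebra k L] {n : ℕ} (x : Fin n → L)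
    (P : MvPolynomial (Fin n) k) :
    D k L (aeval x P) = ∑ l, aeval x (pderiv l P) • D k L (x l) := by
  induction P using MvPolynomial.induction_on with
  | C c => simp
  | add p q hp hq => simp [hp, hq, add_smul, Finset.sum_add_distrib]
  | mul_X p j hp =>
    rw [map_mul, aeval_X, Derivation.leibniz, hp]
    simp only [Derivation.leibniz, map_add, smul_eq_mul, map_mul, aeval_X, add_smul,
      Finset.sum_add_distrib, Finset.smul_sum, smul_smul, pderiv_X]
    congr 1
    rw [Finset.sum_eq_single j]
    · simp
    · intro b _ hb
      simp [Pi.single_eq_of_ne hb.symm]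
    · simp

lemma exists_X_pow_mem_span {n : ℕ} {τ k : Type} [Field k] [IsAlgClosed k]
    {g : τ → MvPolynomial (Fin n) k}
    (h : ∀ a : Fin n → k, (∀ t, eval a (g t) = 0) → a = 0) (i : Fin n) :
    ∃ N : ℕ, X i ^ N ∈ Ideal.span (Set.range g) := by
  have : X i ∈ (Ideal.span (Set.range g)).radical := by
    rw [← vanishingIdeal_zeroLocus_eq_radical (K := k), mem_vanishingIdeal_iff]
    intro a ha
    have : a = 0 := h a fun t => by
      simpa [aeval_eq_eval] using ha (g t) (Ideal.subset_span ⟨t, rfl⟩)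
    simp [this]
  exact this

/-- A linear relation between differentials of `w` makes `w, z` algebraic over few elements. -/
lemma exists_small_generators {k L : Type} [Field k] [Field L] [Algebra k L] [CharZero k] {n : ℕ}
    (w z : Fin n → L) (h : ∑ j, z j • KaehlerDifferential.D k L (w j) = 0) :
    ∃ S : Set L, S.encard ≤ n ∧ (∀ j, w j ∈ relAlgClosure k S) ∧ ∀ j, z j ∈ relAlgClosure k S := by
  classical
  obtain ⟨B, hB⟩ := (AlgebraicIndependent.matroid k L).exists_isBasis (Set.range w)
  have hBw : Set.range w ⊆ relAlgClosure k B := by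
    rw [coe_relAlgClosure, hB.closure_eq_closure]
    exact Matroid.subset_closure _ _ (Set.subset_univ _)
  have hBi : AlgebraicIndepOn k id B := AlgebraicIndependent.matroid_indep_iff.1 hB.indep
  have hfin : B.Finite := (Set.finite_range w).subset hB.subset
  have : Fintype B := hfin.fintype
  choose g hg using fun a : B => hB.subset a.2
  have hginj : Function.Injective g := fun a b hab => Subtype.ext (by rw [← hg a, ← hg b, hab])
  let M := relAlgClosure k B
  obtain ⟨b, hb⟩ : ∃ b : Module.Basis B M (KaehlerDifferential k M), ∀ a : B,
      b a = KaehlerDifferential.D k M ⟨a, subset_relAlgClosure B a.2⟩ :=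
    exists_basis_kaehler (isTranscendenceBasis_relAlgClosure hBi)
  let w' : Fin n → M := fun j => ⟨w j, hBw ⟨j, rfl⟩⟩
  let c : B → Fin n → M := fun a j => b.repr (KaehlerDifferential.D k M (w' j)) a
  have hD : ∀ j, KaehlerDifferential.D k L (w j) =
      ∑ a : B, (c a j : L) • KaehlerDifferential.D k L (a : L) := by
    intro j
    have h1 := b.sum_repr (KaehlerDifferential.D k M (w' j))
    have h2 := congrArg (KaehlerDifferential.map k k M L) h1
    rw [map_sum, KaehlerDifferential.map_D] at h2
    refine h2.symm.trans (Finset.sum_congr rfl fun a _ => ?_)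
    rw [LinearMap.map_smul, hb, KaehlerDifferential.map_D]
    exact (algebraMap_smul L _ _).symm
  have hlin : ∀ a : B, ∑ j, z j * (c a j : L) = 0 := by
    have h1 : ∑ a : B, (∑ j, z j * (c a j : L)) • KaehlerDifferential.D k L (a : L) = 0 := by
      rw [← h]
      simp only [hD, Finset.sum_smul, Finset.smul_sum, smul_smul]
      exact Finset.sum_comm
    exact Fintype.linearIndependent_iff.1 (linearIndependent_D hBi) _ h1
  have hcg : ∀ a a' : B, c a (g a') = if a' = a then 1 else 0 := by
    intro a a'
    have : w' (g a') = ⟨a', subset_relAlgClosure B a'.2⟩ := Subtype.ext (hg a')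
    simp only [c, this, ← hb a', b.repr_self, Finsupp.single_apply]
  let S : Set L := B ∪ z '' (Set.range g)ᶜ
  have hBS : M ≤ relAlgClosure k S := relAlgClosure_mono Set.subset_union_left
  refine ⟨S, ?_, fun j => hBS (hBw ⟨j, rfl⟩), fun j => ?_⟩
  · refine (Set.encard_union_le _ _).trans ?_
    have h1 : (z '' (Set.range g)ᶜ).encard ≤ ((Set.range g)ᶜ).encard := Set.encard_image_le _ _
    have h2 : B.encard = (Set.range g).encard := by
      rw [← Set.image_univ, hginj.encard_image, Set.encard_univ, ENat.card_coe_set_eq]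
    calc B.encard + (z '' (Set.range g)ᶜ).encard
        ≤ (Set.range g).encard + ((Set.range g)ᶜ).encard := by rw [h2]; gcongr
      _ = n := by rw [Set.encard_add_encard_compl]; simp
  · have hz : ∀ j ∉ Set.range g, z j ∈ relAlgClosure k S := fun j hj =>
      subset_relAlgClosure S (Or.inr ⟨j, hj, rfl⟩)
    by_cases hj : j ∈ Set.range g
    · obtain ⟨a, rfl⟩ := hj
      have h1 := hlin a
      rw [← Finset.add_sum_erase _ _ (Finset.mem_univ (g a)), hcg, if_pos rfl] at h1
      have h2 : z (g a) = -∑ j ∈ Finset.univ.erase (g a), z j * (c a j : L) := by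
        rw [← add_eq_zero_iff_eq_neg]
        simpa using h1
      rw [h2]
      refine neg_mem (sum_mem fun j hj => ?_)
      by_cases hj' : j ∈ Set.range g
      · obtain ⟨a', rfl⟩ := hj'
        have : a' ≠ a := fun h => by simp [h] at hj
        rw [hcg, if_neg this]
        simp
      · exact mul_mem (hz j hj') (hBS (c a j).2)
    · exact hz j hj

/-- The Lagrange relation expressing that `x` lies in the singular locus of the polar of `Q` in
the direction `z`, possibly intersected with `Q = 0` and `G = 0`. -/
def PolarRel {k L : Type} [Field k] [Field L] [Algebra k L] {n : ℕ}
    (G Q : MvPolynomial (Fin n) k) (x z : Fin n → L) : Prop :=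
  ∃ α β : L, α * aeval x G = 0 ∧ β * aeval x Q = 0 ∧
    ∀ l, ∑ j, z j * aeval x (pderiv l (pderiv j Q)) =
      α * aeval x (pderiv l G) + β * aeval x (pderiv l Q)

/-- Over an algebraically closed field of characteristic zero, the incidence variety of the
Lagrange relation has the expected dimension. -/
theorem PolarRel.card_le {k L : Type} [Field k] [IsAlgClosed k] [CharZero k] [Field L]
    [Algebra k L] {n u e m : ℕ} {G Q : MvPolynomial (Fin n) k} {x z : Fin n → L}
    (hrel : PolarRel G Q x z) (hQ : Q.IsHomogeneous (e + 1)) (he : 0 < e) (ℓ : Fin u → Fin n → k)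
    (hℓ : ∀ a : Fin n → k, (∀ j, eval a (pderiv j Q) = 0) → (∀ i, ∑ j, ℓ i j * a j = 0) → a = 0)
    (s : Fin m → Fin n ⊕ Fin n) (hs : AlgebraicIndependent k (Sum.elim x z ∘ s)) :
    m ≤ n + u := by
  obtain ⟨α, β, hα, hβ, hrel⟩ := hrel
  have hD : ∑ j, z j • KaehlerDifferential.D k L (aeval x (pderiv j Q)) = 0 := by
    have hz : ∀ (γ : L) (P : MvPolynomial (Fin n) k), γ * aeval x P = 0 →
        γ • KaehlerDifferential.D k L (aeval x P) = 0 := by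
      intro γ P h
      rcases mul_eq_zero.1 h with h | h <;> simp [h]
    calc ∑ j, z j • KaehlerDifferential.D k L (aeval x (pderiv j Q))
        = ∑ l, (∑ j, z j * aeval x (pderiv l (pderiv j Q))) • KaehlerDifferential.D k L (x l) := by
          simp only [D_aeval, Finset.smul_sum, Finset.sum_smul, smul_smul]
          exact Finset.sum_comm
      _ = α • KaehlerDifferential.D k L (aeval x G) + β • KaehlerDifferential.D k L (aeval x Q) := by
          simp only [hrel, D_aeval, Finset.smul_sum, smul_smul, add_smul, Finset.sum_add_distrib]
      _ = 0 := by rw [hz α G hα, hz β Q hβ, add_zero]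
  obtain ⟨S, hS, hwS, hzS⟩ := exists_small_generators _ z hD
  let S' : Set L := S ∪ Set.range fun i => ∑ j, algebraMap k L (ℓ i j) * x j
  have hSS' : relAlgClosure k S ≤ relAlgClosure k S' := relAlgClosure_mono Set.subset_union_left
  let g : Fin n ⊕ Fin u → MvPolynomial (Fin n) k :=
    Sum.elim (fun j => pderiv j Q) fun i => ∑ j, C (ℓ i j) * X j
  have hxS : ∀ i, x i ∈ relAlgClosure k S' := by
    intro i
    refine mem_relAlgClosure_of_isAlgebraic
      (isAlgebraic_of_X_pow_mem_span (g := g) (e := Sum.elim (fun _ => e) fun _ => 1) ?_ ?_ ?_ x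
        (relAlgClosure k S') ?_ i)
    · rintro (j | i)
      · exact hQ.pderiv
      · exact IsHomogeneous.sum _ _ _ fun j _ => by
          simpa using (isHomogeneous_C (Fin n) (ℓ i j)).mul (isHomogeneous_X k j)
    · rintro (j | i)
      · exact he
      · exact one_pos
    · refine exists_X_pow_mem_span fun a ha => hℓ a (fun j => ha (Sum.inl j)) fun i => ?_
      simpa [g] using ha (Sum.inr i)
    · rintro (j | i)
      · exact hSS' (hwS j)
      · refine subset_relAlgClosure S' (Or.inr ⟨i, ?_⟩)
        simp [g]
  have hall : Set.range (Sum.elim x z ∘ s) ⊆ relAlgClosure k S' := by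
    rintro _ ⟨t, rfl⟩
    rcases h : s t with i | i
    · simpa [h] using hxS i
    · simpa [h] using hSS' (hzS i)
  have h1 := encard_le_of_subset_relAlgClosure hs.to_subtype_range hall
  have h2 : (Set.range (Sum.elim x z ∘ s)).encard = m := by
    rw [← Set.image_univ, hs.injective.encard_image]
    simp
  have h3 : S'.encard ≤ n + u := by
    refine (Set.encard_union_le _ _).trans (add_le_add hS ?_)
    rw [← Set.image_univ]
    exact (Set.encard_image_le _ _).trans (by simp)
  rw [h2] at h1
  exact_mod_cast h1.trans h3

end Core

section Generic

/-- The filter generated by the loci in `T` where a nonzero polynomial in the coordinates `E`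
does not vanish. -/
def genericFilter {k : Type} [Field k] {n e : ℕ} (T : Set (Fin n → k)) (E : Fin e → Fin n) :
    Filter T where
  sets := {A | ∃ f : MvPolynomial (Fin e) k, f ≠ 0 ∧ ∀ y : T, eval (y.1 ∘ E) f ≠ 0 → y ∈ A}
  univ_sets := ⟨1, one_ne_zero, fun _ _ => trivial⟩
  sets_of_superset := by
    rintro A B ⟨f, hf, h⟩ hAB
    exact ⟨f, hf, fun y hy => hAB (h y hy)⟩
  inter_sets := by
    rintro A B ⟨f, hf, h⟩ ⟨g, hg, h'⟩
    refine ⟨f * g, mul_ne_zero hf hg, fun y hy => ?_⟩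
    rw [map_mul] at hy
    exact ⟨h y (left_ne_zero_of_mul hy), h' y (right_ne_zero_of_mul hy)⟩

lemma eventually_genericFilter {k : Type} [Field k] {n e : ℕ} (T : Set (Fin n → k))
    (E : Fin e → Fin n) {f : MvPolynomial (Fin e) k} (hf : f ≠ 0) :
    ∀ᶠ y in genericFilter T E, eval (y.1 ∘ E) f ≠ 0 :=
  ⟨f, hf, fun _ h => h⟩

lemma genericFilter_neBot {k : Type} [Field k] {n e : ℕ} {T : Set (Fin n → k)}
    {E : Fin e → Fin n}
    (hE : ∀ f : MvPolynomial (Fin e) k, (∀ y ∈ T, eval (y ∘ E) f = 0) → f = 0) :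
    (genericFilter T E).NeBot := by
  refine ⟨fun hbot => ?_⟩
  obtain ⟨f, hf, h⟩ := Filter.empty_mem_iff_bot.2 hbot
  refine hf (hE f fun y hy => ?_)
  by_contra h0
  exact h ⟨y, hy⟩ h0

lemma Ultrafilter.exists_eventually_eq_const {ι α : Type} [Finite α] (U : Ultrafilter ι)
    (g : ι → α) : ∃ a, ∀ᶠ i in (U : Filter ι), g i = a := by
  obtain ⟨a, ha⟩ := (U.map g).eq_pure_of_finite
  refine ⟨a, ?_⟩
  have : ({a} : Set α) ∈ U.map g := by rw [ha]; exact rfl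
  exact this

lemma aeval_sumElim_algebraMap {k L : Type} [Field k] [Field L] [Algebra k L] {σ τ : Type}
    (a : σ → L) (b : τ → k) (P : MvPolynomial (σ ⊕ τ) k) :
    aeval (Sum.elim a fun j => algebraMap k L (b j)) P =
      aeval a (map (eval b) (sumAlgEquiv k σ τ P)) := by
  induction P using MvPolynomial.induction_on with
  | C c => simp
  | add p q hp hq => simp only [map_add, hp, hq]
  | mul_X p j hp =>
    rw [map_mul, map_mul, map_mul, map_mul, hp]
    congr 1
    rcases j with j | j <;> simp

/-- A family of Lagrange relations over a set of large dimension yields a relation at a generic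
point. -/
lemma PolarRel.exists_generic {k : Type} [Field k] {n u e : ℕ} {T : Set (Fin n → k)}
    {E : Fin e → Fin n}
    (hE : ∀ f : MvPolynomial (Fin e) k, (∀ y ∈ T, eval (y ∘ E) f = 0) → f = 0)
    {G Q : MvPolynomial (Fin n) k}
    (h : ∀ z ∈ T, ∃ (L : Type) (_ : Field L) (_ : Algebra k L) (x : Fin n → L)
      (s : Fin u → Fin n), AlgebraicIndependent k (x ∘ s) ∧
        PolarRel G Q x fun j => algebraMap k L (z j)) :
    ∃ (L : Type) (_ : Field L) (_ : Algebra k L) (x z : Fin n → L)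
      (s : Fin (u + e) → Fin n ⊕ Fin n), AlgebraicIndependent k (Sum.elim x z ∘ s) ∧
        PolarRel G Q x z := by
  choose L iF iA x s hs hrel using fun z : T => h z.1 z.2
  have := genericFilter_neBot hE
  let U : Ultrafilter T := Ultrafilter.of (genericFilter T E)
  have hU : ∀ f : MvPolynomial (Fin e) k, f ≠ 0 →
      ∀ᶠ y in (U : Filter T), eval (y.1 ∘ E) f ≠ 0 := fun f hf =>
    Ultrafilter.of_le _ (eventually_genericFilter T E hf)
  obtain ⟨s₀, hs₀⟩ := U.exists_eventually_eq_const s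
  choose α β hα hβ hl using hrel
  let x' : Fin n → UProd U L := fun j => UProd.mk U L fun y => x y j
  let z' : Fin n → UProd U L := fun j => UProd.mk U L fun y => algebraMap k (L y) (y.1 j)
  refine ⟨UProd U L, inferInstance, inferInstance, x', z',
    Sum.map s₀ E ∘ finSumFinEquiv.symm, ?_, UProd.mk U L α, UProd.mk U L β, ?_, ?_, fun l => ?_⟩
  · rw [← Function.comp_assoc, algebraicIndependent_equiv, algebraicIndependent_iff]
    intro P hP
    have hx : Sum.elim x' z' ∘ Sum.map s₀ E = fun j => UProd.mk U L
        (Sum.elim (fun i y => x y (s₀ i)) (fun i y => algebraMap k (L y) (y.1 (E i))) j) := by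
      funext j
      rcases j with j | j <;> rfl
    rw [hx, UProd.aeval_mk_diag, UProd.mk_eq_zero] at hP
    by_contra hP0
    have hP1 : sumAlgEquiv k (Fin u) (Fin e) P ≠ 0 := by simpa using hP0
    obtain ⟨m, hm⟩ := ne_zero_iff.1 hP1
    obtain ⟨y, ⟨hy1, hy2⟩, hy3⟩ := ((hP.and (hU _ hm)).and hs₀).exists
    have hy4 : aeval (x y ∘ s y) (map (eval (y.1 ∘ E)) (sumAlgEquiv k (Fin u) (Fin e) P)) = 0 := by
      rw [← aeval_sumElim_algebraMap, ← hy1, hy3]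
      congr 2
      funext j
      rcases j with j | j <;> rfl
    have hy5 := algebraicIndependent_iff.1 (hs y) _ hy4
    apply hy2
    rw [← coeff_map, hy5, coeff_zero]
  · rw [UProd.aeval_mk_diag, ← map_mul, UProd.mk_eq_zero]
    exact Filter.Eventually.of_forall hα
  · rw [UProd.aeval_mk_diag, ← map_mul, UProd.mk_eq_zero]
    exact Filter.Eventually.of_forall hβ
  · simp only [x', z', UProd.aeval_mk_diag, ← map_mul, ← map_sum, ← map_add]
    rw [UProd.mk_eq_mk]
    refine Filter.Eventually.of_forall fun y => ?_
    simpa using hl y l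

end Generic

section Transfer

namespace UProd

variable {ι : Type} {U : Ultrafilter ι} {K : ι → Type} [∀ i, Field (K i)]

lemma eval_mk {σ : Type} (x : σ → ∀ i, K i) (P : MvPolynomial σ (∀ i, K i)) :
    eval (fun j => mk U K (x j)) (map (mk U K) P) =
      mk U K fun i => eval (fun j => x j i) (map (Pi.evalRingHom K i) P) := by
  induction P using MvPolynomial.induction_on with
  | C c => simp
  | add p q hp hq =>
    simp only [map_add, hp, hq]
    rfl
  | mul_X p j hp =>
    simp only [map_mul, hp, eval_X, map_X]
    rfl

lemma exists_map_eq {n N : ℕ} (G : ∀ i, MvPolynomial (Fin n) (K i))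
    (hG : ∀ i, (G i).totalDegree ≤ N) :
    ∃ P : MvPolynomial (Fin n) (∀ i, K i), ∀ i, map (Pi.evalRingHom K i) P = G i := by
  classical
  have hfin : {m : Fin n →₀ ℕ | m.degree ≤ N}.Finite := Finsupp.finite_of_degree_le N
  refine ⟨∑ m ∈ hfin.toFinset, monomial m fun i => coeff m (G i), fun i => ?_⟩
  ext m
  simp only [map_sum, map_monomial, coeff_sum, coeff_monomial, Pi.evalRingHom_apply]
  rw [Finset.sum_ite_eq']
  split_ifs with hm
  · rfl
  · by_contra h
    exact hm (hfin.mem_toFinset.2 ((le_totalDegree (mem_support_iff.2 (Ne.symm h))).trans (hG i)))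

lemma isHomogeneous_map_mk {σ : Type} {d : ℕ} {P : MvPolynomial σ (∀ i, K i)}
    (h : ∀ i, (map (Pi.evalRingHom K i) P).IsHomogeneous d) :
    (map (mk U K) P).IsHomogeneous d := by
  intro m hm
  rw [coeff_map, Ne, mk_eq_zero] at hm
  obtain ⟨i, hi⟩ := (Filter.not_eventually.1 hm).exists
  exact h i (by rwa [coeff_map])

end UProd

/-- A point of the incidence variety of the Lagrange relation of dimension larger than
expected. -/
def HasExcessPolar (n d u e : ℕ) (s : Fin (n + u + 1) → Fin n ⊕ Fin n) (k : Type) [Field k] :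
    Prop :=
  ∃ G Q : MvPolynomial (Fin n) k, G.IsHomogeneous d ∧ Q.IsHomogeneous (e + 1) ∧
    ∃ ℓ : Fin u → Fin n → k, (∀ a : Fin n → k, (∀ j, eval a (pderiv j Q) = 0) →
      (∀ i, ∑ j, ℓ i j * a j = 0) → a = 0) ∧
    ∃ (L : Type) (_ : Field L) (_ : Algebra k L) (x z : Fin n → L),
      AlgebraicIndependent k (Sum.elim x z ∘ s) ∧ PolarRel G Q x z

lemma eventually_not_hasExcessPolar {n d u e : ℕ} (he : 0 < e)
    (s : Fin (n + u + 1) → Fin n ⊕ Fin n) :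
    ∀ᶠ p in Filter.atTop, ∀ (k : Type) (_ : Field k) (_ : IsAlgClosed k), ringChar k = p →
      ¬ HasExcessPolar n d u e s k := by
  by_contra hcon
  obtain ⟨φ, hφ, hbad⟩ := Filter.extraction_of_frequently_atTop
    (Filter.not_eventually.1 hcon)
  push Not at hbad
  unfold HasExcessPolar PolarRel at hbad
  choose K iK hK hchar G Q hG hQ ℓ hℓ L iL iA x z hs α β hα hβ hl using hbad
  let U : Ultrafilter ℕ := Filter.hyperfilter ℕ
  obtain ⟨G', hG'⟩ := UProd.exists_map_eq G fun i => (hG i).totalDegree_le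
  obtain ⟨Q', hQ'⟩ := UProd.exists_map_eq Q fun i => (hQ i).totalDegree_le
  have hchar0 : CharZero (UProd U K) := UProd.charZero fun m hm => by
    have : ∀ᶠ i in (U : Filter ℕ), m < i :=
      Nat.hyperfilter_le_atTop (Filter.eventually_gt_atTop m)
    filter_upwards [this] with i hi h0
    have h1 := (ringChar.spec (K i) m).1 h0
    rw [hchar] at h1
    have := Nat.le_of_dvd (Nat.pos_of_ne_zero hm) h1
    have := hφ.id_le i
    simp only [id] at this
    omega
  have hcard := PolarRel.card_le (k := UProd U K) (L := UProd U L)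
    (G := map (UProd.mk U K) G') (Q := map (UProd.mk U K) Q') (e := e)
    (x := fun j => UProd.mk U L fun i => x i j) (z := fun j => UProd.mk U L fun i => z i j)
    ⟨UProd.mk U L α, UProd.mk U L β, ?_, ?_, ?_⟩
    (UProd.isHomogeneous_map_mk fun i => by rw [hQ']; exact hQ i) he
    (fun t j => UProd.mk U K fun i => ℓ i t j) ?_ s ?_
  · omega
  · rw [UProd.aeval_mk, ← map_mul, UProd.mk_eq_zero]
    exact Filter.Eventually.of_forall fun i => by simpa [hG'] using hα i
  · rw [UProd.aeval_mk, ← map_mul, UProd.mk_eq_zero]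
    exact Filter.Eventually.of_forall fun i => by simpa [hQ'] using hβ i
  · intro l
    simp only [pderiv_map, UProd.aeval_mk, ← map_mul, ← map_sum, ← map_add]
    rw [UProd.mk_eq_mk]
    refine Filter.Eventually.of_forall fun i => ?_
    simpa [← pderiv_map, hG', hQ'] using hl i l
  · intro a ha hla
    choose a' ha' using fun j => UProd.mk_surjective (U := U) (K := K) (a j)
    obtain rfl : (fun j => UProd.mk U K (a' j)) = a := funext ha'
    simp only [pderiv_map, UProd.eval_mk, ← map_mul, ← map_sum, UProd.mk_eq_zero] at ha hla
    rw [← Filter.eventually_all] at ha hla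
    have h0 : ∀ᶠ i in (U : Filter ℕ), ∀ j, a' j i = 0 := by
      filter_upwards [ha, hla] with i h1 h2
      refine congrFun (hℓ i (fun j => a' j i) (fun j => ?_) fun t => ?_)
      · simpa [← pderiv_map, hQ'] using h1 j
      · simpa using h2 t
    funext j
    rw [Pi.zero_apply, UProd.mk_eq_zero]
    exact h0.mono fun i hi => hi j
  · have := UProd.algebraicIndependent_mk (U := U) (K := K) (L := L)
      (fun t i => Sum.elim (x i) (z i) (s t)) hs
    convert this using 2 with t
    rw [Function.comp_apply]
    rcases s t <;> rfl

end Transfer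

section Reflection

lemma singIdeal_le_iff {k : Type} [Field k] {n r : ℕ} {f : Fin r → MvPolynomial (Fin n) k}
    {P : Ideal (MvPolynomial (Fin n) k)} :
    singIdeal f ≤ P ↔ (∀ i, f i ∈ P) ∧ ∀ c, jacMinor f c ∈ P := by
  rw [singIdeal, Ideal.span_le, Set.union_subset_iff, Set.range_subset_iff, Set.range_subset_iff]
  rfl

lemma jacMinor_one {k : Type} [Field k] {n : ℕ} (G : MvPolynomial (Fin n) k) (c : Fin 1 → Fin n) :
    jacMinor ![G] c = pderiv (c 0) G := by
  simp [jacMinor]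

lemma jacMinor_two {k : Type} [Field k] {n : ℕ} (G Q : MvPolynomial (Fin n) k)
    (c : Fin 2 → Fin n) :
    jacMinor ![G, Q] c = pderiv (c 0) G * pderiv (c 1) Q - pderiv (c 1) G * pderiv (c 0) Q := by
  simp [jacMinor, Matrix.det_fin_two]

lemma jacMinor_three {k : Type} [Field k] {n : ℕ} (G Q R : MvPolynomial (Fin n) k)
    (c : Fin 3 → Fin n) :
    jacMinor ![G, Q, R] c =
      pderiv (c 2) G * (pderiv (c 0) Q * pderiv (c 1) R - pderiv (c 1) Q * pderiv (c 0) R) -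
      pderiv (c 2) Q * (pderiv (c 0) G * pderiv (c 1) R - pderiv (c 1) G * pderiv (c 0) R) +
      pderiv (c 2) R * (pderiv (c 0) G * pderiv (c 1) Q - pderiv (c 1) G * pderiv (c 0) Q) := by
  simp [jacMinor, Matrix.det_fin_three]
  ring

lemma singIdeal_one_le_iff {k : Type} [Field k] {n : ℕ} {G : MvPolynomial (Fin n) k}
    {P : Ideal (MvPolynomial (Fin n) k)} :
    singIdeal ![G] ≤ P ↔ G ∈ P ∧ ∀ l, pderiv l G ∈ P := by
  simp only [singIdeal_le_iff, jacMinor_one, Fin.forall_fin_one, Matrix.cons_val_zero]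
  exact and_congr_right fun _ => ⟨fun h l => h fun _ => l, fun h c => h (c 0)⟩

lemma aeval_pderiv_polY {k L : Type} [Field k] [Field L] [Algebra k L] {n : ℕ} (x : Fin n → L)
    (z : Fin n → k) (Q : MvPolynomial (Fin n) k) (l : Fin n) :
    aeval x (pderiv l (polY z Q)) =
      ∑ j, algebraMap k L (z j) * aeval x (pderiv l (pderiv j Q)) := by
  simp [polY]

lemma isHomogeneous_polY {k : Type} [Field k] {n e : ℕ} {G : MvPolynomial (Fin n) k}
    (hG : G.IsHomogeneous (e + 1)) (y : Fin n → k) : (polY y G).IsHomogeneous e :=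
  IsHomogeneous.sum _ _ _ fun i _ => by
    simpa using (isHomogeneous_C (Fin n) (y i)).mul (hG.pderiv (i := i))

lemma eval_eq_zero_of_pderiv {k : Type} [Field k] {n m : ℕ} {Q : MvPolynomial (Fin n) k}
    (hQ : Q.IsHomogeneous m) (hm : (m : k) ≠ 0) {a : Fin n → k}
    (h : ∀ j, eval a (pderiv j Q) = 0) : eval a Q = 0 := by
  have h1 := congrArg (eval a) hQ.sum_X_mul_pderiv
  simp [h] at h1
  exact h1.resolve_left hm

lemma R0prop.eq_zero {k L : Type} [Field k] [Field L] [Algebra k L] {n : ℕ}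
    {G : MvPolynomial (Fin n) k} (h : R0prop G) {x : Fin n → L} (hx : aeval x G = 0)
    (hx' : ∀ l, aeval x (pderiv l G) = 0) : x = 0 := by
  have := h (RingHom.ker (aeval (R := k) x)) (RingHom.ker_isPrime _)
    (singIdeal_one_le_iff.2 ⟨hx, hx'⟩)
  funext i
  simpa using this i

lemma ringKrullDim_quotient_mvPolynomial_le {k : Type} [Field k] {n : ℕ}
    (I : Ideal (MvPolynomial (Fin n) k)) :
    ringKrullDim (MvPolynomial (Fin n) k ⧸ I) ≤ n := by
  refine (ringKrullDim_quotient_le I).trans ?_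
  rw [MvPolynomial.ringKrullDim_of_isNoetherianRing]
  simp

lemma polarRel_of_singIdeal_one {k L : Type} [Field k] [Field L] [Algebra k L] {n : ℕ}
    {Q : MvPolynomial (Fin n) k} (G : MvPolynomial (Fin n) k) {x : Fin n → L} {z : Fin n → k}
    (hx : ∀ f ∈ singIdeal ![polY z Q], aeval x f = 0) :
    PolarRel G Q x fun j => algebraMap k L (z j) := by
  have h := (singIdeal_one_le_iff (P := RingHom.ker (aeval (R := k) x))).1 hx
  refine ⟨0, 0, by simp, by simp, fun l => ?_⟩
  rw [← aeval_pderiv_polY, zero_mul, zero_mul, add_zero]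
  exact h.2 l

lemma polarRel_of_singIdeal_two {k L : Type} [Field k] [Field L] [Algebra k L] {n : ℕ}
    {G : MvPolynomial (Fin n) k} (Q : MvPolynomial (Fin n) k) (hG : R0prop G) {x : Fin n → L}
    (hx0 : x ≠ 0) {z : Fin n → k} (hx : ∀ f ∈ singIdeal ![G, polY z Q], aeval x f = 0) :
    PolarRel G Q x fun j => algebraMap k L (z j) := by
  have h := (singIdeal_le_iff (P := RingHom.ker (aeval (R := k) x))).1 hx
  have hG0 : aeval x G = 0 := h.1 0
  obtain ⟨a, ha⟩ : ∃ a, aeval x (pderiv a G) ≠ 0 := by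
    by_contra! hcon
    exact hx0 (hG.eq_zero hG0 hcon)
  refine ⟨aeval x (pderiv a (polY z Q)) / aeval x (pderiv a G), 0, by simp [hG0], by simp,
    fun l => ?_⟩
  have h2 := h.2 ![a, l]
  rw [jacMinor_two, RingHom.mem_ker] at h2
  simp only [Matrix.cons_val_zero, Matrix.cons_val_one, map_sub, map_mul] at h2
  rw [← aeval_pderiv_polY]
  field_simp
  linear_combination h2

lemma polarRel_of_singIdeal_three {k L : Type} [Field k] [Field L] [Algebra k L] {n : ℕ}
    {G Q : MvPolynomial (Fin n) k} {x : Fin n → L} {z : Fin n → k}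
    (hx : ∀ f ∈ singIdeal ![G, Q, polY z Q], aeval x f = 0)
    (hx' : ¬ ∀ f ∈ singIdeal ![G, Q], aeval x f = 0) :
    PolarRel G Q x fun j => algebraMap k L (z j) := by
  have h := (singIdeal_le_iff (P := RingHom.ker (aeval (R := k) x))).1 hx
  have hG0 : aeval x G = 0 := h.1 0
  have hQ0 : aeval x Q = 0 := h.1 1
  obtain ⟨c, hc⟩ : ∃ c, aeval x (jacMinor ![G, Q] c) ≠ 0 := by
    by_contra! hcon
    refine hx' ((singIdeal_le_iff (P := RingHom.ker (aeval (R := k) x))).2 ⟨fun i => ?_, hcon⟩)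
    fin_cases i
    · exact hG0
    · exact hQ0
  rw [jacMinor_two] at hc
  simp only [map_sub, map_mul] at hc
  set r : Fin n → L := fun l => aeval x (pderiv l (polY z Q))
  set g : Fin n → L := fun l => aeval x (pderiv l G)
  set q : Fin n → L := fun l => aeval x (pderiv l Q)
  have hδ : g (c 0) * q (c 1) - g (c 1) * q (c 0) ≠ 0 := hc
  refine ⟨-(q (c 0) * r (c 1) - q (c 1) * r (c 0)) / (g (c 0) * q (c 1) - g (c 1) * q (c 0)),
    (g (c 0) * r (c 1) - g (c 1) * r (c 0)) / (g (c 0) * q (c 1) - g (c 1) * q (c 0)),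
    by simp [hG0], by simp [hQ0], fun l => ?_⟩
  have h2 := h.2 ![c 0, c 1, l]
  rw [jacMinor_three, RingHom.mem_ker] at h2
  simp only [Matrix.cons_val_zero, Matrix.cons_val_one, Matrix.cons_val, map_add, map_sub,
    map_mul] at h2
  have h3 : g l * (q (c 0) * r (c 1) - q (c 1) * r (c 0)) -
      q l * (g (c 0) * r (c 1) - g (c 1) * r (c 0)) +
      r l * (g (c 0) * q (c 1) - g (c 1) * q (c 0)) = 0 := h2
  rw [← aeval_pderiv_polY]
  change r l = _ * g l + _ * q l
  rw [div_mul_eq_mul_div, div_mul_eq_mul_div, ← add_div, eq_div_iff hδ]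
  linear_combination h3

lemma exists_hasExcessPolar_of_le_coneDim {k : Type} [Field k] {n d u e v m : ℕ}
    {T : Set (Fin n → k)} (hT : (m : WithBot ℕ∞) ≤ coneDim T) (hvm : v + m = n + u + 1)
    {G Q : MvPolynomial (Fin n) k} (hG : G.IsHomogeneous d) (hQ : Q.IsHomogeneous (e + 1))
    (ℓ : Fin u → Fin n → k)
    (hℓ : ∀ a : Fin n → k, (∀ j, eval a (pderiv j Q) = 0) → (∀ i, ∑ j, ℓ i j * a j = 0) → a = 0)
    (h : ∀ z ∈ T, ∃ (L : Type) (_ : Field L) (_ : Algebra k L) (x : Fin n → L)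
      (s : Fin v → Fin n), AlgebraicIndependent k (x ∘ s) ∧
        PolarRel G Q x fun j => algebraMap k L (z j)) :
    ∃ s, HasExcessPolar n d u e s k := by
  obtain ⟨E, hE⟩ := exists_dominant_of_le_coneDim T hT
  obtain ⟨L, iL, iA, x, z, s, hs, hrel⟩ := PolarRel.exists_generic hE h
  exact ⟨s ∘ Fin.cast hvm.symm, G, Q, hG, hQ, ℓ, hℓ, L, iL, iA, x, z,
    hs.comp _ (Fin.cast_injective _), hrel⟩

lemma natCast_succ_le_of_not_le {a : WithBot ℕ∞} {m : ℕ} (h : ¬ a ≤ (m : WithBot ℕ∞)) :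
    ((m + 1 : ℕ) : WithBot ℕ∞) ≤ a := by
  induction a with
  | bot => simp at h
  | coe a =>
    induction a with
    | top => exact WithBot.coe_le_coe.2 le_top
    | coe a =>
      norm_cast at h ⊢
      omega

theorem R1prop_of_not_hasExcessPolar {k : Type} [Field k] [IsAlgClosed k] {n e : ℕ}
    {G : MvPolynomial (Fin n) k} (hG : G.IsHomogeneous (e + 1)) (he : ((e + 1 : ℕ) : k) ≠ 0)
    (h0 : R0prop G) (hno : ∀ s, ¬ HasExcessPolar n (e + 1) 0 e s k) : R1prop G := by
  intro u hu
  by_contra hcon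
  rcases Nat.eq_zero_or_pos u with rfl | hu0
  · exact hcon (ringKrullDim_quotient_mvPolynomial_le _)
  refine (exists_hasExcessPolar_of_le_coneDim (v := u) (u := 0)
    (natCast_succ_le_of_not_le hcon) (by omega) hG hG 0
    (fun a ha _ => h0.eq_zero (L := k) (x := a)
      (by simpa [aeval_eq_eval] using eval_eq_zero_of_pderiv hG he ha)
      fun l => by simpa [aeval_eq_eval] using ha l) fun y hy => ?_).elim hno
  rcases hy with hy | hy
  · obtain ⟨L, iL, iA, x, s, hx, hs⟩ := exists_point_of_le_ringKrullDim _ hy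
    refine ⟨L, iL, iA, x, s, hs, polarRel_of_singIdeal_two G h0 ?_ hx⟩
    rintro rfl
    exact hs.ne_zero ⟨0, hu0⟩ rfl
  · obtain ⟨L, iL, iA, x, s, hx, hs⟩ := exists_point_of_le_ringKrullDim _ hy
    exact ⟨L, iL, iA, x, s, hs, polarRel_of_singIdeal_one G hx⟩

lemma eval_smul_of_isHomogeneous {k : Type} [Field k] {n m : ℕ} {Q : MvPolynomial (Fin n) k}
    (hQ : Q.IsHomogeneous m) (c : k) (a : Fin n → k) : eval (c • a) Q = c ^ m * eval a Q := by
  have h := aeval_mul_of_isHomogeneous (L := k) hQ c a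
  simp only [aeval_eq_eval] at h
  exact h

theorem R2prop_of_not_hasExcessPolar {k : Type} [Field k] [IsAlgClosed k] {n e : ℕ}
    {G : MvPolynomial (Fin n) k} (hG : G.IsHomogeneous (e + 2)) (he : ((e + 1 : ℕ) : k) ≠ 0)
    (hno : ∀ u ≤ n, ∀ s, ¬ HasExcessPolar n (e + 2) u e s k) : R2prop G := by
  intro y u t ht hdim2 hdim1
  by_contra hcon
  rcases Nat.eq_zero_or_pos t with rfl | ht0
  · exact hcon (ringKrullDim_quotient_mvPolynomial_le _)
  have hQ : (polY y G).IsHomogeneous (e + 1) := isHomogeneous_polY hG y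
  have hut : u ≤ n := by
    obtain ⟨E, hE⟩ := exists_dominant_of_le_coneDim _ (natCast_succ_le_of_not_le hcon)
    by_contra hun
    refine one_ne_zero (hE 1 fun z hz => ?_)
    have := hz.trans (ringKrullDim_quotient_mvPolynomial_le _)
    norm_cast at this
    omega
  have hker : ∀ {a : Fin n → k}, (∀ f ∈ singIdeal ![polY y G], eval a f = 0) ↔
      eval a (polY y G) = 0 ∧ ∀ l, eval a (pderiv l (polY y G)) = 0 := fun {a} =>
    singIdeal_one_le_iff (P := RingHom.ker (eval a))
  obtain ⟨ℓ, hℓ⟩ := exists_linear_forms_of_ringKrullDim_le _ hdim1 fun a ha c => by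
    rw [hker] at ha ⊢
    refine ⟨?_, fun l => ?_⟩
    · rw [eval_smul_of_isHomogeneous hQ, ha.1, mul_zero]
    · rw [eval_smul_of_isHomogeneous hQ.pderiv, ha.2, mul_zero]
  refine (exists_hasExcessPolar_of_le_coneDim (v := u + t) (u := u)
    (natCast_succ_le_of_not_le hcon) (by omega) hG hQ ℓ
    (fun a ha => hℓ a (hker.2 ⟨eval_eq_zero_of_pderiv hQ he ha, ha⟩)) fun z hz => ?_).elim (hno u hut)
  obtain ⟨L, iL, iA, x, s, hx, hs⟩ := exists_point_of_le_ringKrullDim _ hz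
  refine ⟨L, iL, iA, x, s, hs, polarRel_of_singIdeal_three hx fun hx' => ?_⟩
  have := (le_ringKrullDim_of_point _ x hx' s hs).trans hdim2
  norm_cast at this
  omega

end Reflection

section LinearAlgebra

lemma exists_submatrix_det_ne_zero {K R : Type} [Field K] [Finite R] {r : ℕ}
    {A : Matrix R (Fin r) K} (hA : LinearIndependent K A.col) :
    ∃ I : Fin r → R, (A.submatrix I id).det ≠ 0 := by
  have := Fintype.ofFinite R
  obtain ⟨f, hf, -, hli⟩ := Submodule.exists_fun_fin_finrank_span_eq K (Set.range A.row)
  have hr : Module.finrank K (Submodule.span K (Set.range A.row)) = r := by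
    rw [← Matrix.rank_eq_finrank_span_row, ← Matrix.rank_transpose]
    simpa using hA.rank_matrix
  choose I hI using hf
  let J : Fin r → R := fun i => I (Fin.cast hr.symm i)
  have hJ : LinearIndependent K (A.submatrix J id).row := by
    have hrow : (A.submatrix J id).row = f ∘ Fin.cast hr.symm := funext fun i => hI _
    rw [hrow]
    exact hli.comp _ (Fin.cast_injective _)
  exact ⟨J, ((Matrix.isUnit_iff_isUnit_det _).1
    (Matrix.linearIndependent_rows_iff_isUnit.1 hJ)).ne_zero⟩

/-- An integral linear system soluble in characteristic zero is soluble over `ℤ` up to a bounded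
denominator. -/
lemma exists_int_solution {K R C : Type} [Field K] [CharZero K] [Fintype R] [Fintype C]
    (A : Matrix R C ℤ) (b : R → ℤ) (c : C → K)
    (hc : ∀ i, ∑ j, (A i j : K) * c j = b i) (B : ℕ) (hB : 1 ≤ B) (hA : ∀ i j, |A i j| ≤ B) :
    ∃ D : ℤ, D ≠ 0 ∧ |D| ≤ (Fintype.card C).factorial * B ^ Fintype.card C ∧
      ∃ c' : C → ℤ, ∀ i, ∑ j, A i j * c' j = D * b i := by
  classical
  let A' : Matrix R C K := A.map (Int.castRingHom K)
  obtain ⟨r, hrC, f, hf, hspan, hli⟩ : ∃ r ≤ Fintype.card C, ∃ f : Fin r → R → K,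
      (∀ i, f i ∈ Set.range A'.col) ∧
        Submodule.span K (Set.range f) = Submodule.span K (Set.range A'.col) ∧
        LinearIndependent K f :=
    ⟨_, finrank_range_le_card _,
      Submodule.exists_fun_fin_finrank_span_eq K (Set.range A'.col)⟩
  choose J hJ using hf
  have hbmem : (fun i => (b i : K)) ∈ Submodule.span K (Set.range f) := by
    rw [hspan]
    have : (fun i => (b i : K)) = ∑ j, c j • A'.col j := by
      funext i
      rw [← hc i, Finset.sum_apply]
      exact Finset.sum_congr rfl fun j _ => mul_comm _ _
    rw [this]
    exact Submodule.sum_mem _ fun j _ => Submodule.smul_mem _ _ (Submodule.subset_span ⟨j, rfl⟩)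
  obtain ⟨γ, hγ⟩ := (Submodule.mem_span_range_iff_exists_fun K).1 hbmem
  have hγ' : ∀ i, ∑ j, (A i (J j) : K) * γ j = b i := fun i => by
    rw [← congrFun hγ i, Finset.sum_apply]
    refine Finset.sum_congr rfl fun j _ => ?_
    rw [← hJ j]
    exact mul_comm _ _
  obtain ⟨I, hI⟩ := exists_submatrix_det_ne_zero (A := A'.submatrix id J) (by
    have hcol : (A'.submatrix id J).col = f := funext hJ
    rwa [hcol])
  let S : Matrix (Fin r) (Fin r) ℤ := A.submatrix I J
  have hS : (S.det : K) ≠ 0 := by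
    convert hI
    exact RingHom.map_det (Int.castRingHom K) S
  let γ' : Fin r → ℤ := S.adjugate.mulVec (b ∘ I)
  have hγγ' : ∀ j, (γ' j : K) = S.det * γ j := by
    intro j
    have h1 : (S.map (Int.castRingHom K)).mulVec γ = fun i => (b (I i) : K) := by
      funext i
      exact hγ' (I i)
    have h2 := congrArg ((S.map (Int.castRingHom K)).adjugate.mulVec) h1
    rw [Matrix.mulVec_mulVec, Matrix.adjugate_mul, Matrix.smul_mulVec, Matrix.one_mulVec] at h2
    have h3 := congrFun h2 j
    have h4 : (S.map (Int.castRingHom K)).det = (S.det : K) :=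
      (RingHom.map_det (Int.castRingHom K) S).symm
    have h5 : (S.map (Int.castRingHom K)).adjugate = S.adjugate.map (Int.castRingHom K) :=
      (RingHom.map_adjugate (Int.castRingHom K) S).symm
    rw [h4, h5] at h3
    rw [Pi.smul_apply, smul_eq_mul] at h3
    rw [h3]
    simp [γ', Matrix.mulVec, dotProduct]
  refine ⟨S.det, fun h => hS (by simp [h]), ?_, fun j => ∑ t with J t = j, γ' t, fun i => ?_⟩
  · have h1 := Matrix.det_le (A := S) (abv := AbsoluteValue.abs) (x := (B : ℤ))
      fun i j => hA _ _
    rw [Fintype.card_fin, nsmul_eq_mul] at h1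
    refine le_trans h1 ?_
    norm_cast
    gcongr
  · have h1 : ∑ j, A i j * ∑ t with J t = j, γ' t = ∑ t, A i (J t) * γ' t := by
      rw [← Finset.sum_fiberwise Finset.univ J]
      refine Finset.sum_congr rfl fun j _ => ?_
      rw [Finset.mul_sum]
      refine Finset.sum_congr rfl fun t ht => ?_
      rw [(Finset.mem_filter.1 ht).2]
    rw [h1]
    have h2 : ((∑ t, A i (J t) * γ' t : ℤ) : K) = ((S.det * b i : ℤ) : K) := by
      simp only [Int.cast_sum, Int.cast_mul]
      rw [← hγ' i, Finset.mul_sum]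
      refine Finset.sum_congr rfl fun t _ => ?_
      rw [hγγ']
      ring
    exact_mod_cast h2

end LinearAlgebra

section Effective

/-- A power of a variable with exponent at most `N` is a combination of `g` with coefficients of
degree at most `N`. -/
def HasCertificate {K τ : Type} [CommRing K] [Fintype τ] {n : ℕ} (N : ℕ)
    (g : τ → MvPolynomial (Fin n) K) (i : Fin n) : Prop :=
  ∃ e ≤ N, ∃ c : τ → MvPolynomial (Fin n) K, (∀ t, (c t).totalDegree ≤ N) ∧
    ∑ t, c t * g t = X i ^ e

lemma HasCertificate.mono {K τ : Type} [Field K] [Fintype τ] {n N M : ℕ}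
    {g : τ → MvPolynomial (Fin n) K} {i : Fin n} (h : HasCertificate N g i) (hNM : N ≤ M) :
    HasCertificate M g i := by
  obtain ⟨e, he, c, hc, hsum⟩ := h
  exact ⟨e, he.trans hNM, c, fun t => (hc t).trans hNM, hsum⟩

lemma exists_hasCertificate {K τ : Type} [Field K] [IsAlgClosed K] [Fintype τ] {n : ℕ}
    {g : τ → MvPolynomial (Fin n) K}
    (h : ∀ a : Fin n → K, (∀ t, eval a (g t) = 0) → a = 0) :
    ∃ N, ∀ i, HasCertificate N g i := by
  have h1 : ∀ i, ∃ N, HasCertificate N g i := by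
    intro i
    obtain ⟨e, he⟩ := exists_X_pow_mem_span h i
    obtain ⟨c, hc⟩ := Ideal.mem_span_range_iff_exists_fun.1 he
    exact ⟨max e (Finset.univ.sup fun t => (c t).totalDegree), e, le_max_left _ _, c, fun t =>
      le_max_of_le_right (Finset.le_sup (f := fun t => (c t).totalDegree) (Finset.mem_univ t)), hc⟩
  choose N hN using h1
  exact ⟨Finset.univ.sup N, fun i => (hN i).mono (Finset.le_sup (Finset.mem_univ i))⟩

lemma UProd.exists_map_mk_eq {ι : Type} {U : Ultrafilter ι} {K : ι → Type} [∀ i, Field (K i)]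
    {σ : Type} (P : MvPolynomial σ (UProd U K)) :
    ∃ P' : MvPolynomial σ (∀ i, K i), map (mk U K) P' = P ∧ P'.totalDegree ≤ P.totalDegree := by
  choose f hf using mk_surjective (U := U) (K := K)
  refine ⟨∑ m ∈ P.support, monomial m (f (coeff m P)), ?_, ?_⟩
  · simp only [map_sum, map_monomial, hf]
    exact P.support_sum_monomial_coeff
  · exact totalDegree_finsetSum_le fun m hm =>
      (totalDegree_monomial_le _ _).trans (le_totalDegree hm)

lemma UProd.eventually_hasCertificate {ι : Type} {U : Ultrafilter ι} {K : ι → Type}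
    [∀ i, Field (K i)] {τ : Type} [Fintype τ] {n N : ℕ}
    {g : τ → MvPolynomial (Fin n) (∀ i, K i)} {j : Fin n}
    (h : HasCertificate N (fun t => map (mk U K) (g t)) j) :
    ∀ᶠ i in (U : Filter ι), HasCertificate N (fun t => map (Pi.evalRingHom K i) (g t)) j := by
  obtain ⟨e, he, c, hc, hsum⟩ := h
  choose c' hc' hdeg using fun t => exists_map_mk_eq (c t)
  have h0 : map (mk U K) (∑ t, c' t * g t - X j ^ e) = 0 := by
    simp [hc', hsum]
  filter_upwards [map_mk_eq_zero.1 h0] with i hi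
  refine ⟨e, he, fun t => map (Pi.evalRingHom K i) (c' t), fun t =>
    (Finset.sup_mono (support_map_subset _ _)).trans ((hdeg t).trans (hc t)), ?_⟩
  simpa [sub_eq_zero] using hi

/-- A uniform Nullstellensatz for systems of bounded degree with no common zero other than the
origin. -/
theorem exists_uniform_certificate (K τ : Type) [Field K] [IsAlgClosed K] [Fintype τ] (n d : ℕ) :
    ∃ N, ∀ g : τ → MvPolynomial (Fin n) K, (∀ t, (g t).totalDegree ≤ d) →
      (∀ a : Fin n → K, (∀ t, eval a (g t) = 0) → a = 0) → ∀ i, HasCertificate N g i := by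
  by_contra! hcon
  choose g hdeg hg i hi using hcon
  let U : Ultrafilter ℕ := Filter.hyperfilter ℕ
  choose g' hg' using fun t => UProd.exists_map_eq (K := fun _ : ℕ => K) (fun m => g m t)
    fun m => hdeg m t
  obtain ⟨N, hN⟩ := exists_hasCertificate
    (g := fun t => map (UProd.mk U fun _ : ℕ => K) (g' t)) fun a ha => by
      choose a' ha' using fun j => UProd.mk_surjective (U := U) (K := fun _ : ℕ => K) (a j)
      obtain rfl : (fun j => UProd.mk U _ (a' j)) = a := funext ha'
      simp only [UProd.eval_mk, UProd.mk_eq_zero, hg'] at ha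
      rw [← Filter.eventually_all] at ha
      funext j
      rw [Pi.zero_apply, UProd.mk_eq_zero]
      filter_upwards [ha] with m hm
      exact congrFun (hg m (fun j => a' j m) hm) j
  have h1 := Filter.eventually_all.2 fun j => UProd.eventually_hasCertificate (hN j)
  have h2 : ∀ᶠ m in (U : Filter ℕ), N ≤ m :=
    Nat.hyperfilter_le_atTop (Filter.eventually_ge_atTop N)
  obtain ⟨m, hm1, hm2⟩ := (h1.and h2).exists
  simp only [hg'] at hm1
  exact hi m ((hm1 (i m)).mono hm2)

/-- A certificate in characteristic zero for an integral system yields one over `ℤ` up to a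
denominator bounded in terms of the coefficients. -/
theorem exists_int_certificate (τ : Type) [Fintype τ] (n N : ℕ) :
    ∃ κ : ℕ, ∀ (K : Type) [Field K] [CharZero K] (g : τ → MvPolynomial (Fin n) ℤ) (B : ℕ), 1 ≤ B →
      (∀ t m, |coeff m (g t)| ≤ B) → ∀ i,
      HasCertificate N (fun t => map (Int.castRingHom K) (g t)) i →
      ∃ D : ℤ, D ≠ 0 ∧ |D| ≤ κ.factorial * B ^ κ ∧ ∃ e, C D * X i ^ e ∈ Ideal.span (Set.range g) := by
  classical
  let S : Finset (Fin n →₀ ℕ) := (Finsupp.finite_of_degree_le N).toFinset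
  refine ⟨Fintype.card (τ × S), ?_⟩
  rintro K _ _ g B hB hg i ⟨e, -, c, hc, hsum⟩
  let R : Finset (Fin n →₀ ℕ) :=
    (Finset.univ.biUnion fun j : τ × S => (monomial j.2.1 1 * g j.1).support) ∪
      (X i ^ e : MvPolynomial (Fin n) ℤ).support
  let A : Matrix R (τ × S) ℤ := fun m j => coeff m.1 (monomial j.2.1 1 * g j.1)
  have hcS : ∀ t, c t = ∑ m : S, monomial m.1 (coeff m.1 (c t)) := by
    intro t
    rw [Finset.sum_coe_sort S fun m => monomial m (coeff m (c t))]
    conv_lhs => rw [← (c t).support_sum_monomial_coeff]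
    refine Finset.sum_subset (fun m hm => ?_) fun m _ hm => ?_
    · exact (Finsupp.finite_of_degree_le N).mem_toFinset.2 ((le_totalDegree hm).trans (hc t))
    · rw [notMem_support_iff.1 hm, map_zero]
  obtain ⟨D, hD, hDB, c', hc'⟩ := exists_int_solution A (fun m => coeff m.1 (X i ^ e))
    (fun j => coeff j.2.1 (c j.1)) (fun m => by
      have h1 : ((coeff m.1 (X i ^ e : MvPolynomial (Fin n) ℤ) : ℤ) : K) =
          coeff m.1 (X i ^ e : MvPolynomial (Fin n) K) := by
        rw [← map_X (Int.castRingHom K), ← map_pow, coeff_map]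
        rfl
      rw [h1, ← hsum, coeff_sum, Fintype.sum_prod_type]
      refine Finset.sum_congr rfl fun t _ => ?_
      conv_rhs => rw [hcS t]
      rw [Finset.sum_mul, coeff_sum]
      refine Finset.sum_congr rfl fun j _ => ?_
      simp only [A, coeff_monomial_mul', coeff_map]
      split_ifs <;> simp [mul_comm]) B hB
    (fun m j => by
      simp only [A, coeff_monomial_mul', one_mul]
      split_ifs
      · exact hg _ _
      · simp)
  refine ⟨D, hD, hDB, e, ?_⟩
  have hfin : ∑ j : τ × S, monomial j.2.1 (c' j) * g j.1 = C D * X i ^ e := by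
    ext m
    rw [coeff_sum, coeff_C_mul]
    have hmon : ∀ j : τ × S, coeff m (monomial j.2.1 (c' j) * g j.1) =
        coeff m (monomial j.2.1 1 * g j.1) * c' j := by
      intro j
      rw [coeff_monomial_mul', coeff_monomial_mul']
      split_ifs <;> simp [mul_comm]
    rw [Finset.sum_congr rfl fun j _ => hmon j]
    by_cases hm : m ∈ R
    · exact hc' ⟨m, hm⟩
    · simp only [R, Finset.mem_union, Finset.mem_biUnion, Finset.mem_univ, true_and,
        not_or, not_exists, notMem_support_iff] at hm
      simp [hm.1, hm.2]
  rw [← hfin]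
  exact Ideal.sum_mem _ fun j _ => Ideal.mul_mem_left _ _ (Ideal.subset_span ⟨j.1, rfl⟩)

end Effective

section Final

/-- A form together with its partial derivatives. -/
noncomputable def jacobianSystem {R : Type} [CommRing R] {n : ℕ} (F : MvPolynomial (Fin n) R) :
    Option (Fin n) → MvPolynomial (Fin n) R
  | none => F
  | some j => pderiv j F

lemma map_jacobianSystem {R S : Type} [CommRing R] [CommRing S] (f : R →+* S) {n : ℕ}
    (F : MvPolynomial (Fin n) R) (t : Option (Fin n)) :
    map f (jacobianSystem F t) = jacobianSystem (map f F) t := by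
  cases t with
  | none => rfl
  | some j => exact pderiv_map.symm

lemma natAbs_coeff_le_polyHeight {n : ℕ} (F : MvPolynomial (Fin n) ℤ) (m : Fin n →₀ ℕ) :
    (coeff m F).natAbs ≤ polyHeight F := by
  by_cases hm : m ∈ F.support
  · exact Finset.le_sup (f := fun m => (F.coeff m).natAbs) hm
  · simp [notMem_support_iff.1 hm]

lemma polyHeight_pos {n : ℕ} {F : MvPolynomial (Fin n) ℤ} (hF : F ≠ 0) : 0 < polyHeight F := by
  obtain ⟨m, hm⟩ := ne_zero_iff.1 hF
  exact (Int.natAbs_pos.2 hm).trans_le (natAbs_coeff_le_polyHeight F m)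

lemma abs_coeff_jacobianSystem_le {n d : ℕ} (hd : 0 < d) {F : MvPolynomial (Fin n) ℤ}
    (hF : F.IsHomogeneous d) (t : Option (Fin n)) (m : Fin n →₀ ℕ) :
    |coeff m (jacobianSystem F t)| ≤ ((d * polyHeight F : ℕ) : ℤ) := by
  rw [Int.abs_eq_natAbs, Nat.cast_le]
  cases t with
  | none =>
    exact (natAbs_coeff_le_polyHeight F m).trans (Nat.le_mul_of_pos_left _ hd)
  | some j =>
    change (coeff m (pderiv j F)).natAbs ≤ _
    rw [coeff_pderiv]
    by_cases h0 : coeff (m + Finsupp.single j 1) F = 0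
    · simp [h0]
    have hdeg : (m + Finsupp.single j 1).degree = d := by
      rw [Finsupp.degree_eq_weight_one]
      exact hF h0
    have hj : m j + 1 ≤ d := by
      have := Finsupp.le_degree j (m + Finsupp.single j 1)
      simpa [hdeg] using this
    have hcast : ((m j : ℤ) + 1).natAbs = m j + 1 := by omega
    rw [Int.natAbs_mul, hcast, mul_comm]
    exact Nat.mul_le_mul hj (natAbs_coeff_le_polyHeight F _)

lemma totalDegree_jacobianSystem_le {R : Type} [CommRing R] {n d : ℕ}
    {F : MvPolynomial (Fin n) R} (hF : F.IsHomogeneous d) (t : Option (Fin n)) :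
    (jacobianSystem F t).totalDegree ≤ d := by
  cases t with
  | none => exact hF.totalDegree_le
  | some j => exact (hF.pderiv (i := j)).totalDegree_le.trans (Nat.sub_le _ _)

/-- Effective elimination for the Jacobian system of a form that is smooth over `ℚ`. -/
lemma exists_discriminant_bound (n d : ℕ) (hd : 0 < d) :
    ∃ κ : ℕ, ∀ F : MvPolynomial (Fin n) ℤ, F ≠ 0 → F.IsHomogeneous d →
      R0prop (F.map (Int.castRingHom ℚ)) → ∀ i, ∃ D : ℤ, D ≠ 0 ∧
        |D| ≤ κ.factorial * ((d * polyHeight F : ℕ) : ℤ) ^ κ ∧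
        ∃ e, C D * X i ^ e ∈ Ideal.span (Set.range (jacobianSystem F)) := by
  obtain ⟨N, hN⟩ := exists_uniform_certificate (AlgebraicClosure ℚ) (Option (Fin n)) n d
  obtain ⟨κ, hκ⟩ := exists_int_certificate (Option (Fin n)) n N
  refine ⟨κ, fun F hF0 hF hsm i => ?_⟩
  refine hκ (AlgebraicClosure ℚ) (jacobianSystem F) (d * polyHeight F)
    (Nat.mul_pos hd (polyHeight_pos hF0)) (abs_coeff_jacobianSystem_le hd hF) i
    (hN _ (fun t => ?_) (fun a ha => ?_) i)
  · rw [map_jacobianSystem]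
    exact totalDegree_jacobianSystem_le (hF.map _) t
  · have hmap : ∀ P : MvPolynomial (Fin n) ℤ,
        aeval a (map (Int.castRingHom ℚ) P) =
          eval a (map (Int.castRingHom (AlgebraicClosure ℚ)) P) := fun P => by
      rw [aeval_def, eval₂_map, eval_map]
      exact congrArg (fun f => eval₂ f a P) (RingHom.ext_int _ _)
    refine hsm.eq_zero (L := AlgebraicClosure ℚ) ?_ fun l => ?_
    · rw [hmap]; exact ha none
    · rw [pderiv_map, hmap]; exact ha (some l)

lemma R0prop_of_mem_span {n : ℕ} {F : MvPolynomial (Fin n) ℤ} {k : Type} [Field k]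
    (h : ∀ i, ∃ D : ℤ, (D : k) ≠ 0 ∧
      ∃ e, C D * X i ^ e ∈ Ideal.span (Set.range (jacobianSystem F))) :
    R0prop (F.map (Int.castRingHom k)) := by
  intro P hP hle i
  obtain ⟨hFP, hdP⟩ := singIdeal_one_le_iff.1 hle
  obtain ⟨D, hD, e, hmem⟩ := h i
  have hspan : Ideal.span (Set.range (jacobianSystem F)) ≤
      P.comap (map (Int.castRingHom k)) := by
    rw [Ideal.span_le]
    rintro _ ⟨t, rfl⟩
    change map _ (jacobianSystem F t) ∈ P
    rw [map_jacobianSystem]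
    cases t with
    | none => exact hFP
    | some j => exact hdP j
  have hX : map (Int.castRingHom k) (C D * X i ^ e) ∈ P := hspan hmem
  rw [map_mul, map_pow, map_C, map_X] at hX
  refine hP.mem_of_pow_mem e ((hP.mem_or_mem hX).resolve_left fun hC => hP.ne_top ?_)
  exact Ideal.eq_top_of_isUnit_mem _ hC ((isUnit_iff_ne_zero.2 hD).map C)

lemma ne_zero_of_R0prop_map {n : ℕ} (hn : 0 < n) {F : MvPolynomial (Fin n) ℤ}
    (h : R0prop (F.map (Int.castRingHom ℚ))) : F ≠ 0 := by
  rintro rfl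
  refine X_ne_zero (R := ℚ) (⟨0, hn⟩ : Fin n) ?_
  exact Ideal.mem_bot.1 (h ⊥ Ideal.isPrime_bot (singIdeal_one_le_iff.2 (by simp)) ⟨0, hn⟩)

lemma exists_bound_R1prop_R2prop (n d : ℕ) (hd : 3 ≤ d) :
    ∃ M : ℕ, ∀ p, p.Prime → M < p → ∀ (k : Type) (_ : Field k) (_ : IsAlgClosed k),
      ringChar k = p → ∀ G : MvPolynomial (Fin n) k, G.IsHomogeneous d → R0prop G →
        R1prop G ∧ R2prop G := by
  obtain ⟨e, rfl⟩ : ∃ e, d = e + 2 := ⟨d - 2, by omega⟩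
  have h1 := Filter.eventually_all.2 fun s =>
    eventually_not_hasExcessPolar (n := n) (d := e + 2) (u := 0) (Nat.succ_pos e) s
  have h2 := Filter.eventually_all.2 fun u : Fin (n + 1) => Filter.eventually_all.2 fun s =>
    eventually_not_hasExcessPolar (n := n) (d := e + 2) (u := u) (show 0 < e by omega) s
  obtain ⟨M, hM⟩ := Filter.eventually_atTop.1 (h1.and h2)
  refine ⟨max M (e + 2), fun p hp hMp k _ _ hk G hG h0 => ?_⟩
  obtain ⟨hM1, hM2⟩ := hM p ((le_max_left _ _).trans hMp.le)
  have hep : e + 2 < p := (le_max_right _ _).trans_lt hMp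
  have hcast : ∀ a : ℕ, 0 < a → a < p → (a : k) ≠ 0 := fun a ha hap h => by
    rw [ringChar.spec, hk] at h
    exact absurd (Nat.le_of_dvd ha h) (by omega)
  exact ⟨R1prop_of_not_hasExcessPolar (e := e + 1) hG (hcast _ (by omega) (by omega)) h0
      fun s => hM1 s k _ ‹_› hk,
    R2prop_of_not_hasExcessPolar hG (hcast _ (by omega) (by omega))
      fun u hu s => hM2 ⟨u, by omega⟩ s k _ ‹_› hk⟩

end Final

/-- Let `F ∈ ℤ[x_1,…,x_n]` be homogeneous of degree `d ≥ 3`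
(`n ≥ 3`) defining a non-singular hypersurface in `P^{n-1}_ℚ`. Then the set `P(F)` of
primes `p` for which `F` fails at least one of (R₀(p)), (R₁(p)), (R₂(p)) is finite, and
there are constants `C, κ` depending only on `n, d` such that
`∏_{p ∈ P(F)} p ≤ C ‖F‖^κ`. -/
theorem statement12 (n d : ℕ) (hn : 3 ≤ n) (hd : 3 ≤ d) :
    ∃ C κ : ℕ, 0 < C ∧
      ∀ F : MvPolynomial (Fin n) ℤ, F.IsHomogeneous d →
      ProjNonsingular ![F.map (Int.castRingHom ℚ)] →
      ∃ hfin : {p : ℕ | p.Prime ∧ ¬ GoodPrime F p}.Finite,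
        (∏ p ∈ hfin.toFinset, p) ≤ C * polyHeight F ^ κ := by
  obtain ⟨M, hM⟩ := exists_bound_R1prop_R2prop n d hd
  obtain ⟨κ, hκ⟩ := exists_discriminant_bound n d (by omega)
  refine ⟨M.factorial * (κ.factorial * d ^ κ) ^ n, κ * n, by positivity, fun F hF hsm => ?_⟩
  choose D hD0 hDle hDmem using hκ F (ne_zero_of_R0prop_map (by omega) hsm) hF hsm
  set W : ℕ := M.factorial * ∏ i, (D i).natAbs with hW
  have hW0 : W ≠ 0 := mul_ne_zero M.factorial_ne_zero
    (Finset.prod_ne_zero_iff.2 fun i _ => Int.natAbs_ne_zero.2 (hD0 i))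
  have hdvd : ∀ p : ℕ, p.Prime ∧ ¬ GoodPrime F p → p ∣ W := by
    rintro p ⟨hp, hbad⟩
    by_contra hpW
    refine hbad fun k _ _ hk => ?_
    have h0 : R0prop (F.map (Int.castRingHom k)) := R0prop_of_mem_span fun i =>
      ⟨D i, fun h => hpW ?_, hDmem i⟩
    · have hMp : M < p := by
        by_contra hle
        exact hpW (Dvd.dvd.mul_right (hp.dvd_factorial.2 (not_lt.1 hle)) _)
      exact ⟨h0, hM p hp hMp k _ ‹_› hk _ (hF.map _) h0⟩
    · have : CharP k p := hk ▸ ringChar.charP k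
      have hpD : p ∣ (D i).natAbs :=
        Int.natCast_dvd.1 ((CharP.intCast_eq_zero_iff k p (D i)).1 h)
      exact (hpD.trans (Finset.dvd_prod_of_mem (fun i => (D i).natAbs) (Finset.mem_univ i))).mul_left _
  have hfin : {p : ℕ | p.Prime ∧ ¬ GoodPrime F p}.Finite :=
    (Finset.finite_toSet W.divisors).subset fun p hp =>
      Finset.mem_coe.2 (Nat.mem_divisors.2 ⟨hdvd p hp, hW0⟩)
  refine ⟨hfin, ?_⟩
  have hprod : ∏ p ∈ hfin.toFinset, p ∣ W :=
    Finset.prod_primes_dvd W (fun p hp => (hfin.mem_toFinset.1 hp).1.prime)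
      fun p hp => hdvd p (hfin.mem_toFinset.1 hp)
  have hDnat : ∀ i, (D i).natAbs ≤ κ.factorial * (d * polyHeight F) ^ κ := fun i => by
    have := hDle i
    rw [Int.abs_eq_natAbs] at this
    exact_mod_cast this
  calc ∏ p ∈ hfin.toFinset, p ≤ W := Nat.le_of_dvd (Nat.pos_of_ne_zero hW0) hprod
    _ ≤ M.factorial * (κ.factorial * (d * polyHeight F) ^ κ) ^ n := by
      refine Nat.mul_le_mul_left _ ?_
      simpa using Finset.prod_le_pow_card Finset.univ (fun i => (D i).natAbs) _
        fun i _ => hDnat i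
    _ = M.factorial * (κ.factorial * d ^ κ) ^ n * polyHeight F ^ (κ * n) := by ring
end

section
/- Let X ⊂ P^n over an algebraically closed field of characteristic 0 be an integral closed subvariety of dimension m ≤ n−2 and degree d, and let Λ ∈ G(n−m−2, n) be a linear subspace with Λ ∩ X = ∅ such that the locus S_{Λ,X} of (n−m−1)-planes M ⊇ Λ meeting X in at least 2 points has dimension < m. Then the linear projection π_Λ: X → P^{m+1} from Λ is birational onto its image; in particular π_Λ(X) is integral of degree d and every fibre of π_Λ on X consists of at most d points. -/
open MvPolynomial

noncomputable section

/-- A set is an (affine) subvariety if it is the zero locus of its vanishing ideal. -/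
def IsSubvariety {K : Type*} [Field K] {n : ℕ} (S : Set (Fin n → K)) : Prop :=
  S = zeroLocusSet (↑(vIdeal S) : Set (MvPolynomial (Fin n) K))

/-- `Z` is an irreducible component of `X`. -/
def IrredComp {K : Type*} [Field K] {n : ℕ} (X Z : Set (Fin n → K)) : Prop :=
  Z ⊆ X ∧ IsSubvariety Z ∧ Z.Nonempty ∧ (vIdeal Z).IsPrime ∧
    ∀ Z' : Set (Fin n → K), Z' ⊆ X → IsSubvariety Z' → (vIdeal Z').IsPrime →
      Z ⊆ Z' → Z = Z'

/-- `X` is equidimensional of dimension `m`. -/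
def Equidim {K : Type*} [Field K] {n : ℕ} (X : Set (Fin n → K)) (m : ℕ) : Prop :=
  ∀ Z : Set (Fin n → K), IrredComp X Z → coneDim Z = (m : WithBot ℕ∞)

/-- The set of lines (1-dimensional subspaces) contained in `S ∪ {0}`; these are the
projective points of the cone `S`. -/
def linesIn {K : Type*} [Field K] {N : ℕ} (S : Set (Fin N → K)) :
    Set (Submodule K (Fin N → K)) :=
  {L | Module.finrank K L = 1 ∧ (L : Set (Fin N → K)) ⊆ S ∪ {0}}

/-- The cone `S` (representing a projective variety) has degree `d`: every linear
section of it which is finite (projectively) has at most `d` points, and some finite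
linear section has exactly `d` points. -/
def HasDeg {K : Type*} [Field K] {N : ℕ} (S : Set (Fin N → K)) (d : ℕ) : Prop :=
  (∀ U : Submodule K (Fin N → K),
      (linesIn (S ∩ ↑U)).Finite → (linesIn (S ∩ ↑U)).ncard ≤ d) ∧
  (∃ U : Submodule K (Fin N → K),
      (linesIn (S ∩ ↑U)).Finite ∧ (linesIn (S ∩ ↑U)).ncard = d)

/-- The union of all the linear spaces `M ⊇ W` with `dim M = dim W + 1` which meet the
cone `Z` in at least two distinct projective points.  If `S_{Λ,Z}` (for `Λ = P(W)`)
has projective dimension `s`, this cone has dimension `s + 1 + finrank W`. -/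
def SCset {K : Type*} [Field K] {N : ℕ} (Z : Set (Fin N → K))
    (W : Submodule K (Fin N → K)) : Set (Fin N → K) :=
  ↑W ∪ {v | ∃ x y : Fin N → K, x ∈ Z ∧ y ∈ Z ∧
    x ∈ W ⊔ Submodule.span K {v} ∧ y ∈ W ⊔ Submodule.span K {v} ∧
    LinearIndependent K ![x, y]}

end

theorem ringKrullDim_le_of_isIntegral {A B : Type*} [CommRing A] [CommRing B] [Algebra A B]
    [Algebra.IsIntegral A B] : ringKrullDim B ≤ ringKrullDim A := by
  refine Order.krullDim_le_of_strictMono (PrimeSpectrum.comap (algebraMap A B)) ?_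
  intro P Q h
  exact Ideal.IsIntegral.comap_lt_comap (R := A) (A := B) h

theorem exists_ltSeries_of_isIntegral {A B : Type*} [CommRing A] [CommRing B] [Algebra A B]
    [Algebra.IsIntegral A B] (hinj : Function.Injective (algebraMap A B))
    (l : LTSeries (PrimeSpectrum A)) :
    ∃ l' : LTSeries (PrimeSpectrum B), l'.length = l.length ∧
      PrimeSpectrum.comap (algebraMap A B) l'.last = l.last := by
  induction l using RelSeries.inductionOn' with
  | singleton x =>
    obtain ⟨Q, -, hQ, hQ'⟩ := Ideal.exists_ideal_over_prime_of_isIntegral x.asIdeal (⊥ : Ideal B)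
      (by rw [← RingHom.ker_eq_comap_bot, (RingHom.injective_iff_ker_eq_bot _).mp hinj]
          exact bot_le)
    exact ⟨RelSeries.singleton _ ⟨Q, hQ⟩, rfl, PrimeSpectrum.ext hQ'⟩
  | snoc p x hx ih =>
    obtain ⟨l', h1, h2⟩ := ih
    have hlt : p.last < x := hx
    obtain ⟨Q, hge, hQ, hQ'⟩ := Ideal.exists_ideal_over_prime_of_isIntegral x.asIdeal
      l'.last.asIdeal (by
        have := congrArg PrimeSpectrum.asIdeal h2
        rw [PrimeSpectrum.comap_asIdeal] at this
        rw [this]; exact hlt.le)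
    have hl : l'.last < ⟨Q, hQ⟩ := by
      refine lt_of_le_of_ne hge ?_
      intro h
      rw [h] at h2
      have : x = p.last := by rw [← h2]; exact PrimeSpectrum.ext hQ'.symm
      exact hlt.ne' this
    refine ⟨l'.snoc ⟨Q, hQ⟩ hl, by simp [h1], ?_⟩
    simp only [RelSeries.last_snoc]
    exact PrimeSpectrum.ext hQ'

theorem ringKrullDim_eq_of_isIntegral {A B : Type*} [CommRing A] [CommRing B] [Algebra A B]
    [Algebra.IsIntegral A B] (hinj : Function.Injective (algebraMap A B)) :
    ringKrullDim B = ringKrullDim A := by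
  refine le_antisymm ringKrullDim_le_of_isIntegral (iSup_le fun l => ?_)
  obtain ⟨l', h, -⟩ := exists_ltSeries_of_isIntegral hinj l
  rw [← h]
  exact le_iSup (fun l : LTSeries (PrimeSpectrum B) => (l.length : WithBot ℕ∞)) l'

theorem homogeneousComponent_succ_mul {k : Type*} [Field k] {N : ℕ}
    {l : MvPolynomial (Fin N) k} (hl : l.IsHomogeneous 1) (h : MvPolynomial (Fin N) k) (t : ℕ) :
    homogeneousComponent (t + 1) (l * h) = l * homogeneousComponent t h := by
  conv_lhs => rw [← sum_homogeneousComponent h, Finset.mul_sum, map_sum]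
  have key : ∀ i, homogeneousComponent (t + 1) (l * homogeneousComponent i h) =
      if i = t then l * homogeneousComponent t h else 0 := by
    intro i
    have hi : l * homogeneousComponent i h ∈ homogeneousSubmodule (Fin N) k (1 + i) :=
      hl.mul (homogeneousComponent_isHomogeneous i h)
    rw [homogeneousComponent_of_mem hi]
    by_cases e : i = t
    · subst e; simp [add_comm]
    · rw [if_neg e, if_neg (by omega)]
  simp only [key, Finset.sum_ite_eq', Finset.mem_range]
  split_ifs with ht
  · rfl
  · rw [homogeneousComponent_eq_zero t h (by omega), mul_zero]

theorem eval_smul_of_isHomogeneous_s14 {k : Type*} [Field k] {N t : ℕ}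
    {f : MvPolynomial (Fin N) k} (hf : f.IsHomogeneous t) (c : k) (x : Fin N → k) :
    eval (c • x) f = c ^ t * eval x f := by
  rw [eval_eq', eval_eq', Finset.mul_sum]
  refine Finset.sum_congr rfl fun a ha => ?_
  have h := hf (mem_support_iff.mp ha)
  rw [Finsupp.weight_apply, Finsupp.sum_fintype _ _ (by simp)] at h
  simp only [Pi.one_apply, smul_eq_mul, mul_one] at h
  simp only [Pi.smul_apply, smul_eq_mul, mul_pow, Finset.prod_mul_distrib,
    Finset.prod_pow_eq_pow_sum, h]
  ring

theorem homogeneousComponent_mem_vIdeal {k : Type*} [Field k] [Infinite k] {N : ℕ}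
    {Z : Set (Fin N → k)} (hcone : ∀ (c : k) (x : Fin N → k), x ∈ Z → c • x ∈ Z)
    {f : MvPolynomial (Fin N) k} (hf : f ∈ vIdeal Z) (t : ℕ) :
    homogeneousComponent t f ∈ vIdeal Z := by
  intro x hx
  let q : Polynomial k := ∑ i ∈ Finset.range (f.totalDegree + 1),
    Polynomial.C (eval x (homogeneousComponent i f)) * Polynomial.X ^ i
  have hq : q = 0 := by
    refine Polynomial.funext fun c => ?_
    have h1 : eval (c • x) f = 0 := hf _ (hcone c x hx)
    rw [← sum_homogeneousComponent f, map_sum] at h1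
    simp only [q, Polynomial.eval_finsetSum, Polynomial.eval_mul, Polynomial.eval_C,
      Polynomial.eval_pow, Polynomial.eval_X, Polynomial.eval_zero]
    rw [← h1]
    refine Finset.sum_congr rfl fun i _ => ?_
    rw [eval_smul_of_isHomogeneous_s14 (homogeneousComponent_isHomogeneous i f), mul_comm]
  by_cases ht : t < f.totalDegree + 1
  · have := congrArg (fun p => Polynomial.coeff p t) hq
    simpa [q, Polynomial.finsetSum_coeff, Polynomial.coeff_C_mul, Polynomial.coeff_X_pow, ht,
      Finset.sum_ite_eq] using this
  · rw [homogeneousComponent_eq_zero t f (by omega), map_zero]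

/-- The `i`-th coordinate of a linear map `K^N → K^r`, as a linear form. -/
noncomputable def coordForm {k : Type*} [Field k] {N r : ℕ} (z : (Fin N → k) →ₗ[k] (Fin r → k))
    (i : Fin r) : MvPolynomial (Fin N) k :=
  ∑ j, C (z (Pi.single j 1) i) * X j

/-- Pullback of polynomials along a linear map. -/
noncomputable def pullback {k : Type*} [Field k] {N r : ℕ} (z : (Fin N → k) →ₗ[k] (Fin r → k)) :
    MvPolynomial (Fin r) k →ₐ[k] MvPolynomial (Fin N) k :=
  aeval (coordForm z)

section Pullback

variable {k : Type*} [Field k] {N r : ℕ} (z : (Fin N → k) →ₗ[k] (Fin r → k))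

theorem eval_coordForm (i : Fin r) (x : Fin N → k) : eval x (coordForm z i) = z x i := by
  conv_rhs => rw [← Finset.univ_sum_single x, map_sum, Finset.sum_apply]
  simp only [coordForm, map_sum, map_mul, eval_C, eval_X]
  refine Finset.sum_congr rfl fun j _ => ?_
  have : (Pi.single j (x j) : Fin N → k) = x j • Pi.single j 1 := by
    rw [← Pi.single_smul]; simp
  rw [this, map_smul, Pi.smul_apply, smul_eq_mul, mul_comm]

theorem coordForm_isHomogeneous (i : Fin r) : (coordForm z i).IsHomogeneous 1 :=
  IsHomogeneous.sum _ _ _ fun j _ => (isHomogeneous_X k j).C_mul _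

theorem eval_pullback (f : MvPolynomial (Fin r) k) (x : Fin N → k) :
    eval x (pullback z f) = eval (z x) f := by
  have : ((eval x).comp (pullback z : _ →+* MvPolynomial (Fin N) k)) = eval (z x) := by
    refine MvPolynomial.ringHom_ext (fun c => ?_) (fun i => ?_)
    · simp [pullback]
    · simp [pullback, eval_coordForm]
  exact congrArg (fun φ => φ f) this

theorem totalDegree_pullback_le (f : MvPolynomial (Fin r) k) :
    (pullback z f).totalDegree ≤ f.totalDegree := by
  rw [← sum_homogeneousComponent f, map_sum, sum_homogeneousComponent f]
  refine totalDegree_finsetSum_le fun i hi => ?_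
  have := ((homogeneousComponent_isHomogeneous i f).aeval _ (coordForm_isHomogeneous z)).totalDegree_le
  rw [one_mul] at this
  exact this.trans (by simpa [Nat.lt_succ_iff] using hi)

theorem pullback_mem_vIdeal_iff {Z : Set (Fin N → k)} {f : MvPolynomial (Fin r) k} :
    pullback z f ∈ vIdeal Z ↔ f ∈ vIdeal (z '' Z) := by
  constructor
  · rintro h _ ⟨x, hx, rfl⟩
    rw [← eval_pullback]; exact h x hx
  · intro h x hx
    rw [eval_pullback]; exact h _ ⟨x, hx, rfl⟩

end Pullback

/-- Restriction of polynomials on the target of a linear map to functions on `Z`. -/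
noncomputable def pullbackQuot {k : Type*} [Field k] {N r : ℕ} (Z : Set (Fin N → k))
    (z : (Fin N → k) →ₗ[k] (Fin r → k)) :
    MvPolynomial (Fin r) k →ₐ[k] MvPolynomial (Fin N) k ⧸ vIdeal Z :=
  (Ideal.Quotient.mkₐ k (vIdeal Z)).comp (pullback z)

/-- The functions on `Z` spanned by the products of a pulled back polynomial of degree at most `t`
with a monomial of degree less than `B`. -/
noncomputable def boundedSpan {k : Type*} [Field k] {N r : ℕ} (Z : Set (Fin N → k))
    (z : (Fin N → k) →ₗ[k] (Fin r → k)) (B t : ℕ) :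
    Submodule k (MvPolynomial (Fin N) k ⧸ vIdeal Z) :=
  Submodule.span k {g | ∃ a : MvPolynomial (Fin r) k, a.totalDegree ≤ t ∧
    ∃ β : Fin N →₀ ℕ, β.degree < B ∧
      g = pullbackQuot Z z a * Ideal.Quotient.mk (vIdeal Z) (monomial β 1)}

section Cone

variable {k : Type*} [Field k] {N r : ℕ} {Z : Set (Fin N → k)}
  {z : (Fin N → k) →ₗ[k] (Fin r → k)}

theorem coordForm_mul_mem_boundedSpan {B t : ℕ} (i : Fin r)
    {g : MvPolynomial (Fin N) k ⧸ vIdeal Z} (hg : g ∈ boundedSpan Z z B t) :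
    Ideal.Quotient.mk (vIdeal Z) (coordForm z i) * g ∈ boundedSpan Z z B (t + 1) := by
  induction hg using Submodule.span_induction with
  | mem g hg =>
    obtain ⟨a, ha, β, hβ, rfl⟩ := hg
    refine Submodule.subset_span ⟨X i * a, ?_, β, hβ, ?_⟩
    · refine (totalDegree_mul _ _).trans ?_
      rw [totalDegree_X]; omega
    · rw [map_mul, ← mul_assoc]
      congr 2
      simp [pullbackQuot, pullback]
  | zero => simp
  | add x y _ _ hx hy => rw [mul_add]; exact add_mem hx hy
  | smul c x _ hx => rw [mul_smul_comm]; exact Submodule.smul_mem _ _ hx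

variable [IsAlgClosed k]

theorem exists_monomial_mem (hcl : IsSubvariety Z) (hz : ∀ x ∈ Z, z x = 0 → x = 0) :
    ∃ B : ℕ, ∀ β : Fin N →₀ ℕ, β.degree = B →
      monomial β (1 : k) ∈ vIdeal Z ⊔ Ideal.span (Set.range (coordForm z)) := by
  set J := vIdeal Z ⊔ Ideal.span (Set.range (coordForm z))
  have hrad : Ideal.span (Set.range (X : Fin N → MvPolynomial (Fin N) k)) ≤ J.radical := by
    rw [Ideal.span_le, ← vanishingIdeal_zeroLocus_eq_radical (K := k)]
    rintro _ ⟨j, rfl⟩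
    intro x hx
    have h1 : x ∈ Z := by
      rw [hcl]
      intro f hf
      simpa using hx f (Ideal.mem_sup_left hf)
    have h2 : x = 0 := by
      refine hz x h1 (funext fun i => ?_)
      rw [← eval_coordForm]
      simpa using hx (coordForm z i) (Ideal.mem_sup_right (Ideal.subset_span ⟨i, rfl⟩))
    simp [h2]
  obtain ⟨B, hB⟩ := Ideal.exists_pow_le_of_le_radical_of_fg hrad
    (IsNoetherian.noetherian _)
  refine ⟨B, fun β hβ => hB ?_⟩
  rw [monomial_eq, C_1, one_mul, Finsupp.prod_fintype _ _ (by simp), ← hβ,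
    Finsupp.degree_eq_sum, ← Finset.prod_pow_eq_pow_sum]
  exact Ideal.prod_mem_prod fun i _ =>
    Ideal.pow_mem_pow (Ideal.subset_span (Set.mem_range_self i)) _

theorem exists_sub_mem_vIdeal
    (hcone : ∀ (c : k) (x : Fin N → k), x ∈ Z → c • x ∈ Z) (hcl : IsSubvariety Z)
    (hz : ∀ x ∈ Z, z x = 0 → x = 0) :
    ∃ B : ℕ, ∀ β : Fin N →₀ ℕ, β.degree = B + 1 →
      ∃ h : Fin r → MvPolynomial (Fin N) k, (∀ i, (h i).totalDegree ≤ B) ∧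
        monomial β (1 : k) - ∑ i, coordForm z i * h i ∈ vIdeal Z := by
  obtain ⟨B, hB⟩ := exists_monomial_mem hcl hz
  refine ⟨B, fun β hβ => ?_⟩
  have hmem : monomial β (1 : k) ∈ vIdeal Z ⊔ Ideal.span (Set.range (coordForm z)) := by
    have hne : β ≠ 0 := by rintro rfl; simp at hβ
    obtain ⟨j, hj⟩ := Finsupp.ne_iff.mp hne
    have hle : Finsupp.single j 1 ≤ β := by
      rw [Finsupp.single_le_iff]; simp only [Finsupp.coe_zero, Pi.zero_apply] at hj; omega
    obtain ⟨γ, rfl⟩ := exists_add_of_le hle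
    have : monomial (Finsupp.single j 1 + γ) (1 : k) = X j * monomial γ 1 := by
      rw [X, monomial_mul, one_mul]
    rw [this]
    refine Ideal.mul_mem_left _ _ (hB γ ?_)
    rw [map_add, Finsupp.degree_single] at hβ
    omega
  obtain ⟨g, hg, s, hs, hgs⟩ := Submodule.mem_sup.mp hmem
  obtain ⟨h, hh⟩ := (Ideal.mem_span_range_iff_exists_fun).mp hs
  refine ⟨fun i => homogeneousComponent B (h i),
    fun i => (homogeneousComponent_isHomogeneous _ _).totalDegree_le, ?_⟩
  have hβ' : (monomial β (1 : k)) ∈ homogeneousSubmodule (Fin N) k (B + 1) :=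
    isHomogeneous_monomial _ hβ
  have key : monomial β (1 : k) = homogeneousComponent (B + 1) g +
      ∑ i, coordForm z i * homogeneousComponent B (h i) := by
    conv_lhs => rw [← homogeneousComponent_eq_self hβ', ← hgs, ← hh, map_add, map_sum]
    congr 1
    refine Finset.sum_congr rfl fun i _ => ?_
    rw [mul_comm, homogeneousComponent_succ_mul (coordForm_isHomogeneous z i)]
  rw [key, add_sub_cancel_right]
  exact homogeneousComponent_mem_vIdeal hcone hg _

/-- Graded finiteness of a linear projection with centre disjoint from a projective variety. -/
theorem exists_forall_mem_boundedSpan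
    (hcone : ∀ (c : k) (x : Fin N → k), x ∈ Z → c • x ∈ Z) (hcl : IsSubvariety Z)
    (hz : ∀ x ∈ Z, z x = 0 → x = 0) :
    ∃ B : ℕ, ∀ (t : ℕ) (f : MvPolynomial (Fin N) k), f.totalDegree ≤ t →
      Ideal.Quotient.mk (vIdeal Z) f ∈ boundedSpan Z z B t := by
  obtain ⟨B, hB⟩ := exists_sub_mem_vIdeal hcone hcl hz
  refine ⟨B + 1, fun t => ?_⟩
  have reduce : ∀ t, (∀ β : Fin N →₀ ℕ, β.degree ≤ t →
      Ideal.Quotient.mk (vIdeal Z) (monomial β (1 : k)) ∈ boundedSpan Z z (B + 1) t) →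
      ∀ f : MvPolynomial (Fin N) k, f.totalDegree ≤ t →
        Ideal.Quotient.mk (vIdeal Z) f ∈ boundedSpan Z z (B + 1) t := by
    intro t ht f hf
    rw [f.as_sum, map_sum]
    refine Submodule.sum_mem _ fun β hβ => ?_
    have : Ideal.Quotient.mk (vIdeal Z) (monomial β (coeff β f)) =
        coeff β f • Ideal.Quotient.mk (vIdeal Z) (monomial β (1 : k)) := by
      rw [← Ideal.Quotient.mkₐ_eq_mk k, ← map_smul, smul_monomial, smul_eq_mul, mul_one]
    rw [this]
    exact Submodule.smul_mem _ _ (ht β ((le_totalDegree hβ).trans hf))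
  have small : ∀ t (β : Fin N →₀ ℕ), β.degree < B + 1 →
      Ideal.Quotient.mk (vIdeal Z) (monomial β (1 : k)) ∈ boundedSpan Z z (B + 1) t := by
    intro t β hβ
    exact Submodule.subset_span ⟨1, by simp, β, hβ, by simp⟩
  induction t with
  | zero => exact reduce 0 fun β hβ => small 0 β (by omega)
  | succ t ih =>
    refine reduce _ fun β hβ => ?_
    by_cases hlt : β.degree < B + 1
    · exact small _ β hlt
    obtain ⟨γ, hγβ, hγ⟩ := Finsupp.exists_le_degree_eq β (B + 1) (by omega)
    obtain ⟨δ, rfl⟩ := exists_add_of_le hγβ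
    obtain ⟨h, hdeg, hmem⟩ := hB γ hγ
    rw [map_add] at hβ
    have e : Ideal.Quotient.mk (vIdeal Z) (monomial (γ + δ) (1 : k)) =
        ∑ i, Ideal.Quotient.mk (vIdeal Z) (coordForm z i) *
          Ideal.Quotient.mk (vIdeal Z) (h i * monomial δ 1) := by
      rw [← one_mul (1 : k), ← monomial_mul, map_mul, (Ideal.Quotient.mk_eq_mk_iff_sub_mem _ _).mpr hmem,
        one_mul, map_sum, Finset.sum_mul]
      simp only [map_mul, mul_assoc]
    rw [e]
    refine Submodule.sum_mem _ fun i _ => coordForm_mul_mem_boundedSpan i (ih _ ?_)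
    refine (totalDegree_mul _ _).trans ?_
    have := hdeg i
    have h2 : (monomial δ (1 : k)).totalDegree = δ.degree := by
      rw [totalDegree_monomial _ one_ne_zero]; rfl
    omega

theorem pullbackQuot_finite
    (hcone : ∀ (c : k) (x : Fin N → k), x ∈ Z → c • x ∈ Z) (hcl : IsSubvariety Z)
    (hz : ∀ x ∈ Z, z x = 0 → x = 0) : (pullbackQuot Z z).toRingHom.Finite := by
  obtain ⟨B, hB⟩ := exists_forall_mem_boundedSpan hcone hcl hz
  let alg : Algebra (MvPolynomial (Fin r) k) (MvPolynomial (Fin N) k ⧸ vIdeal Z) :=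
    (pullbackQuot Z z).toRingHom.toAlgebra
  let mod : Module (MvPolynomial (Fin r) k) (MvPolynomial (Fin N) k ⧸ vIdeal Z) := alg.toModule
  have hfin : {β : Fin N →₀ ℕ | β.degree < B}.Finite := by
    refine (Finsupp.finite_of_degree_le B).subset fun β hβ => ?_
    exact Nat.le_of_lt hβ
  refine ⟨⟨(hfin.image fun β => Ideal.Quotient.mk (vIdeal Z) (monomial β (1 : k))).toFinset, ?_⟩⟩
  rw [eq_top_iff]
  rintro g -
  obtain ⟨f, rfl⟩ := Ideal.Quotient.mk_surjective g
  have hf := hB _ f le_rfl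
  generalize Ideal.Quotient.mk (vIdeal Z) f = g at hf
  induction hf using Submodule.span_induction with
  | mem g hg =>
    obtain ⟨a, -, β, hβ, rfl⟩ := hg
    refine Submodule.smul_mem _ a (Submodule.subset_span ?_)
    rw [Set.Finite.coe_toFinset]
    exact ⟨β, hβ, rfl⟩
  | zero => exact zero_mem _
  | add x y _ _ hx hy => exact add_mem hx hy
  | smul c x _ hx =>
    have : c • x = (C c : MvPolynomial (Fin r) k) • x := by
      refine (Algebra.smul_def c x).trans ?_
      rw [← (pullbackQuot Z z).commutes c]
      rfl
    rw [this]
    exact Submodule.smul_mem _ _ hx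

theorem pullbackQuot_isIntegral
    (hcone : ∀ (c : k) (x : Fin N → k), x ∈ Z → c • x ∈ Z) (hcl : IsSubvariety Z)
    (hz : ∀ x ∈ Z, z x = 0 → x = 0) : (pullbackQuot Z z).toRingHom.IsIntegral :=
  (pullbackQuot_finite hcone hcl hz).to_isIntegral

end Cone

section Projection

variable {k : Type*} [Field k] {N r : ℕ} {Z : Set (Fin N → k)}

theorem ringKrullDim_mvPolynomial_fin (k : Type*) [Field k] (r : ℕ) :
    ringKrullDim (MvPolynomial (Fin r) k) = (r : WithBot ℕ∞) := by
  rw [MvPolynomial.ringKrullDim_of_isNoetherianRing, ringKrullDim_eq_zero_of_field]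
  simp

theorem pullbackQuot_eq_zero_iff {z : (Fin N → k) →ₗ[k] (Fin r → k)}
    {f : MvPolynomial (Fin r) k} : pullbackQuot Z z f = 0 ↔ f ∈ vIdeal (z '' Z) := by
  rw [← pullback_mem_vIdeal_iff]
  exact Ideal.Quotient.eq_zero_iff_mem

theorem image_cone (z : (Fin N → k) →ₗ[k] (Fin r → k))
    (hcone : ∀ (c : k) (x : Fin N → k), x ∈ Z → c • x ∈ Z) :
    ∀ (c : k) (x : Fin r → k), x ∈ z '' Z → c • x ∈ z '' Z := by
  rintro c _ ⟨x, hx, rfl⟩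
  exact ⟨c • x, hcone c x hx, map_smul z c x⟩

theorem exists_linearMap_ker_eq (K : Submodule k (Fin N → k)) :
    ∃ z : (Fin N → k) →ₗ[k] (Fin (Module.finrank k ((Fin N → k) ⧸ K)) → k),
      LinearMap.ker z = K ∧ Function.Surjective z := by
  let e := (Module.finBasis k ((Fin N → k) ⧸ K)).equivFun
  refine ⟨e.toLinearMap ∘ₗ K.mkQ, ?_, ?_⟩
  · rw [LinearEquiv.ker_comp, Submodule.ker_mkQ]
  · exact e.surjective.comp K.mkQ_surjective

theorem isSubvariety_zeroLocusSet (S : Set (MvPolynomial (Fin N) k)) :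
    IsSubvariety (zeroLocusSet S) := by
  refine Set.Subset.antisymm (fun x hx f hf => hf x hx) (fun x hx f hf => hx f fun y hy => hy f hf)

theorem mem_linesIn_iff {S : Set (Fin N → k)} {L : Submodule k (Fin N → k)}
    (hcone : ∀ (c : k) (x : Fin N → k), x ∈ S → c • x ∈ S) :
    L ∈ linesIn S ↔ ∃ x ∈ S, x ≠ 0 ∧ L = Submodule.span k {x} := by
  constructor
  · rintro ⟨h1, h2⟩
    obtain ⟨x, hx0, hx⟩ := finrank_eq_one_iff'.mp h1
    have hx0' : (x : Fin N → k) ≠ 0 := by simpa using hx0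
    refine ⟨x, (h2 x.2).resolve_right hx0', hx0', le_antisymm ?_ ?_⟩
    · intro y hy
      obtain ⟨c, hc⟩ := hx ⟨y, hy⟩
      exact Submodule.mem_span_singleton.mpr ⟨c, congrArg Subtype.val hc⟩
    · rw [Submodule.span_singleton_le_iff_mem]; exact x.2
  · rintro ⟨x, hx, hx0, rfl⟩
    refine ⟨finrank_span_singleton hx0, fun y hy => Or.inl ?_⟩
    obtain ⟨c, rfl⟩ := Submodule.mem_span_singleton.mp hy
    exact hcone c x hx

theorem inter_submodule_cone (hcone : ∀ (c : k) (x : Fin N → k), x ∈ Z → c • x ∈ Z)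
    (Q : Submodule k (Fin N → k)) :
    ∀ (c : k) (x : Fin N → k), x ∈ Z ∩ Q → c • x ∈ Z ∩ Q :=
  fun c x hx => ⟨hcone c x hx.1, Q.smul_mem c hx.2⟩

variable [IsAlgClosed k]

theorem coneDim_le_of_linear {z : (Fin N → k) →ₗ[k] (Fin r → k)}
    (hcone : ∀ (c : k) (x : Fin N → k), x ∈ Z → c • x ∈ Z) (hcl : IsSubvariety Z)
    (hz : ∀ x ∈ Z, z x = 0 → x = 0) : coneDim Z ≤ (r : WithBot ℕ∞) := by
  let alg : Algebra (MvPolynomial (Fin r) k) (MvPolynomial (Fin N) k ⧸ vIdeal Z) :=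
    (pullbackQuot Z z).toRingHom.toAlgebra
  have : Algebra.IsIntegral (MvPolynomial (Fin r) k) (MvPolynomial (Fin N) k ⧸ vIdeal Z) :=
    ⟨pullbackQuot_isIntegral hcone hcl hz⟩
  rw [← ringKrullDim_mvPolynomial_fin k r]
  exact ringKrullDim_le_of_isIntegral

theorem coneDim_eq_of_linear {z : (Fin N → k) →ₗ[k] (Fin r → k)}
    (hcone : ∀ (c : k) (x : Fin N → k), x ∈ Z → c • x ∈ Z) (hcl : IsSubvariety Z)
    (hz : ∀ x ∈ Z, z x = 0 → x = 0) (hinj : Function.Injective (pullbackQuot Z z)) :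
    coneDim Z = (r : WithBot ℕ∞) := by
  let alg : Algebra (MvPolynomial (Fin r) k) (MvPolynomial (Fin N) k ⧸ vIdeal Z) :=
    (pullbackQuot Z z).toRingHom.toAlgebra
  have : Algebra.IsIntegral (MvPolynomial (Fin r) k) (MvPolynomial (Fin N) k ⧸ vIdeal Z) :=
    ⟨pullbackQuot_isIntegral hcone hcl hz⟩
  rw [← ringKrullDim_mvPolynomial_fin k r]
  exact ringKrullDim_eq_of_isIntegral hinj

/-- If the image of `Z` under `z` is not dense, there is a further direction `a` such that the
preimage of the line through `a` meets `Z` only at the origin. -/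
theorem exists_direction_of_not_injective {z : (Fin N → k) →ₗ[k] (Fin r → k)}
    (hcone : ∀ (c : k) (x : Fin N → k), x ∈ Z → c • x ∈ Z)
    (hz : ∀ x ∈ Z, z x = 0 → x = 0) (hne : Z.Nonempty)
    (hinj : ¬ Function.Injective (pullbackQuot Z z)) :
    ∃ a : Fin r → k, a ≠ 0 ∧ ∀ x ∈ Z, z x ∈ Submodule.span k {a} → x = 0 := by
  rw [injective_iff_map_eq_zero] at hinj
  push Not at hinj
  obtain ⟨F, hF, hF0⟩ := hinj
  rw [pullbackQuot_eq_zero_iff] at hF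
  obtain ⟨t, ht⟩ : ∃ t, homogeneousComponent t F ≠ 0 := by
    by_contra! h
    exact hF0 (by rw [← sum_homogeneousComponent F]; exact Finset.sum_eq_zero fun i _ => h i)
  have hG := homogeneousComponent_mem_vIdeal (image_cone z hcone) hF t
  have hhom := homogeneousComponent_isHomogeneous t F
  generalize homogeneousComponent t F = G at ht hG hhom
  obtain ⟨a, ha⟩ : ∃ a, eval a G ≠ 0 := by
    by_contra! h
    exact ht (MvPolynomial.funext fun x => by simpa using h x)
  have hscale : ∀ (c : k) (x : Fin N → k), x ∈ Z → z x = c • a → c ^ t = 0 := by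
    intro c x hx hxa
    have := hG _ ⟨x, hx, rfl⟩
    rw [hxa, eval_smul_of_isHomogeneous_s14 hhom] at this
    exact (mul_eq_zero.mp this).resolve_right ha
  have ht0 : t ≠ 0 := by
    rintro rfl
    obtain ⟨x, hx⟩ := hne
    have := hscale 0 ((0 : k) • x) (hcone 0 x hx) (by simp)
    simp at this
  refine ⟨a, ?_, ?_⟩
  · rintro rfl
    obtain ⟨x, hx⟩ := hne
    have := hscale 1 ((0 : k) • x) (hcone 0 x hx) (by simp)
    simp at this
  · intro x hx hxa
    obtain ⟨c, hc⟩ := Submodule.mem_span_singleton.mp hxa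
    have := hscale c x hx hc.symm
    refine hz x hx ?_
    rw [← hc, (pow_eq_zero_iff ht0).mp this, zero_smul]

/-- Linear Noether normalization, with prescribed linear forms. -/
theorem exists_noether_normalization
    (hcone : ∀ (c : k) (x : Fin N → k), x ∈ Z → c • x ∈ Z) (hcl : IsSubvariety Z)
    (hne : Z.Nonempty) (K : Submodule k (Fin N → k)) (hK : ∀ x ∈ Z, x ∈ K → x = 0) :
    ∃ (r : ℕ) (z : (Fin N → k) →ₗ[k] (Fin r → k)), K ≤ LinearMap.ker z ∧
      (∀ x ∈ Z, z x = 0 → x = 0) ∧ Function.Injective (pullbackQuot Z z) ∧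
      coneDim Z = (r : WithBot ℕ∞) := by
  induction h : Module.finrank k ((Fin N → k) ⧸ K) using Nat.strong_induction_on generalizing K with
  | _ s ih =>
    obtain ⟨z, hker, hsurj⟩ := exists_linearMap_ker_eq K
    have hz : ∀ x ∈ Z, z x = 0 → x = 0 := fun x hx hx0 =>
      hK x hx (by rw [← hker]; exact hx0)
    by_cases hinj : Function.Injective (pullbackQuot Z z)
    · exact ⟨_, z, hker.ge, hz, hinj, coneDim_eq_of_linear hcone hcl hz hinj⟩
    obtain ⟨a, ha0, ha⟩ := exists_direction_of_not_injective hcone hz hne hinj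
    let K' := (Submodule.span k {a}).comap z
    have hKK' : K < K' := by
      refine lt_of_le_of_ne ?_ ?_
      · intro x hx
        rw [← hker] at hx
        rw [Submodule.mem_comap, LinearMap.mem_ker.mp hx]; exact zero_mem _
      · intro e
        obtain ⟨x, hx⟩ := hsurj a
        have : x ∈ K' := by
          rw [Submodule.mem_comap, hx]
          exact Submodule.mem_span_singleton_self a
        rw [← e, ← hker, LinearMap.mem_ker, hx] at this
        exact ha0 this
    have hlt : Module.finrank k ((Fin N → k) ⧸ K') < s := by
      have h1 := Submodule.finrank_quotient_add_finrank K
      have h2 := Submodule.finrank_quotient_add_finrank K'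
      have h3 := Submodule.finrank_lt_finrank_of_lt hKK'
      omega
    obtain ⟨r, z', hz'⟩ := ih _ hlt K' (fun x hx hx' => ha x hx hx') rfl
    exact ⟨r, z', hKK'.le.trans hz'.1, hz'.2⟩

/-- Points of an integral extension: a `k`-point of `C` killing the kernel of
`C → k[Z]` lifts to a point of `Z`. -/
theorem exists_point_of_isIntegral (hcl : IsSubvariety Z) {C : Type*} [CommRing C]
    (φ : C →+* MvPolynomial (Fin N) k ⧸ vIdeal Z) (hφ : φ.IsIntegral)
    (i : k →+* C) (hi : ∀ c, φ (i c) = Ideal.Quotient.mk (vIdeal Z) (MvPolynomial.C c))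
    (χ : C →+* k) (hχi : ∀ c, χ (i c) = c) (hker : RingHom.ker φ ≤ RingHom.ker χ) :
    ∃ x ∈ Z, ∀ (c : C) (f : MvPolynomial (Fin N) k),
      Ideal.Quotient.mk (vIdeal Z) f = φ c → eval x f = χ c := by
  let alg : Algebra C (MvPolynomial (Fin N) k ⧸ vIdeal Z) := φ.toAlgebra
  have : Algebra.IsIntegral C (MvPolynomial (Fin N) k ⧸ vIdeal Z) := ⟨hφ⟩
  have hmax : (RingHom.ker χ).IsMaximal :=
    RingHom.ker_isMaximal_of_surjective χ fun c => ⟨i c, hχi c⟩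
  obtain ⟨Q, hQ, hQχ⟩ := Ideal.exists_ideal_over_maximal_of_isIntegral
    (S := MvPolynomial (Fin N) k ⧸ vIdeal Z) (RingHom.ker χ) hker
  have hQ' : (Q.comap (Ideal.Quotient.mk (vIdeal Z))).IsMaximal :=
    Ideal.comap_isMaximal_of_surjective _ Ideal.Quotient.mk_surjective
  obtain ⟨x, hx⟩ := isMaximal_iff_eq_vanishingIdeal_singleton.mp hQ'
  have hmem : ∀ f, Ideal.Quotient.mk (vIdeal Z) f ∈ Q → eval x f = 0 := by
    intro f hf
    have : f ∈ Q.comap (Ideal.Quotient.mk (vIdeal Z)) := hf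
    rw [hx, mem_vanishingIdeal_singleton_iff] at this
    simpa using this
  refine ⟨x, ?_, ?_⟩
  · rw [hcl]
    intro f hf
    exact hmem f (by rw [Ideal.Quotient.eq_zero_iff_mem.mpr hf]; exact zero_mem _)
  · intro c f hf
    have h1 : c - i (χ c) ∈ RingHom.ker χ := by
      rw [RingHom.mem_ker, map_sub, hχi, sub_self]
    rw [← hQχ] at h1
    have h2 : φ (c - i (χ c)) ∈ Q := h1
    rw [map_sub, hi, ← hf, ← map_sub] at h2
    have := hmem _ h2
    rwa [map_sub, eval_C, sub_eq_zero] at this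

/-- The image of a projective variety under a linear projection is closed. -/
theorem zeroLocusSet_vIdeal_image {z : (Fin N → k) →ₗ[k] (Fin r → k)}
    (hcone : ∀ (c : k) (x : Fin N → k), x ∈ Z → c • x ∈ Z) (hcl : IsSubvariety Z)
    (hz : ∀ x ∈ Z, z x = 0 → x = 0) :
    zeroLocusSet (vIdeal (z '' Z) : Set (MvPolynomial (Fin r) k)) = z '' Z := by
  refine Set.Subset.antisymm (fun y hy => ?_) (fun y hy f hf => hf y hy)
  obtain ⟨x, hx, hxf⟩ := exists_point_of_isIntegral hcl (pullbackQuot Z z).toRingHom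
    (pullbackQuot_isIntegral hcone hcl hz) MvPolynomial.C
    (fun c => (pullbackQuot Z z).commutes c) (eval y) (fun c => eval_C c)
    (fun f hf => hy f (pullbackQuot_eq_zero_iff.mp hf))
  refine ⟨x, hx, funext fun j => ?_⟩
  have := hxf (X j) (pullback z (X j)) rfl
  rwa [eval_pullback, eval_X, eval_X] at this

theorem finite_fibre {z : (Fin N → k) →ₗ[k] (Fin r → k)}
    (hcone : ∀ (c : k) (x : Fin N → k), x ∈ Z → c • x ∈ Z) (hcl : IsSubvariety Z)
    (hz : ∀ x ∈ Z, z x = 0 → x = 0) (a : Fin r → k) : {x ∈ Z | z x = a}.Finite := by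
  have hint := pullbackQuot_isIntegral hcone hcl hz
  choose p hpm hp using fun j : Fin N => hint (Ideal.Quotient.mk (vIdeal Z) (X j))
  refine (Set.Finite.pi' (t := fun j => {c | c ∈ ((p j).map (eval a)).roots})
    fun j => Multiset.finite_toSet _).subset ?_
  rintro x ⟨hx, hxa⟩ j
  change x j ∈ ((p j).map (eval a)).roots
  rw [Polynomial.mem_roots ((hpm j).map _).ne_zero, Polynomial.IsRoot.def, Polynomial.eval_map]
  let ev : MvPolynomial (Fin N) k ⧸ vIdeal Z →+* k :=
    Ideal.Quotient.lift (vIdeal Z) (eval x) fun f hf => hf x hx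
  have h1 := congrArg ev (hp j)
  rw [Polynomial.hom_eval₂, map_zero] at h1
  have h2 : ev.comp (pullbackQuot Z z).toRingHom = eval a := by
    ext f
    · simp [ev, pullbackQuot]
    · rename_i f
      change eval x (pullback z (X f)) = _
      rw [eval_pullback, hxa]
  rw [h2] at h1
  simpa [ev] using h1

theorem finite_linesIn_comap_span {z : (Fin N → k) →ₗ[k] (Fin r → k)}
    (hcone : ∀ (c : k) (x : Fin N → k), x ∈ Z → c • x ∈ Z) (hcl : IsSubvariety Z)
    (hz : ∀ x ∈ Z, z x = 0 → x = 0) (a : Fin r → k) :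
    (linesIn (Z ∩ (Submodule.span k {a}).comap z)).Finite := by
  refine ((finite_fibre hcone hcl hz a).image fun x => Submodule.span k {x}).subset ?_
  intro L hL
  obtain ⟨x, ⟨hxZ, hxa⟩, hx0, rfl⟩ :=
    (mem_linesIn_iff (inter_submodule_cone hcone _)).mp hL
  obtain ⟨c, hc⟩ := Submodule.mem_span_singleton.mp hxa
  have hc0 : c ≠ 0 := by
    rintro rfl
    exact hx0 (hz x hxZ (by rw [← hc, zero_smul]))
  refine ⟨c⁻¹ • x, ⟨hcone _ x hxZ, ?_⟩, ?_⟩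
  · rw [map_smul, ← hc, smul_smul, inv_mul_cancel₀ hc0, one_smul]
  · exact Submodule.span_singleton_smul_eq (IsUnit.mk0 _ (inv_ne_zero hc0)) x

end Projection

section PrimitiveElement

open scoped Polynomial

theorem exists_ne_zero_forall_smul_mem {A M : Type*} [CommRing A] [IsDomain A] [AddCommGroup M]
    [Module A M] [Module.Finite A M] (S : Submodule A M)
    (h : ∀ r : M, ∃ c : A, c ≠ 0 ∧ c • r ∈ S) : ∃ c : A, c ≠ 0 ∧ ∀ r : M, c • r ∈ S := by
  obtain ⟨s, hs⟩ := Module.Finite.fg_top (R := A) (M := M)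
  choose c hc hcS using h
  refine ⟨∏ r ∈ s, c r, Finset.prod_ne_zero_iff.mpr fun r _ => hc r, fun r => ?_⟩
  have hle : Submodule.span A (s : Set M) ≤ S.comap (LinearMap.lsmul A M (∏ r ∈ s, c r)) := by
    rw [Submodule.span_le]
    intro x hx
    obtain ⟨b, hb⟩ := Finset.dvd_prod_of_mem c hx
    change (∏ r ∈ s, c r) • x ∈ S
    rw [hb, mul_comm, mul_smul]
    exact S.smul_mem _ (hcS x)
  exact (hs ▸ hle) (Submodule.mem_top (x := r))

variable {A R : Type*} [CommRing A] [IsDomain A] [IsIntegrallyClosed A] [CommRing R]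
  [IsDomain R] [Algebra A R] [Module.Finite A R] [FaithfulSMul A R]

theorem exists_primitive_integral_element [CharZero A] :
    ∃ θ : R, (∃ c : A, c ≠ 0 ∧ ∀ r : R, c • r ∈
        Submodule.span A (Set.range fun i : Fin (minpoly A θ).natDegree => θ ^ (i : ℕ))) ∧
      ∃ Δ : A, Δ ≠ 0 ∧ ∃ u v : A[X],
        u * minpoly A θ + v * Polynomial.derivative (minpoly A θ) = Polynomial.C Δ := by
  let K := FractionRing A
  let L := FractionRing R
  let _ : Algebra K L := FractionRing.liftAlgebra A L
  have := FractionRing.isScalarTower_liftAlgebra A L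
  have : FiniteDimensional K L := inferInstance
  obtain ⟨α, hα⟩ := Field.exists_primitive_element K L
  have hlift : ∀ β : L, ∃ (a : A) (r : R), a ≠ 0 ∧ algebraMap A L a * β = algebraMap R L r := by
    intro β
    obtain ⟨⟨r, ⟨_, a, ha, rfl⟩⟩, h⟩ :=
      IsLocalization.surj (Algebra.algebraMapSubmonoid R (nonZeroDivisors A)) β
    refine ⟨a, r, nonZeroDivisors.ne_zero ha, ?_⟩
    rw [IsScalarTower.algebraMap_apply A R L, mul_comm]
    exact h
  obtain ⟨a, θ, ha, hθ⟩ := hlift α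
  have haK : algebraMap A K a ≠ 0 := by simpa using ha
  have hint : IsIntegral A θ := IsIntegral.of_finite A θ
  have htop : IntermediateField.adjoin K {algebraMap R L θ} = ⊤ := by
    rw [eq_top_iff, ← hα, IntermediateField.adjoin_simple_le_iff]
    have h1 : α = algebraMap K L (algebraMap A K a)⁻¹ * algebraMap R L θ := by
      rw [← hθ, IsScalarTower.algebraMap_apply A K L, ← mul_assoc, ← map_mul,
        inv_mul_cancel₀ haK, map_one, one_mul]
    rw [h1]
    exact mul_mem (algebraMap_mem _ _) (IntermediateField.mem_adjoin_simple_self K _)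
  have hmin := minpoly.isIntegrallyClosed_eq_field_fractions K L hint
  refine ⟨θ, exists_ne_zero_forall_smul_mem _ fun r => ?_, ?_⟩
  · have hr : algebraMap R L r ∈ (IntermediateField.adjoin K {algebraMap R L θ}) := by
      rw [htop]; trivial
    rw [← IntermediateField.mem_toSubalgebra,
      IntermediateField.adjoin_simple_toSubalgebra_of_isAlgebraic
        (Algebra.IsAlgebraic.isAlgebraic _)] at hr
    obtain ⟨q, hq⟩ := Algebra.adjoin_singleton_eq_range_aeval K (algebraMap R L θ) ▸ hr
    obtain ⟨c, hc, hcq⟩ := IsLocalization.integerNormalization_spec (nonZeroDivisors A) q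
    set q' := IsLocalization.integerNormalization (nonZeroDivisors A) q
    have h1 : c • r = Polynomial.aeval θ q' := by
      apply IsFractionRing.injective R L
      rw [← Polynomial.aeval_algebraMap_apply, ← Polynomial.aeval_map_algebraMap K, hcq, ← algebraMap_smul K c q]
      rw [map_smul (Polynomial.aeval (algebraMap R L θ)), algebraMap_smul,
        show Polynomial.aeval (algebraMap R L θ) q = algebraMap R L r from hq, Algebra.smul_def,
        Algebra.smul_def, map_mul, ← IsScalarTower.algebraMap_apply]
    refine ⟨c, nonZeroDivisors.ne_zero hc, ?_⟩
    have h2 : Polynomial.aeval θ q' = Polynomial.aeval θ (q' %ₘ minpoly A θ) := by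
      conv_lhs => rw [← Polynomial.modByMonic_add_div q' (minpoly A θ)]
      simp
    rw [h1, h2, Polynomial.aeval_eq_sum_range' (Polynomial.natDegree_modByMonic_lt _ (minpoly.monic hint)
      (minpoly.ne_one A θ)), ← Fin.sum_univ_eq_sum_range
        (fun i => (q' %ₘ minpoly A θ).coeff i • θ ^ i)]
    exact sum_mem fun i _ => Submodule.smul_mem _ _ (Submodule.subset_span ⟨i, rfl⟩)
  · have hsep : (minpoly K (algebraMap R L θ)).Separable :=
      Algebra.IsSeparable.isSeparable K (algebraMap R L θ)
    rw [hmin, Polynomial.separable_def] at hsep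
    obtain ⟨u, v, huv⟩ := hsep
    obtain ⟨b, hb, hbu⟩ := IsLocalization.integerNormalization_spec (nonZeroDivisors A) u
    obtain ⟨c, hc, hcv⟩ := IsLocalization.integerNormalization_spec (nonZeroDivisors A) v
    refine ⟨b * c, mul_ne_zero (nonZeroDivisors.ne_zero hb) (nonZeroDivisors.ne_zero hc),
      Polynomial.C c * IsLocalization.integerNormalization (nonZeroDivisors A) u,
      Polynomial.C b * IsLocalization.integerNormalization (nonZeroDivisors A) v, ?_⟩
    apply Polynomial.map_injective (algebraMap A K) (IsFractionRing.injective A K)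
    rw [Polynomial.derivative_map] at huv
    simp only [Polynomial.map_add, Polynomial.map_mul, Polynomial.map_C, hbu, hcv]
    have hs : ∀ (x : A) (w : K[X]), x • w = Polynomial.C (algebraMap A K x) * w := fun x w => by
      rw [← algebraMap_smul K x w, Polynomial.smul_eq_C_mul]
    rw [hs, hs, map_mul, Polynomial.C_mul]
    linear_combination (Polynomial.C (algebraMap A K b) * Polynomial.C (algebraMap A K c)) * huv

end PrimitiveElement

theorem eq_zero_of_sum_smul_pow_eq_zero {A R k : Type*} [CommRing A] [IsDomain A]
    [IsIntegrallyClosed A] [CommRing R] [IsDomain R] [Algebra A R] [FaithfulSMul A R] [Field k]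
    {θ : R} (hθ : IsIntegral A θ) {d : ℕ} {χ₀ : A →+* k} {χ : Fin d → R →+* k}
    (hχ : ∀ j a, χ j (algebraMap A R a) = χ₀ a) (hinj : Function.Injective fun j => χ j θ)
    {c : Fin d → A} (hc : ∑ i, c i • θ ^ (i : ℕ) = 0) : c = 0 := by
  classical
  have hmonic := minpoly.monic hθ
  have hd : d ≤ (minpoly A θ).natDegree := by
    have hsub : Finset.univ.image (fun j => χ j θ) ⊆ ((minpoly A θ).map χ₀).roots.toFinset := by
      intro b hb
      obtain ⟨j, -, rfl⟩ := Finset.mem_image.mp hb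
      rw [Multiset.mem_toFinset, Polynomial.mem_roots (hmonic.map χ₀).ne_zero,
        Polynomial.IsRoot.def, Polynomial.eval_map,
        show χ₀ = (χ j).comp (algebraMap A R) from RingHom.ext fun a => (hχ j a).symm,
        ← Polynomial.hom_eval₂, ← Polynomial.aeval_def, minpoly.aeval, map_zero]
    calc d = (Finset.univ.image (fun j => χ j θ)).card := by
          rw [Finset.card_image_of_injective _ hinj, Finset.card_univ, Fintype.card_fin]
      _ ≤ _ := Finset.card_le_card hsub
      _ ≤ _ := Multiset.toFinset_card_le _
      _ ≤ ((minpoly A θ).map χ₀).natDegree := Polynomial.card_roots' _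
      _ = _ := hmonic.natDegree_map χ₀
  let q : Polynomial A := ∑ i : Fin d, Polynomial.C (c i) * Polynomial.X ^ (i : ℕ)
  have hqdeg : q.degree < d := Polynomial.degree_sum_fin_lt c
  have hq0 : q = 0 := by
    refine Polynomial.eq_zero_of_dvd_of_degree_lt (minpoly.isIntegrallyClosed_dvd hθ (p := q) ?_) ?_
    · simpa [q, Algebra.smul_def] using hc
    · rw [Polynomial.degree_eq_natDegree hmonic.ne_zero]
      exact hqdeg.trans_le (by exact_mod_cast hd)
  funext i
  have h := congrArg (fun p => Polynomial.coeff p (i : ℕ)) hq0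
  simp only [q, Polynomial.finsetSum_coeff, Polynomial.coeff_C_mul, Polynomial.coeff_X_pow,
    Polynomial.coeff_zero] at h
  rw [Finset.sum_eq_single i] at h
  · simpa using h
  · intro j _ hj
    rw [if_neg (fun h => hj (Fin.ext h.symm)), mul_zero]
  · simp

theorem le_of_mul_le_mul_shift {d e c M : ℕ} {D : ℕ → ℕ} (hD0 : 0 < D 0)
    (hD : ∀ t, D t ≤ (t + 1) ^ M) (h : ∀ t, d * D t ≤ e * D (t + c)) : d ≤ e := by
  by_contra! hlt
  have he : 0 < e := by
    by_contra! he0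
    have := h 0
    rw [Nat.le_zero.mp he0, zero_mul] at this
    exact absurd (Nat.mul_pos (by omega : 0 < d) hD0) (by omega)
  have hpow : ∀ j, (e + 1) ^ j ≤ e ^ j * D (j * c) := by
    intro j
    induction j with
    | zero => rw [pow_zero, pow_zero, zero_mul, one_mul]; exact hD0
    | succ j ih =>
      calc (e + 1) ^ (j + 1) = (e + 1) ^ j * (e + 1) := pow_succ _ _
        _ ≤ e ^ j * D (j * c) * d := Nat.mul_le_mul ih hlt
        _ = e ^ j * (d * D (j * c)) := by ring
        _ ≤ e ^ j * (e * D (j * c + c)) := Nat.mul_le_mul_left _ (h _)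
        _ = e ^ (j + 1) * D ((j + 1) * c) := by rw [add_mul, one_mul]; ring
  have hr : (1 : ℝ) < ((e : ℝ) + 1) / e := by
    rw [one_lt_div (by exact_mod_cast he)]; linarith
  have hlim := tendsto_pow_const_div_const_pow_of_one_lt M hr
  have hpos : (0 : ℝ) < 1 / (c + 1) ^ M := by positivity
  obtain ⟨j, hj, hj1⟩ := ((hlim.eventually (gt_mem_nhds hpos)).and
    (Filter.eventually_ge_atTop 1)).exists
  have h1 : ((e : ℝ) + 1) ^ j ≤ e ^ j * ((c + 1) ^ M * j ^ M) := by
    rw [← mul_pow]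
    have h2 : (e + 1) ^ j ≤ e ^ j * ((c + 1) * j) ^ M :=
      (hpow j).trans (Nat.mul_le_mul_left _ ((hD _).trans (Nat.pow_le_pow_left (by nlinarith) _)))
    exact_mod_cast h2
  have he' : (0 : ℝ) < (e : ℝ) ^ j := by positivity
  rw [div_pow, div_lt_div_iff₀ (by positivity) (by positivity), one_mul,
    lt_div_iff₀ he'] at hj
  nlinarith

theorem finrank_restrictTotalDegree_le (k : Type*) [Field k] (M t : ℕ) :
    Module.finrank k (restrictTotalDegree (Fin M) k t) ≤ (t + 1) ^ M := by
  have hb := Module.finrank_eq_nat_card_basis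
    (basisRestrictSupport k {s : Fin M →₀ ℕ | s.sum (fun _ e => e) ≤ t})
  refine hb.le.trans ?_
  have hle : ∀ (s : {s : Fin M →₀ ℕ | s.sum (fun _ e => e) ≤ t}) i, s.1 i < t + 1 := by
    rintro ⟨s, hs⟩ i
    have hs' : s.sum (fun _ e => e) ≤ t := hs
    rw [Finsupp.sum_fintype _ _ (by simp)] at hs'
    exact Nat.lt_succ_of_le ((Finset.single_le_sum (f := fun i => s i) (by simp)
      (Finset.mem_univ i)).trans hs')
  calc _ ≤ Nat.card (Fin M → Fin (t + 1)) :=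
        Nat.card_le_card_of_injective (fun s i => ⟨s.1 i, hle s i⟩) (by
          intro s s' h
          refine Subtype.ext (Finsupp.ext fun i => ?_)
          simpa using congrArg Fin.val (congrFun h i))
    _ = _ := by simp

theorem finrank_restrictTotalDegree_pos (k : Type*) [Field k] (M t : ℕ) :
    0 < Module.finrank k (restrictTotalDegree (Fin M) k t) := by
  have : Nontrivial (restrictTotalDegree (Fin M) k t) :=
    ⟨⟨0, ⟨1, (mem_restrictTotalDegree _ _ _).mpr (by simp)⟩, fun h =>
      zero_ne_one (congrArg Subtype.val h)⟩⟩
  exact Module.finrank_pos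

/-- The functions on `Z` which are restrictions of polynomials of degree at most `t`. -/
noncomputable def degreeLEQuot {k : Type*} [Field k] {N : ℕ} (Z : Set (Fin N → k)) (t : ℕ) :
    Submodule k (MvPolynomial (Fin N) k ⧸ vIdeal Z) :=
  (restrictTotalDegree (Fin N) k t).map (Ideal.Quotient.mkₐ k (vIdeal Z)).toLinearMap

/-- The combinations of the powers `θ ^ i`, `i < d`, whose coefficients are pulled back from
polynomials of degree at most `t`. -/
noncomputable def powerSum {k : Type*} [Field k] {N r : ℕ} (Z : Set (Fin N → k))
    (z : (Fin N → k) →ₗ[k] (Fin r → k)) (θ : MvPolynomial (Fin N) k ⧸ vIdeal Z) (d t : ℕ) :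
    (Fin d → restrictTotalDegree (Fin r) k t) →ₗ[k] MvPolynomial (Fin N) k ⧸ vIdeal Z :=
  ∑ i : Fin d, LinearMap.mulRight k (θ ^ (i : ℕ)) ∘ₗ (pullbackQuot Z z).toLinearMap ∘ₗ
    (restrictTotalDegree (Fin r) k t).subtype ∘ₗ LinearMap.proj i

section HilbertFunction

variable {k : Type*} [Field k] {N r : ℕ} {Z : Set (Fin N → k)}
  {z : (Fin N → k) →ₗ[k] (Fin r → k)}

theorem powerSum_apply (θ : MvPolynomial (Fin N) k ⧸ vIdeal Z) (d t : ℕ)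
    (c : Fin d → restrictTotalDegree (Fin r) k t) :
    powerSum Z z θ d t c = ∑ i, pullbackQuot Z z (c i) * θ ^ (i : ℕ) := by
  simp [powerSum]

theorem finrank_pi_restrictTotalDegree (d t : ℕ) :
    Module.finrank k (Fin d → restrictTotalDegree (Fin r) k t) =
      d * Module.finrank k (restrictTotalDegree (Fin r) k t) := by
  simp [Module.finrank_pi_fintype]

theorem mul_finrank_le_finrank_degreeLEQuot [(vIdeal Z).IsPrime]
    (hint : (pullbackQuot Z z).toRingHom.IsIntegral)
    (hinj : Function.Injective (pullbackQuot Z z)) {θ : MvPolynomial (Fin N) k}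
    (hθ : θ.totalDegree ≤ 1) {d : ℕ} {x : Fin d → Fin N → k} (hx : ∀ j, x j ∈ Z)
    {a : Fin r → k} (hxa : ∀ j, z (x j) = a) (hθx : Function.Injective fun j => eval (x j) θ)
    (t : ℕ) :
    d * Module.finrank k (restrictTotalDegree (Fin r) k t) ≤
      Module.finrank k (degreeLEQuot Z (t + d)) := by
  let alg : Algebra (MvPolynomial (Fin r) k) (MvPolynomial (Fin N) k ⧸ vIdeal Z) :=
    (pullbackQuot Z z).toRingHom.toAlgebra
  have : FaithfulSMul (MvPolynomial (Fin r) k) (MvPolynomial (Fin N) k ⧸ vIdeal Z) :=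
    (faithfulSMul_iff_algebraMap_injective _ _).mpr hinj
  set θ' := Ideal.Quotient.mk (vIdeal Z) θ with hθ'
  let χ : Fin d → (MvPolynomial (Fin N) k ⧸ vIdeal Z) →+* k := fun j =>
    Ideal.Quotient.lift (vIdeal Z) (eval (x j)) fun f hf => hf _ (hx j)
  have hker : ∀ c, powerSum Z z θ' d t c = 0 → c = 0 := by
    intro c hc
    rw [powerSum_apply] at hc
    have h := eq_zero_of_sum_smul_pow_eq_zero (A := MvPolynomial (Fin r) k) (θ := θ')
      (hint θ') (χ₀ := eval a) (χ := χ)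
      (fun j f => by
        change eval (x j) (pullback z f) = _
        rw [eval_pullback, hxa])
      hθx (c := fun i => (c i : MvPolynomial (Fin r) k)) (by
        rw [← hc]
        exact Finset.sum_congr rfl fun i _ => Algebra.smul_def _ _)
    funext i
    exact Subtype.ext (congrFun h i)
  have hrange : ∀ c, powerSum Z z θ' d t c ∈ degreeLEQuot Z (t + d) := by
    intro c
    rw [powerSum_apply]
    refine sum_mem fun i _ => ⟨pullback z (c i) * θ ^ (i : ℕ), ?_, ?_⟩
    · rw [SetLike.mem_coe, mem_restrictTotalDegree]
      refine (totalDegree_mul _ _).trans (add_le_add ?_ ?_)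
      · exact (totalDegree_pullback_le z _).trans ((mem_restrictTotalDegree _ _ _).mp (c i).2)
      · refine (totalDegree_pow _ _).trans ?_
        exact (Nat.mul_le_mul_left _ hθ).trans (by rw [mul_one]; exact i.2.le)
    · change Ideal.Quotient.mk (vIdeal Z) _ = _
      rw [map_mul, map_pow]
      rfl
  have : Module.Finite k (degreeLEQuot Z (t + d)) :=
    Module.Finite.map _ _
  rw [← finrank_pi_restrictTotalDegree]
  refine LinearMap.finrank_le_finrank_of_injective
    (f := (powerSum Z z θ' d t).codRestrict _ hrange) ?_
  rw [injective_iff_map_eq_zero]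
  intro c hc
  exact hker c (congrArg Subtype.val hc)

theorem exists_finrank_degreeLEQuot_le [IsAlgClosed k] [(vIdeal Z).IsPrime]
    (hcone : ∀ (c : k) (x : Fin N → k), x ∈ Z → c • x ∈ Z) (hcl : IsSubvariety Z)
    (hz : ∀ x ∈ Z, z x = 0 → x = 0) (hinj : Function.Injective (pullbackQuot Z z))
    {θ : MvPolynomial (Fin N) k ⧸ vIdeal Z} {e : ℕ} {f : MvPolynomial (Fin r) k} (hf : f ≠ 0)
    (hspan : ∀ g, ∃ c : Fin e → MvPolynomial (Fin r) k,
      pullbackQuot Z z f * g = ∑ i, pullbackQuot Z z (c i) * θ ^ (i : ℕ)) :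
    ∃ b : ℕ, ∀ t, Module.finrank k (degreeLEQuot Z t) ≤
      e * Module.finrank k (restrictTotalDegree (Fin r) k (t + b)) := by
  obtain ⟨B, hB⟩ := exists_forall_mem_boundedSpan hcone hcl hz
  choose c hc using hspan
  have hfin : {β : Fin N →₀ ℕ | β.degree < B}.Finite :=
    (Finsupp.finite_of_degree_le B).subset fun β hβ => le_of_lt (Set.mem_ofPred.mp hβ)
  let b := hfin.toFinset.sup fun β => Finset.univ.sup fun i =>
    (c (Ideal.Quotient.mk (vIdeal Z) (monomial β 1)) i).totalDegree
  refine ⟨b, fun t => ?_⟩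
  let μ := LinearMap.mulLeft k (pullbackQuot Z z f)
  have hμ : Function.Injective μ :=
    mul_right_injective₀ ((map_ne_zero_iff _ hinj).mpr hf)
  have hle : (degreeLEQuot Z t).map μ ≤ LinearMap.range (powerSum Z z θ e (t + b)) := by
    rw [Submodule.map_le_iff_le_comap]
    have h1 : degreeLEQuot Z t ≤ boundedSpan Z z B t := by
      rintro _ ⟨g, hg, rfl⟩
      exact hB t g ((mem_restrictTotalDegree _ _ _).mp hg)
    refine h1.trans (Submodule.span_le.mpr ?_)
    rintro _ ⟨a, ha, β, hβ, rfl⟩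
    refine ⟨fun i => ⟨a * c (Ideal.Quotient.mk (vIdeal Z) (monomial β 1)) i, ?_⟩, ?_⟩
    · rw [mem_restrictTotalDegree]
      refine (totalDegree_mul _ _).trans (add_le_add ha ?_)
      refine le_trans ?_ (Finset.le_sup (hfin.mem_toFinset.mpr hβ))
      exact Finset.le_sup (f := fun i =>
        (c (Ideal.Quotient.mk (vIdeal Z) (monomial β 1)) i).totalDegree) (Finset.mem_univ i)
    · rw [powerSum_apply]
      change _ = pullbackQuot Z z f * (pullbackQuot Z z a * _)
      rw [mul_left_comm, hc, Finset.mul_sum]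
      refine Finset.sum_congr rfl fun i _ => ?_
      rw [map_mul, mul_assoc]
  rw [← finrank_pi_restrictTotalDegree, (Submodule.equivMapOfInjective μ hμ _).finrank_eq]
  exact (Submodule.finrank_mono hle).trans (LinearMap.finrank_range_le _)

end HilbertFunction

section DegreeComparison

variable {k : Type*} [Field k] [IsAlgClosed k] {N M : ℕ} {Z : Set (Fin N → k)}

theorem exists_normalization_of_section [(vIdeal Z).IsPrime]
    (hcone : ∀ (c : k) (x : Fin N → k), x ∈ Z → c • x ∈ Z) (hcl : IsSubvariety Z)
    (hdim : coneDim Z = (M : WithBot ℕ∞)) (Q : Submodule k (Fin N → k))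
    (hfin : (linesIn (Z ∩ Q)).Finite) :
    ∃ (z : (Fin N → k) →ₗ[k] (Fin M → k)) (a : Fin M → k)
      (x : Fin (linesIn (Z ∩ Q)).ncard → Fin N → k),
      (∀ x ∈ Z, z x = 0 → x = 0) ∧ Function.Injective (pullbackQuot Z z) ∧
      Function.Injective x ∧ ∀ j, x j ∈ Z ∧ z (x j) = a := by
  have : Finite (linesIn (Z ∩ Q)) := hfin
  let E := Finite.equivFin (linesIn (Z ∩ Q))
  have hL : ∀ L : linesIn (Z ∩ Q), ∃ v ∈ Z ∩ Q, v ≠ 0 ∧ L.1 = Submodule.span k {v} := fun L =>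
    (mem_linesIn_iff (inter_submodule_cone hcone Q)).mp L.2
  choose v hv hv0 hvL using hL
  obtain ⟨ψ, hψ⟩ := Module.exists_dual_forall_apply_ne_zero (K := k) v hv0
  have hK : ∀ x ∈ Z, x ∈ Q ⊓ LinearMap.ker ψ → x = 0 := by
    rintro x hx ⟨hxQ, hxψ⟩
    by_contra hx0
    let L : linesIn (Z ∩ Q) := ⟨Submodule.span k {x},
      (mem_linesIn_iff (inter_submodule_cone hcone Q)).mpr ⟨x, ⟨hx, hxQ⟩, hx0, rfl⟩⟩
    have hmem : v L ∈ Submodule.span k {x} := by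
      rw [show Submodule.span k {x} = L.1 from rfl, hvL L]
      exact Submodule.mem_span_singleton_self _
    obtain ⟨c, hc⟩ := Submodule.mem_span_singleton.mp hmem
    exact hψ L (by rw [← hc, map_smul, LinearMap.mem_ker.mp hxψ, smul_zero])
  have hne : Z.Nonempty := by
    by_contra hemp
    rw [Set.not_nonempty_iff_eq_empty] at hemp
    refine Ideal.IsPrime.ne_top (I := vIdeal Z) inferInstance ((Ideal.eq_top_iff_one _).mpr ?_)
    intro x hx
    rw [hemp] at hx
    exact hx.elim
  obtain ⟨r, z, hKz, hz, hinj, hr⟩ := exists_noether_normalization hcone hcl hne _ hK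
  obtain rfl : M = r := by
    rw [hdim] at hr
    exact_mod_cast hr
  let x : linesIn (Z ∩ Q) → Fin N → k := fun L => (ψ (v L))⁻¹ • v L
  have hxψ : ∀ L, ψ (x L) = 1 := fun L => by
    rw [map_smul, smul_eq_mul, inv_mul_cancel₀ (hψ L)]
  have hxinj : Function.Injective x := by
    intro L L' h
    have hspan : ∀ L, Submodule.span k {x L} = L.1 := fun L => by
      rw [hvL L]
      exact Submodule.span_singleton_smul_eq (IsUnit.mk0 _ (inv_ne_zero (hψ L))) _
    exact Subtype.ext (by rw [← hspan, ← hspan, h])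
  have hxz : ∀ L L', z (x L) = z (x L') := by
    intro L L'
    rw [← sub_eq_zero, ← map_sub]
    refine LinearMap.mem_ker.mp (hKz ⟨?_, ?_⟩)
    · exact Q.sub_mem (Q.smul_mem _ (hv L).2) (Q.smul_mem _ (hv L').2)
    · rw [SetLike.mem_coe, LinearMap.mem_ker, map_sub, hxψ, hxψ, sub_self]
  obtain ⟨a, ha⟩ : ∃ a, ∀ L, z (x L) = a := by
    rcases isEmpty_or_nonempty (linesIn (Z ∩ Q)) with h | ⟨⟨L⟩⟩
    · exact ⟨0, fun L => (h.false L).elim⟩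
    · exact ⟨z (x L), fun L' => hxz L' L⟩
  exact ⟨z, a, fun j => x (E.symm j), hz, hinj, hxinj.comp E.symm.injective,
    fun j => ⟨hcone _ _ (hv _).1, ha _⟩⟩

theorem ncard_linesIn_le [(vIdeal Z).IsPrime]
    (hcone : ∀ (c : k) (x : Fin N → k), x ∈ Z → c • x ∈ Z) (hcl : IsSubvariety Z)
    (hdim : coneDim Z = (M : WithBot ℕ∞)) {Q : Submodule k (Fin N → k)}
    (hfin : (linesIn (Z ∩ Q)).Finite) {y : (Fin N → k) →ₗ[k] (Fin M → k)}
    (hy : ∀ x ∈ Z, y x = 0 → x = 0) (hinj : Function.Injective (pullbackQuot Z y))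
    {θ : MvPolynomial (Fin N) k ⧸ vIdeal Z} {e : ℕ} {f : MvPolynomial (Fin M) k} (hf : f ≠ 0)
    (hspan : ∀ g, ∃ c : Fin e → MvPolynomial (Fin M) k,
      pullbackQuot Z y f * g = ∑ i, pullbackQuot Z y (c i) * θ ^ (i : ℕ)) :
    (linesIn (Z ∩ Q)).ncard ≤ e := by
  obtain ⟨z, a, x, hz, hzinj, hx, hxa⟩ := exists_normalization_of_section hcone hcl hdim Q hfin
  let d := (linesIn (Z ∩ Q)).ncard
  obtain ⟨b, hb⟩ := exists_finrank_degreeLEQuot_le hcone hcl hy hinj hf hspan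
  obtain ⟨ψ, hψ⟩ := Module.exists_dual_forall_apply_ne_zero (K := k)
    (fun p : {p : Fin d × Fin d // p.1 ≠ p.2} => x p.1.1 - x p.1.2)
    (fun p => sub_ne_zero.mpr (hx.ne p.2))
  let l : MvPolynomial (Fin N) k := coordForm (LinearMap.pi fun _ : Fin 1 => ψ) 0
  have hl : Function.Injective fun j => eval (x j) l := by
    intro i j hij
    simp only [l, eval_coordForm, LinearMap.pi_apply] at hij
    by_contra hne
    exact hψ ⟨(i, j), hne⟩ (by rw [map_sub, hij, sub_self])
  refine le_of_mul_le_mul_shift (c := d + b) (M := M) (finrank_restrictTotalDegree_pos k M 0)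
    (finrank_restrictTotalDegree_le k M) fun t => ?_
  rw [← add_assoc]
  exact (mul_finrank_le_finrank_degreeLEQuot (pullbackQuot_isIntegral hcone hcl hz) hzinj
    (coordForm_isHomogeneous _ _).totalDegree_le (fun j => (hxa j).1) (fun j => (hxa j).2)
    hl t).trans (hb _)

end DegreeComparison

section Secant

variable {k : Type*} [Field k] {N : ℕ} {Z : Set (Fin N → k)} {W : Submodule k (Fin N → k)}

theorem subset_zeroLocusSet_vIdeal (S : Set (Fin N → k)) :
    S ⊆ zeroLocusSet (vIdeal S : Set (MvPolynomial (Fin N) k)) :=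
  fun x hx _ hf => hf x hx

theorem vIdeal_zeroLocusSet_vIdeal (S : Set (Fin N → k)) :
    vIdeal (zeroLocusSet (vIdeal S : Set (MvPolynomial (Fin N) k))) = vIdeal S :=
  le_antisymm (fun _ hf x hx => hf x (subset_zeroLocusSet_vIdeal S hx))
    (fun f hf _ hx => hx f hf)

theorem smul_mem_zeroLocusSet_vIdeal {S : Set (Fin N → k)}
    (hcone : ∀ (c : k) (x : Fin N → k), x ∈ S → c • x ∈ S) (c : k) (x : Fin N → k)
    (hx : x ∈ zeroLocusSet (vIdeal S : Set (MvPolynomial (Fin N) k))) :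
    c • x ∈ zeroLocusSet (vIdeal S : Set (MvPolynomial (Fin N) k)) := by
  intro f hf
  have h := hx (pullback (c • LinearMap.id) f) fun y hy => by
    rw [eval_pullback]
    exact hf _ (hcone c y hy)
  rwa [eval_pullback] at h

theorem add_mem_zeroLocusSet_vIdeal {S : Set (Fin N → k)} {w : Fin N → k}
    (hw : ∀ x ∈ S, x + w ∈ S) {x : Fin N → k}
    (hx : x ∈ zeroLocusSet (vIdeal S : Set (MvPolynomial (Fin N) k))) :
    x + w ∈ zeroLocusSet (vIdeal S : Set (MvPolynomial (Fin N) k)) := by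
  intro f hf
  have hev : ∀ y : Fin N → k, eval y (bind₁ (fun i => X i + C (w i)) f) = eval (y + w) f := by
    intro y
    rw [eval, eval₂Hom_bind₁]
    congr 1
    congr 1
    funext i
    simp
  have h := hx (bind₁ (fun i => X i + C (w i)) f) fun y hy => by
    rw [hev]
    exact hf _ (hw y hy)
  rwa [hev] at h

theorem SCset_cone (c : k) (v : Fin N → k) (hv : v ∈ SCset Z W) : c • v ∈ SCset Z W := by
  rcases hv with hv | ⟨x, y, hx, hy, hxv, hyv, hxy⟩
  · exact Or.inl (W.smul_mem c hv)
  · by_cases hc : c = 0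
    · rw [hc, zero_smul]
      exact Or.inl W.zero_mem
    · have hs : Submodule.span k {c • v} = Submodule.span k {v} :=
        Submodule.span_singleton_smul_eq (IsUnit.mk0 c hc) v
      exact Or.inr ⟨x, y, hx, hy, hs ▸ hxv, hs ▸ hyv, hxy⟩

theorem add_mem_SCset {w : Fin N → k} (hw : w ∈ W) (v : Fin N → k) (hv : v ∈ SCset Z W) :
    v + w ∈ SCset Z W := by
  rcases hv with hv | ⟨x, y, hx, hy, hxv, hyv, hxy⟩
  · exact Or.inl (W.add_mem hv hw)
  · have hle : W ⊔ Submodule.span k {v} ≤ W ⊔ Submodule.span k {v + w} := by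
      refine sup_le le_sup_left ?_
      rw [Submodule.span_singleton_le_iff_mem]
      have h1 := Submodule.sub_mem _ (Submodule.mem_sup_right (S := W)
        (Submodule.mem_span_singleton_self (R := k) (v + w)))
        (Submodule.mem_sup_left (T := Submodule.span k {v + w}) hw)
      rwa [add_sub_cancel_right] at h1
    exact Or.inr ⟨x, y, hx, hy, hle hxv, hle hyv, hxy⟩

theorem exists_mem_vIdeal_SCset [IsAlgClosed k] {M : ℕ}
    (hcone : ∀ (c : k) (x : Fin N → k), x ∈ Z → c • x ∈ Z) (hcl : IsSubvariety Z)
    (hdim : coneDim Z = (M : WithBot ℕ∞)) (hWZ : ∀ x ∈ Z, x ∈ W → x = 0) {s : ℕ}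
    (hS : coneDim (SCset Z W) ≤ (s : WithBot ℕ∞)) (hs : s < Module.finrank k W + M) :
    ∃ g ∈ vIdeal (SCset Z W), g ∉ vIdeal Z := by
  by_contra! hcon
  set T := zeroLocusSet (vIdeal (SCset Z W) : Set (MvPolynomial (Fin N) k)) with hT
  have hZT : Z ⊆ T := fun x hx f hf => hcon f hf x hx
  have hWT : ∀ w ∈ W, w ∈ T := fun w hw => subset_zeroLocusSet_vIdeal _ (Or.inl hw)
  obtain ⟨r, z, -, hz, -, hr⟩ := exists_noether_normalization
    (smul_mem_zeroLocusSet_vIdeal (SCset_cone (Z := Z) (W := W))) (isSubvariety_zeroLocusSet _)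
    ⟨0, hWT 0 W.zero_mem⟩ ⊥ (fun x _ hx => by simpa using hx)
  have hrs : r ≤ s := by
    rw [coneDim, vIdeal_zeroLocusSet_vIdeal] at hr
    rw [coneDim, hr] at hS
    exact_mod_cast hS
  have hinf : W ⊓ LinearMap.ker z = ⊥ := by
    rw [eq_bot_iff]
    rintro w ⟨hw, hwz⟩
    exact hz w (hWT w hw) hwz
  obtain ⟨q, hq, -⟩ := exists_linearMap_ker_eq (W ⊔ LinearMap.ker z)
  have hle := coneDim_le_of_linear (z := q) hcone hcl fun x hx hqx => by
    have hx' : x ∈ W ⊔ LinearMap.ker z := by rw [← hq]; exact hqx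
    obtain ⟨w, hw, u, hu, rfl⟩ := Submodule.mem_sup.mp hx'
    have h0 : u = 0 := by
      refine hz u ?_ hu
      have := add_mem_zeroLocusSet_vIdeal (add_mem_SCset (Z := Z) (W.neg_mem hw)) (hZT hx)
      rwa [add_neg_cancel_comm] at this
    rw [h0, add_zero] at hx ⊢
    exact hWZ w hx hw
  rw [hdim] at hle
  have hle' : M ≤ Module.finrank k ((Fin N → k) ⧸ W ⊔ LinearMap.ker z) := by exact_mod_cast hle
  have h1 := Submodule.finrank_quotient_add_finrank (W ⊔ LinearMap.ker z)
  have h2 := Submodule.finrank_sup_add_finrank_inf_eq W (LinearMap.ker z)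
  have h3 := LinearMap.finrank_range_add_finrank_ker z
  have h4 := Submodule.finrank_le (LinearMap.range z)
  rw [hinf, finrank_bot] at h2
  simp only [Module.finrank_fintype_fun_eq_card, Fintype.card_fin] at h1 h3 h4
  omega

/-- Away from the zeros of a function vanishing on the secant locus, points of `Z` are determined
up to scaling by their image under a linear map with kernel `W`. -/
theorem mem_span_of_map_mem_span (hWZ : ∀ x ∈ Z, x ∈ W → x = 0) {r : ℕ}
    {p : (Fin N → k) →ₗ[k] (Fin r → k)} (hp : LinearMap.ker p = W)
    {g : MvPolynomial (Fin N) k} (hg : g ∈ vIdeal (SCset Z W)) {x y : Fin N → k} (hx : x ∈ Z)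
    (hy : y ∈ Z) (hgx : eval x g ≠ 0) (hy0 : y ≠ 0) (hpxy : p x ∈ Submodule.span k {p y}) :
    x ∈ Submodule.span k {y} := by
  by_contra hxy
  have hx0 : x ≠ 0 := fun h => hxy (h ▸ Submodule.zero_mem _)
  obtain ⟨c, hc⟩ := Submodule.mem_span_singleton.mp hpxy
  have hc0 : c ≠ 0 := by
    rintro rfl
    rw [zero_smul] at hc
    exact hx0 (hWZ x hx (hp ▸ hc.symm))
  refine hgx (hg x (Or.inr ⟨x, y, hx, hy,
    Submodule.mem_sup_right (Submodule.mem_span_singleton_self x), ?_, ?_⟩))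
  · have hw : y - c⁻¹ • x ∈ W := by
      rw [← hp, LinearMap.mem_ker, map_sub, map_smul, ← hc, inv_smul_smul₀ hc0, sub_self]
    have := Submodule.add_mem_sup hw (Submodule.smul_mem _ c⁻¹
      (Submodule.mem_span_singleton_self (R := k) x))
    rwa [sub_add_cancel] at this
  · rw [LinearIndependent.pair_symm_iff, LinearIndependent.pair_iff' hy0]
    intro b hb
    exact hxy (Submodule.mem_span_singleton.mpr ⟨b, hb⟩)

end Secant

section GenericFibre

variable {k : Type*} [Field k] [IsAlgClosed k] {N M : ℕ} {Z : Set (Fin N → k)}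

theorem exists_injective_roots {p : Polynomial k} (hsep : p.Separable) :
    ∃ ρ : Fin p.natDegree → k, Function.Injective ρ ∧ ∀ j, p.eval (ρ j) = 0 := by
  classical
  have hcard : p.roots.toFinset.card = p.natDegree := by
    rw [Multiset.toFinset_card_of_nodup (Polynomial.nodup_roots hsep),
      (IsAlgClosed.splits p).natDegree_eq_card_roots]
  let E := p.roots.toFinset.equivFinOfCardEq hcard
  refine ⟨fun j => E.symm j, Subtype.val_injective.comp E.symm.injective, fun j => ?_⟩
  exact Polynomial.isRoot_of_mem_roots (Multiset.mem_toFinset.mp (E.symm j).2)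

theorem exists_point_of_root (hcl : IsSubvariety Z) {y : (Fin N → k) →ₗ[k] (Fin M → k)}
    (hint : (pullbackQuot Z y).toRingHom.IsIntegral) {θ : MvPolynomial (Fin N) k}
    {p : Polynomial (MvPolynomial (Fin M) k)}
    (hp : ∀ q, q.eval₂ (pullbackQuot Z y).toRingHom (Ideal.Quotient.mk (vIdeal Z) θ) = 0 → p ∣ q)
    {a : Fin M → k} {ρ : k} (hρ : (p.map (eval a)).eval ρ = 0) :
    ∃ x ∈ Z, y x = a ∧ eval x θ = ρ := by
  let φ : Polynomial (MvPolynomial (Fin M) k) →+* MvPolynomial (Fin N) k ⧸ vIdeal Z :=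
    Polynomial.eval₂RingHom (pullbackQuot Z y).toRingHom (Ideal.Quotient.mk (vIdeal Z) θ)
  have hφC : φ.comp Polynomial.C = (pullbackQuot Z y).toRingHom := by
    ext <;> simp [φ]
  have hφint : φ.IsIntegral := RingHom.IsIntegral.tower_top Polynomial.C φ (hφC ▸ hint)
  obtain ⟨x, hx, hxf⟩ := exists_point_of_isIntegral hcl φ hφint
    (Polynomial.C.comp MvPolynomial.C)
    (fun c => (congrArg (fun ψ => ψ (MvPolynomial.C c)) hφC).trans
      ((pullbackQuot Z y).commutes c))
    (Polynomial.eval₂RingHom (eval a) ρ) (fun c => by simp) (fun q hq => by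
      obtain ⟨s, rfl⟩ := hp q hq
      rw [RingHom.mem_ker, map_mul, Polynomial.coe_eval₂RingHom, ← Polynomial.eval_map, hρ,
        zero_mul])
  refine ⟨x, hx, funext fun i => ?_, ?_⟩
  · have h := hxf (Polynomial.C (X i)) (pullback y (X i))
      (congrArg (fun ψ => ψ (X i)) hφC).symm
    rw [eval_pullback] at h
    simpa using h
  · simpa using hxf Polynomial.X θ (by simp [φ])

theorem exists_generic_fibre [CharZero k] [(vIdeal Z).IsPrime]
    (hcone : ∀ (c : k) (x : Fin N → k), x ∈ Z → c • x ∈ Z) (hcl : IsSubvariety Z)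
    (hdim : coneDim Z = (M : WithBot ℕ∞)) (hM : 0 < M) {y : (Fin N → k) →ₗ[k] (Fin M → k)}
    (hy : ∀ x ∈ Z, y x = 0 → x = 0) (hinj : Function.Injective (pullbackQuot Z y))
    {g : MvPolynomial (Fin N) k} (hg : g ∉ vIdeal Z) :
    ∃ (a : Fin M → k) (e : ℕ) (x : Fin e → Fin N → k), a ≠ 0 ∧ Function.Injective x ∧
      (∀ j, x j ∈ Z ∧ y (x j) = a ∧ eval (x j) g ≠ 0) ∧
      ∀ Q : Submodule k (Fin N → k), (linesIn (Z ∩ Q)).Finite → (linesIn (Z ∩ Q)).ncard ≤ e := by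
  have hint := pullbackQuot_isIntegral hcone hcl hy
  let alg : Algebra (MvPolynomial (Fin M) k) (MvPolynomial (Fin N) k ⧸ vIdeal Z) :=
    (pullbackQuot Z y).toRingHom.toAlgebra
  let mod : Module (MvPolynomial (Fin M) k) (MvPolynomial (Fin N) k ⧸ vIdeal Z) := alg.toModule
  have : FaithfulSMul (MvPolynomial (Fin M) k) (MvPolynomial (Fin N) k ⧸ vIdeal Z) :=
    (faithfulSMul_iff_algebraMap_injective _ _).mpr hinj
  have : Module.Finite (MvPolynomial (Fin M) k) (MvPolynomial (Fin N) k ⧸ vIdeal Z) :=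
    pullbackQuot_finite hcone hcl hy
  obtain ⟨θ, ⟨f, hf, hspan⟩, Δ, hΔ, u, v, huv⟩ := exists_primitive_integral_element
    (A := MvPolynomial (Fin M) k) (R := MvPolynomial (Fin N) k ⧸ vIdeal Z)
  have hmonic := minpoly.monic (hint θ : IsIntegral (MvPolynomial (Fin M) k) θ)
  set p := minpoly (MvPolynomial (Fin M) k) θ
  obtain ⟨θ', rfl⟩ := Ideal.Quotient.mk_surjective θ
  have hg0 : Ideal.Quotient.mk (vIdeal Z) g ≠ 0 := fun h => hg (Ideal.Quotient.eq_zero_iff_mem.mp h)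
  obtain ⟨h, hh0, s, hs⟩ := (Algebra.IsAlgebraic.isAlgebraic (R := MvPolynomial (Fin M) k)
    (Ideal.Quotient.mk (vIdeal Z) g)).exists_nonzero_dvd (mem_nonZeroDivisors_of_ne_zero hg0)
  obtain ⟨s', rfl⟩ := Ideal.Quotient.mk_surjective s
  have hprod : Δ * h * X ⟨0, hM⟩ ≠ 0 := mul_ne_zero (mul_ne_zero hΔ hh0) (X_ne_zero _)
  obtain ⟨a, ha⟩ : ∃ a, eval a (Δ * h * X ⟨0, hM⟩) ≠ 0 := by
    by_contra! hcon
    exact hprod (MvPolynomial.funext fun a => by rw [hcon, map_zero])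
  rw [map_mul, map_mul, eval_X] at ha
  have hΔa := left_ne_zero_of_mul (left_ne_zero_of_mul ha)
  have hha := right_ne_zero_of_mul (left_ne_zero_of_mul ha)
  have hsep : (p.map (eval a)).Separable := by
    have h1 := congrArg (Polynomial.map (eval a)) huv
    simp only [Polynomial.map_add, Polynomial.map_mul, Polynomial.map_C] at h1
    refine ⟨Polynomial.C (eval a Δ)⁻¹ * u.map (eval a),
      Polynomial.C (eval a Δ)⁻¹ * v.map (eval a), ?_⟩
    rw [Polynomial.derivative_map, mul_assoc, mul_assoc, ← mul_add, h1, ← Polynomial.C_mul,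
      inv_mul_cancel₀ hΔa, Polynomial.C_1]
  obtain ⟨ρ, hρ, hroot⟩ := exists_injective_roots hsep
  have hpt : ∀ j, ∃ x ∈ Z, y x = a ∧ eval x θ' = ρ j := fun j =>
    exists_point_of_root hcl hint
      (fun q hq => minpoly.isIntegrallyClosed_dvd (hint _) hq) (hroot j)
  choose x hxZ hxa hxθ using hpt
  refine ⟨a, _, x, ?_, ?_, fun j => ⟨hxZ j, hxa j, ?_⟩, fun Q hQ => ?_⟩
  · rintro rfl
    exact right_ne_zero_of_mul ha rfl
  · intro i j hij
    exact hρ (by rw [← hxθ, ← hxθ, hij])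
  · intro hgx
    apply hha
    have h2 : pullback y h - g * s' ∈ vIdeal Z := by
      rw [← Ideal.Quotient.eq_zero_iff_mem, map_sub, map_mul, ← hs]
      exact sub_self _
    have h3 := h2 (x j) (hxZ j)
    rwa [map_sub, map_mul, hgx, zero_mul, sub_zero, eval_pullback, hxa] at h3
  · rw [hmonic.natDegree_map]
    refine ncard_linesIn_le hcone hcl hdim hQ hy hinj hf
      (θ := Ideal.Quotient.mk (vIdeal Z) θ') fun r => ?_
    obtain ⟨c, hc⟩ := (Submodule.mem_span_range_iff_exists_fun _).mp (hspan r)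
    refine ⟨c, ?_⟩
    refine Eq.trans (Algebra.smul_def f r).symm (hc.symm.trans ?_)
    exact Finset.sum_congr rfl fun i _ => Algebra.smul_def _ _

end GenericFibre

section Image

variable {k : Type*} [Field k] {N r : ℕ} {Z : Set (Fin N → k)}
  {p : (Fin N → k) →ₗ[k] (Fin r → k)}

theorem linesIn_image_inter_subset
    (hcone : ∀ (c : k) (x : Fin N → k), x ∈ Z → c • x ∈ Z) (Q : Submodule k (Fin r → k)) :
    linesIn (p '' Z ∩ Q) ⊆ Submodule.map p '' linesIn (Z ∩ Q.comap p) := by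
  intro L hL
  obtain ⟨_, ⟨⟨x, hx, rfl⟩, hxQ⟩, hx0, rfl⟩ :=
    (mem_linesIn_iff (inter_submodule_cone (image_cone p hcone) Q)).mp hL
  refine ⟨Submodule.span k {x}, (mem_linesIn_iff (inter_submodule_cone hcone _)).mpr
    ⟨x, ⟨hx, hxQ⟩, fun h => hx0 (by rw [h, map_zero]), rfl⟩, ?_⟩
  rw [Submodule.map_span, Set.image_singleton]

variable [IsAlgClosed k]

theorem finite_linesIn_comap (hcone : ∀ (c : k) (x : Fin N → k), x ∈ Z → c • x ∈ Z)
    (hcl : IsSubvariety Z) (hp : ∀ x ∈ Z, p x = 0 → x = 0) {Q : Submodule k (Fin r → k)}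
    (hQ : (linesIn (p '' Z ∩ Q)).Finite) : (linesIn (Z ∩ Q.comap p)).Finite := by
  have hfin : ∀ L ∈ linesIn (p '' Z ∩ Q), (linesIn (Z ∩ L.comap p)).Finite := by
    intro L hL
    obtain ⟨b, -, -, rfl⟩ :=
      (mem_linesIn_iff (inter_submodule_cone (image_cone p hcone) Q)).mp hL
    exact finite_linesIn_comap_span hcone hcl hp b
  refine (hQ.biUnion hfin).subset fun L hL => ?_
  obtain ⟨x, ⟨hx, hxQ⟩, hx0, rfl⟩ := (mem_linesIn_iff (inter_submodule_cone hcone _)).mp hL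
  refine Set.mem_biUnion (x := Submodule.span k {p x}) ?_ ?_
  · exact (mem_linesIn_iff (inter_submodule_cone (image_cone p hcone) Q)).mpr
      ⟨p x, ⟨⟨x, hx, rfl⟩, hxQ⟩, fun h => hx0 (hp x hx h), rfl⟩
  · exact (mem_linesIn_iff (inter_submodule_cone hcone _)).mpr
      ⟨x, ⟨hx, Submodule.mem_span_singleton_self (p x)⟩, hx0, rfl⟩

theorem hasDeg_image [CharZero k] [(vIdeal Z).IsPrime] {d M : ℕ}
    (hcone : ∀ (c : k) (x : Fin N → k), x ∈ Z → c • x ∈ Z) (hcl : IsSubvariety Z)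
    (hdim : coneDim Z = (M : WithBot ℕ∞)) (hM : 0 < M) (hdeg : HasDeg Z d)
    (hp : ∀ x ∈ Z, p x = 0 → x = 0) {g : MvPolynomial (Fin N) k}
    (hg : g ∈ vIdeal (SCset Z (LinearMap.ker p))) (hgZ : g ∉ vIdeal Z) : HasDeg (p '' Z) d := by
  have upper : ∀ Q : Submodule k (Fin r → k), (linesIn (p '' Z ∩ Q)).Finite →
      (linesIn (p '' Z ∩ Q)).ncard ≤ d := by
    intro Q hQ
    have hfin := finite_linesIn_comap hcone hcl hp hQ
    exact (Set.ncard_le_ncard (linesIn_image_inter_subset hcone Q) (hfin.image _)).trans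
      ((Set.ncard_image_le hfin).trans (hdeg.1 _ hfin))
  refine ⟨upper, ?_⟩
  have hne : Z.Nonempty := by
    by_contra hemp
    exact hgZ fun x hx => (hemp ⟨x, hx⟩).elim
  obtain ⟨s, y, hpy, hy, hyinj, hs⟩ := exists_noether_normalization hcone hcl hne
    (LinearMap.ker p) hp
  obtain rfl : M = s := by
    rw [hdim] at hs
    exact_mod_cast hs
  obtain ⟨a, e, x, ha, hxinj, hx, hle⟩ :=
    exists_generic_fibre hcone hcl hdim hM hy hyinj hgZ
  have hde : d ≤ e := by
    obtain ⟨Q, hQ, rfl⟩ := hdeg.2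
    exact hle Q hQ
  have hkey : ((((Submodule.span k {a}).comap y).map p).comap p) = (Submodule.span k {a}).comap y :=
    Submodule.comap_map_eq_self (hpy.trans (LinearMap.ker_le_comap y))
  have hfin : (linesIn (p '' Z ∩ ((Submodule.span k {a}).comap y).map p)).Finite := by
    refine Set.Finite.subset ?_ (linesIn_image_inter_subset hcone _)
    rw [hkey]
    exact (finite_linesIn_comap_span hcone hcl hy a).image _
  refine ⟨((Submodule.span k {a}).comap y).map p, hfin, le_antisymm (upper _ hfin) ?_⟩
  have hx0 : ∀ j, x j ≠ 0 := fun j h => ha (by rw [← (hx j).2.1, h, map_zero])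
  have hinj : Function.Injective fun j => Submodule.span k {p (x j)} := by
    intro i j hij
    have hmem : p (x i) ∈ Submodule.span k {p (x j)} := by
      rw [← show Submodule.span k {p (x i)} = Submodule.span k {p (x j)} from hij]
      exact Submodule.mem_span_singleton_self _
    have hmem' := mem_span_of_map_mem_span hp rfl hg (hx i).1 (hx j).1 (hx i).2.2 (hx0 j) hmem
    obtain ⟨c, hc⟩ := Submodule.mem_span_singleton.mp hmem'
    have h1 : c • a = a := by
      conv_rhs => rw [← (hx i).2.1, ← hc, map_smul, (hx j).2.1]
    have h2 : c = 1 := smul_left_injective k ha (h1.trans (one_smul k a).symm)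
    exact hxinj (by rw [← hc, h2, one_smul])
  calc d ≤ e := hde
    _ = (Set.range fun j => Submodule.span k {p (x j)}).ncard := by
        rw [← Set.image_univ, Set.ncard_image_of_injective _ hinj, Set.ncard_univ, Nat.card_fin]
    _ ≤ _ := by
        refine Set.ncard_le_ncard ?_ hfin
        rintro _ ⟨j, rfl⟩
        refine (mem_linesIn_iff (inter_submodule_cone (image_cone p hcone) _)).mpr
          ⟨p (x j), ⟨⟨x j, (hx j).1, rfl⟩, ⟨x j, ?_, rfl⟩⟩, fun h => hx0 j (hp _ (hx j).1 h), rfl⟩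
        rw [SetLike.mem_coe, Submodule.mem_comap, (hx j).2.1]
        exact Submodule.mem_span_singleton_self a

end Image

/-- Let `X ⊂ P^n` (over an algebraically closed field of
characteristic `0`), represented by its affine cone in `k^{n+1}`, be an integral closed
subvariety of dimension `m ≤ n-2` and degree `d`. Let `Λ = P(W)` be an
`(n-m-2)`-plane (so `finrank W = n-m-1`) with `Λ ∩ X = ∅` and such that the locus
`S_{Λ,X}` of `(n-m-1)`-planes `M ⊇ Λ` meeting `X` in at least two points has dimension
`< m` (encoded: the cone `SCset X W`, of dimension `dim S_{Λ,X} + n - m`, has dimension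
`≤ n - 1`). Then the projection `π_Λ : X → P^{m+1}` from `Λ` (the linear projection
onto a complement `U` of `W`) is birational onto its image; in particular the closure of
`π_Λ(X)` is integral of degree `d`, and every fibre of `π_Λ` on `X` consists of at most
`d` points. -/
theorem statement14 {k : Type*} [Field k] [IsAlgClosed k] [CharZero k] {n m d : ℕ}
    (hm : m + 2 ≤ n) (Xs : Set (Fin (n + 1) → k))
    (hcone : ∀ (c : k) (x : Fin (n + 1) → k), x ∈ Xs → c • x ∈ Xs)
    (hcl : IsSubvariety Xs) (hint : (vIdeal Xs).IsPrime)
    (hdim : coneDim Xs = ((m + 1 : ℕ) : WithBot ℕ∞))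
    (hdeg : HasDeg Xs d)
    (W U : Submodule k (Fin (n + 1) → k))
    (hW : Module.finrank k W = n - m - 1)
    (hWX : (↑W : Set (Fin (n + 1) → k)) ∩ Xs ⊆ {0})
    (hS : coneDim (SCset Xs W) ≤ ((n - 1 : ℕ) : WithBot ℕ∞))
    (hU : IsCompl W U) :
    -- birationality onto the image
    (∃ Xb : Set (Fin (n + 1) → k), IsSubvariety Xb ∧ Xb ⊆ Xs ∧ Xb ≠ Xs ∧
      ∀ x ∈ Xs \ Xb, ∀ y ∈ Xs \ Xb, x ≠ 0 → y ≠ 0 →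
        ((Submodule.linearProjOfIsCompl U W hU.symm x : Fin (n + 1) → k) ∈
          Submodule.span k {(Submodule.linearProjOfIsCompl U W hU.symm y :
            Fin (n + 1) → k)}) →
        x ∈ Submodule.span k {y}) ∧
    -- the (closure of the) image is integral of degree d
    (vIdeal ((fun x => (Submodule.linearProjOfIsCompl U W hU.symm x :
        Fin (n + 1) → k)) '' Xs)).IsPrime ∧
    HasDeg (zeroLocusSet (↑(vIdeal ((fun x =>
        (Submodule.linearProjOfIsCompl U W hU.symm x : Fin (n + 1) → k)) '' Xs)) :
      Set (MvPolynomial (Fin (n + 1)) k))) d ∧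
    -- the fibres consist of at most d (projective) points
    (∀ v : Fin (n + 1) → k,
      (linesIn {x ∈ Xs | (Submodule.linearProjOfIsCompl U W hU.symm x :
          Fin (n + 1) → k) ∈ Submodule.span k {v}}).Finite ∧
      (linesIn {x ∈ Xs | (Submodule.linearProjOfIsCompl U W hU.symm x :
          Fin (n + 1) → k) ∈ Submodule.span k {v}}).ncard ≤ d) := by
  let p : (Fin (n + 1) → k) →ₗ[k] (Fin (n + 1) → k) :=
    U.subtype ∘ₗ Submodule.projectionOnto U W hU.symm
  have hker : LinearMap.ker p = W := by
    rw [LinearMap.ker_comp_of_ker_eq_bot _ U.ker_subtype, Submodule.ker_projectionOnto]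
  have hWZ : ∀ x ∈ Xs, x ∈ W → x = 0 := fun x hx hxW => hWX ⟨hxW, hx⟩
  have hp : ∀ x ∈ Xs, p x = 0 → x = 0 := fun x hx hpx => hWZ x hx (hker ▸ hpx)
  obtain ⟨g, hg, hgX⟩ := exists_mem_vIdeal_SCset hcone hcl hdim hWZ hS (by omega)
  have himage : zeroLocusSet (vIdeal (p '' Xs) : Set (MvPolynomial (Fin (n + 1)) k)) = p '' Xs :=
    zeroLocusSet_vIdeal_image hcone hcl hp
  refine ⟨⟨zeroLocusSet (vIdeal Xs ∪ {g}), isSubvariety_zeroLocusSet _, ?_, ?_, ?_⟩, ?_, ?_,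
    fun v => ?_⟩
  · intro x hx
    rw [hcl]
    exact fun f hf => hx f (Or.inl hf)
  · intro h
    refine hgX fun x hx => ?_
    rw [← h] at hx
    exact hx g (Or.inr rfl)
  · rintro x ⟨hx, hxb⟩ y ⟨hy, -⟩ - hy0 hxy
    refine mem_span_of_map_mem_span hWZ hker hg hx hy (fun hgx => hxb ?_) hy0 hxy
    rintro f (hf | rfl)
    · exact hf x hx
    · exact hgx
  · have hcomap : vIdeal (p '' Xs) = (vIdeal Xs).comap (pullback p) := by
      ext f
      exact (pullback_mem_vIdeal_iff p).symm
    change (vIdeal (p '' Xs)).IsPrime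
    rw [hcomap]
    exact Ideal.comap_isPrime _ _
  · change HasDeg (zeroLocusSet (vIdeal (p '' Xs) : Set (MvPolynomial (Fin (n + 1)) k))) d
    rw [himage]
    exact hasDeg_image hcone hcl hdim (Nat.succ_pos m) hdeg hp (hker.symm ▸ hg) hgX
  · change (linesIn (Xs ∩ (Submodule.span k {v}).comap p)).Finite ∧
      (linesIn (Xs ∩ (Submodule.span k {v}).comap p)).ncard ≤ d
    have hfin := finite_linesIn_comap_span hcone hcl hp v
    exact ⟨hfin, hdeg.1 _ hfin⟩
end
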